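/- arXiv:1601.05445 — 3 statements merged into one kernel-verified Lean document; each statement's English description precedes it below -/
import Mathlib

section
/- For every ε > 0 there exists δ > 0 such that for every finite-dimensional C*-algebra F, every C*-algebra A, and every δ-*-homomorphism φ : F → A, there exists a *-homomorphism ψ : F → A such that ‖ψ(x) − φ(x)‖ < ε for every x in the closed unit ball of F. -/
/-- `φ : A → B` (not assumed linear or continuous) is an `ε`-*-homomorphism. -/
def IsApproxStarHom {A B : Type*}
    [NonUnitalNormedRing A] [StarRing A] [Module ℂ A]
    [NonUnitalNormedRing B] [StarRing B] [Module ℂ B]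
    (ε : ℝ) (φ : A → B) : Prop :=
  (∀ x y : A, ‖x‖ ≤ 1 → ‖y‖ ≤ 1 → ‖φ (x + y) - φ x - φ y‖ ≤ ε) ∧
  (∀ (x : A) (l : ℂ), ‖x‖ ≤ 1 → ‖l‖ ≤ 1 → ‖φ (l • x) - l • φ x‖ ≤ ε) ∧
  (∀ x y : A, ‖x‖ ≤ 1 → ‖y‖ ≤ 1 → ‖φ (x * y) - φ x * φ y‖ ≤ ε) ∧
  (∀ x : A, ‖x‖ ≤ 1 → ‖φ (star x) - star (φ x)‖ ≤ ε) ∧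
  (∀ x : A, ‖x‖ ≤ 1 → ‖φ x‖ ≤ 1 + ε)

universe u v

open MeasureTheory in
lemma us_newton_step {G B : Type*} [Group G] [TopologicalSpace G] [IsTopologicalGroup G]
    [CompactSpace G] [SecondCountableTopology G] [MeasurableSpace G] [BorelSpace G]
    [NormedRing B] [NormedAlgebra ℝ B] [CompleteSpace B]
    (μ : Measure G) [IsProbabilityMeasure μ] [μ.IsMulLeftInvariant]
    (f : C(G, B)) (δ : ℝ) (h1 : f 1 = 1) (hB : ∀ x, ‖f x‖ ≤ 2)
    (hδ : ∀ x y, ‖f (x * y) - f x * f y‖ ≤ δ) :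
    ∃ f' : C(G, B), f' 1 = 1 ∧ (∀ x, ‖f' x - f x‖ ≤ 2 * δ) ∧
      ∀ x y, ‖f' (x * y) - f' x * f' y‖ ≤ 6 * δ ^ 2 := by
  have hδ0 : 0 ≤ δ := (norm_nonneg _).trans (hδ 1 1)
  have h_int : ∀ g : G → B, Continuous g → Integrable g μ := fun g hg =>
    hg.integrable_of_hasCompactSupport (HasCompactSupport.of_compactSpace g)
  have hnorm : ∀ (g : G → B) (C : ℝ), (∀ y, ‖g y‖ ≤ C) → ‖∫ y, g y ∂μ‖ ≤ C := by
    intro g C h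
    simpa using norm_integral_le_of_norm_le_const (μ := μ) (Filter.Eventually.of_forall h)
  let c : G → G → B := fun x y => f (x * y) - f x * f y
  let a : G → B := fun x => ∫ y, c x y * f y⁻¹ ∂μ
  have ha : Continuous a := by
    have := continuous_parametric_integral_of_continuous (μ := μ)
      (f := fun x y => c x y * f y⁻¹) (by simp only [c, Function.uncurry_def]; fun_prop) isCompact_univ
    simpa [a] using this
  have hcont : ∀ x, Continuous (c x) := fun x => by simp only [c]; fun_prop
  have han : ∀ x, ‖a x‖ ≤ 2 * δ := by
    intro x
    refine hnorm _ _ fun y => (norm_mul_le _ _).trans ?_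
    have := mul_le_mul (hδ x y) (hB y⁻¹) (norm_nonneg _) hδ0
    simp only [c]; linarith
  refine ⟨⟨fun x => f x + a x, by fun_prop⟩, ?_, ?_, ?_⟩
  · simp [a, c, h1]
  · intro x; simpa using han x
  · intro x z
    simp only [ContinuousMap.coe_mk]
    have key : (f x + a x) * (f z + a z) - (f (x * z) + a (x * z)) =
        a x * a z + (∫ y, c x z * (f y * f y⁻¹ - 1) ∂μ) - ∫ y, c x y * c y⁻¹ z ∂μ := by
      have e1 : f x * a z = ∫ y, f x * (c z y * f y⁻¹) ∂μ :=
        (integral_const_mul_of_integrable (h_int _ (by have := hcont z; fun_prop))).symm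
      have e2 : a x * f z = ∫ y, (c x y * f y⁻¹) * f z ∂μ :=
        (integral_mul_const_of_integrable (h_int _ (by have := hcont x; fun_prop))).symm
      have e3 : ∫ y, c x (z * y) * f y⁻¹ ∂μ = ∫ y, c x y * f (y⁻¹ * z) ∂μ := by
        rw [← integral_mul_left_eq_self (fun y => c x y * f (y⁻¹ * z)) z]
        simp
      have e4 : f x * a z - a (x * z) =
          (∫ y, c x z * (f y * f y⁻¹ - 1) ∂μ) + c x z - ∫ y, c x (z * y) * f y⁻¹ ∂μ := by
        have : c x z = ∫ y, c x z ∂μ := by simp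
        rw [e1, add_sub_assoc]
        nth_rewrite 2 [this]
        simp only [a]
        rw [← integral_sub, ← integral_sub, ← integral_add]
        · congr 1; ext y
          simp only [c, mul_assoc]
          noncomm_ring
        all_goals
          have := hcont x
          have := hcont z
          have := hcont (x * z)
          apply h_int; fun_prop
      have e5 : a x * f z - (∫ y, c x y * f (y⁻¹ * z) ∂μ) = - ∫ y, c x y * c y⁻¹ z ∂μ := by
        rw [e2, ← integral_sub, ← integral_neg]
        · congr 1; ext y
          simp only [c, mul_assoc]
          noncomm_ring
        all_goals
          have := hcont x
          apply h_int; fun_prop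
      have e6 : c x z = f (x * z) - f x * f z := rfl
      have : (f x + a x) * (f z + a z) - (f (x * z) + a (x * z)) =
        a x * a z + (f x * a z - a (x * z)) + a x * f z - c x z := by rw [e6]; noncomm_ring
      rw [this, e4, e3]
      rw [sub_eq_iff_eq_add] at e5
      rw [e5]; abel
    rw [norm_sub_rev, key]
    have n1 : ‖a x * a z‖ ≤ (2 * δ) * (2 * δ) := (norm_mul_le _ _).trans
      (mul_le_mul (han x) (han z) (norm_nonneg _) (by positivity))
    have n2 : ‖∫ y, c x z * (f y * f y⁻¹ - 1) ∂μ‖ ≤ δ * δ := by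
      refine hnorm _ _ fun y => (norm_mul_le _ _).trans
        (mul_le_mul (hδ x z) ?_ (norm_nonneg _) hδ0)
      have := hδ y y⁻¹
      rwa [mul_inv_cancel, h1, norm_sub_rev] at this
    have n3 : ‖∫ y, c x y * c y⁻¹ z ∂μ‖ ≤ δ * δ :=
      hnorm _ _ fun y => (norm_mul_le _ _).trans
        (mul_le_mul (hδ x y) (hδ _ z) (norm_nonneg _) hδ0)
    have := norm_sub_le (a x * a z + (∫ y, c x z * (f y * f y⁻¹ - 1) ∂μ)) (∫ y, c x y * c y⁻¹ z ∂μ)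
    have := norm_add_le (a x * a z) (∫ y, c x z * (f y * f y⁻¹ - 1) ∂μ)
    nlinarith

open MeasureTheory in
lemma us_newton {G B : Type*} [Group G] [TopologicalSpace G] [IsTopologicalGroup G]
    [CompactSpace G] [SecondCountableTopology G] [MeasurableSpace G] [BorelSpace G]
    [NormedRing B] [NormedAlgebra ℝ B] [CompleteSpace B]
    (μ : Measure G) [IsProbabilityMeasure μ] [μ.IsMulLeftInvariant]
    (f : C(G, B)) (δ : ℝ) (hδs : δ ≤ 1 / 12) (h1 : f 1 = 1) (hB : ∀ x, ‖f x‖ ≤ 3 / 2)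
    (hδ : ∀ x y, ‖f (x * y) - f x * f y‖ ≤ δ) :
    ∃ f' : C(G, B), f' 1 = 1 ∧ (∀ x, ‖f' x - f x‖ ≤ 4 * δ) ∧
      ∀ x y, f' (x * y) = f' x * f' y := by
  have hδ0 : 0 ≤ δ := (norm_nonneg _).trans (hδ 1 1)
  let Q : ℕ → C(G, B) → Prop := fun n g => g 1 = 1 ∧
    (∀ x, ‖g x - f x‖ ≤ 4 * δ * (1 - (1 / 2) ^ n)) ∧
      ∀ x y, ‖g (x * y) - g x * g y‖ ≤ δ * (1 / 2) ^ n
  have step : ∀ n g, Q n g → ∃ g', Q (n + 1) g' ∧ ∀ x, ‖g' x - g x‖ ≤ 2 * δ * (1 / 2) ^ n := by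
    rintro n g ⟨g1, g2, g3⟩
    have hp : (0 : ℝ) < (1 / 2) ^ n := by positivity
    have hp1 : ((1 : ℝ) / 2) ^ n ≤ 1 := pow_le_one₀ (by norm_num) (by norm_num)
    obtain ⟨g', k1, k2, k3⟩ := us_newton_step μ g (δ * (1 / 2) ^ n) g1 (fun x => by
      have := norm_le_norm_add_norm_sub' (g x) (f x)
      have := g2 x; have := hB x
      nlinarith) g3
    refine ⟨g', ⟨k1, fun x => ?_, fun x y => (k3 x y).trans ?_⟩, fun x => by have := k2 x; linarith⟩
    · have := norm_sub_le_norm_sub_add_norm_sub (g' x) (g x) (f x)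
      have := g2 x; have := k2 x
      rw [pow_succ]; linarith
    · rw [pow_succ (1 / 2 : ℝ) n]
      have : δ * (1 / 2) ^ n ≤ 1 / 12 := by nlinarith
      have : 0 ≤ δ * (1 / 2) ^ n := by positivity
      nlinarith
  choose! S hS1 hS2 using step
  let F : ℕ → C(G, B) := fun n => Nat.rec f (fun n g => S n g) n
  have hF : ∀ n, Q n (F n) := by
    intro n
    induction n with
    | zero => exact ⟨h1, fun x => by simp [F], fun x y => by simpa [F] using hδ x y⟩
    | succ n ih => exact hS1 n _ ih
  have hd : ∀ n, dist (F n) (F (n + 1)) ≤ 2 * δ * (1 / 2) ^ n := by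
    intro n
    rw [dist_comm, ContinuousMap.dist_le (by positivity)]
    intro x
    rw [dist_eq_norm]
    exact hS2 n _ (hF n) x
  obtain ⟨L, hL⟩ := cauchySeq_tendsto_of_complete
    (cauchySeq_of_le_geometric (1 / 2) (2 * δ) (by norm_num) hd)
  have hpt : ∀ x, Filter.Tendsto (fun n => F n x) Filter.atTop (nhds (L x)) := fun x =>
    ((continuous_eval_const (F := C(G, B)) x).tendsto L).comp hL
  refine ⟨L, ?_, ?_, ?_⟩
  · refine tendsto_nhds_unique (hpt 1) ?_
    simp [(hF _).1]
  · intro x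
    have := dist_le_of_le_geometric_of_tendsto₀ (1 / 2) (2 * δ) (by norm_num) hd hL
    rw [← dist_eq_norm, dist_comm]
    refine (ContinuousMap.dist_apply_le_dist x).trans (this.trans (le_of_eq ?_))
    ring
  · intro x y
    have t1 : Filter.Tendsto (fun n => F n (x * y) - F n x * F n y) Filter.atTop
      (nhds (L (x * y) - L x * L y)) := (hpt _).sub ((hpt x).mul (hpt y))
    have t2 : Filter.Tendsto (fun n => F n (x * y) - F n x * F n y) Filter.atTop (nhds 0) := by
      refine squeeze_zero_norm (fun n => (hF n).2.2 x y) ?_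
      simpa using (tendsto_pow_atTop_nhds_zero_of_lt_one (r := (1 : ℝ) / 2) (by norm_num)
        (by norm_num)).const_mul δ
    exact sub_eq_zero.mp (tendsto_nhds_unique t1 t2)

lemma us_norm_le_one {B : Type*} [NormedRing B] [StarRing B] [CStarRing B] {u : B}
    (hu : u ∈ unitary B) : ‖u‖ ≤ 1 := by
  nontriviality B
  exact (CStarRing.norm_of_mem_unitary hu).le

lemma us_proj_norm {B : Type*} [NormedRing B] [StarRing B] [CStarRing B] {p : B}
    (hp : IsStarProjection p) : ‖p‖ ≤ 1 := by
  have h : ‖p‖ * ‖p‖ = ‖p‖ := by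
    rw [← CStarRing.norm_star_mul_self, hp.isSelfAdjoint.star_eq, hp.isIdempotentElem.eq]
  nlinarith [norm_nonneg p, sq_nonneg (‖p‖ - 1)]

open MeasureTheory in
lemma us_unitarize {G B : Type*} [Group G] [TopologicalSpace G] [IsTopologicalGroup G]
    [CompactSpace G] [SecondCountableTopology G] [MeasurableSpace G] [BorelSpace G]
    [CStarAlgebra B]
    (μ : Measure G) [IsProbabilityMeasure μ] [μ.IsMulLeftInvariant]
    (f : C(G, B)) (η : ℝ) (hη : η ≤ 1 / 2) (h1 : f 1 = 1) (hm : ∀ x y, f (x * y) = f x * f y)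
    (hB : ∀ x, ‖f x‖ ≤ 2)
    (hs : ∀ x, ‖star (f x) * f x - 1‖ ≤ η) :
    ∃ r : G → B, r 1 = 1 ∧ (∀ x y, r (x * y) = r x * r y) ∧ (∀ x, r x ∈ unitary B) ∧
      ∀ x, ‖r x - f x‖ ≤ 8 * η := by
  have hη0 : 0 ≤ η := (norm_nonneg _).trans (hs 1)
  have h_int : ∀ g : G → B, Continuous g → Integrable g μ := fun g hg =>
    hg.integrable_of_hasCompactSupport (HasCompactSupport.of_compactSpace g)
  let _ : PartialOrder B := CStarAlgebra.spectralOrder B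
  have _ : StarOrderedRing B := CStarAlgebra.spectralOrderedRing B
  set h : B := ∫ y, star (f y⁻¹) * f y⁻¹ ∂μ with hh
  have hinv : ∀ x, star (f x) * h * f x = h := by
    intro x
    rw [hh, ← integral_const_mul_of_integrable (h_int _ (by fun_prop)),
      ← integral_mul_const_of_integrable (h_int _ (by fun_prop)),
      ← integral_mul_left_eq_self (fun y => star (f y⁻¹) * f y⁻¹) x⁻¹]
    congr 1; ext y
    simp only [mul_inv_rev, inv_inv, hm, star_mul, mul_assoc]
  have hh1 : ‖h - 1‖ ≤ η := by
    have : h - 1 = ∫ y, (star (f y⁻¹) * f y⁻¹ - 1) ∂μ := by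
      rw [integral_sub (h_int _ (by fun_prop)) (h_int _ (by fun_prop))]; simp [hh]
    rw [this]
    simpa using norm_integral_le_of_norm_le_const (μ := μ) (Filter.Eventually.of_forall
      (fun y => hs y⁻¹))
  have hpos : 0 ≤ h := integral_nonneg fun y => star_mul_self_nonneg _
  have hsa : IsSelfAdjoint h := IsSelfAdjoint.of_nonneg hpos
  have hspec : ∀ x ∈ spectrum ℝ h, |x - 1| ≤ η := by
    intro x hx
    have hx' : x - 1 ∈ spectrum ℝ (h - 1) := by
      have h2 := spectrum.add_mem_add_iff (R := ℝ) (a := h - 1) (r := x - 1) (s := 1)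
      rw [← h2]; simpa using hx
    cases subsingleton_or_nontrivial B
    · simp [spectrum.of_subsingleton] at hx
    · exact (spectrum.norm_le_norm_of_mem hx').trans hh1
  set S := CFC.sqrt h with hS
  have hSS : S * S = h := CFC.sqrt_mul_sqrt_self h
  have hSsa : star S = S := (IsSelfAdjoint.of_nonneg (CFC.sqrt_nonneg h)).star_eq
  have hSn : ‖S - 1‖ ≤ η := by
    rw [hS, CFC.sqrt_eq_real_sqrt h, cfcₙ_eq_cfc]
    have : cfc Real.sqrt h - 1 = cfc (fun x => Real.sqrt x - 1) h := by
      rw [cfc_sub _ _ _, cfc_const_one ℝ h]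
    rw [this]
    refine norm_cfc_le hη0 fun x hx => ?_
    have hx1 := abs_le.mp (hspec x hx)
    rw [Real.norm_eq_abs]
    have h0 : 0 ≤ x := by linarith
    have e := Real.mul_self_sqrt h0
    have := Real.sqrt_nonneg x
    rw [abs_le]
    constructor <;> nlinarith
  have hunit : IsUnit S := by
    have := isUnit_one_sub_of_norm_lt_one (x := 1 - S) (by rw [norm_sub_rev]; linarith)
    simpa using this
  obtain ⟨U, hU⟩ := hunit
  have hinvn : ‖(↑U⁻¹ : B)‖ ≤ 2 := by
    have e : (↑U⁻¹ : B) = 1 - (S - 1) * ↑U⁻¹ := by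
      rw [← hU, sub_mul, U.mul_inv, one_mul]; abel
    have n1 : ‖(↑U⁻¹ : B)‖ ≤ ‖(1 : B)‖ + ‖(S - 1) * ↑U⁻¹‖ := by
      conv_lhs => rw [e]
      exact norm_sub_le _ _
    have n2 := norm_mul_le (S - 1) (↑U⁻¹ : B)
    have n3 := us_norm_le_one (one_mem (unitary B))
    nlinarith [norm_nonneg (↑U⁻¹ : B)]
  have hUs : star (↑U⁻¹ : B) = ↑U⁻¹ := by
    have : star U = U := Units.ext (by simp [hU, hSsa])
    rw [← Units.coe_star, star_inv, this]
  refine ⟨fun x => S * f x * ↑U⁻¹, ?_, ?_, ?_, ?_⟩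
  · simp [h1, ← hU]
  · intro x y
    simp only [← hU, hm, mul_assoc, Units.inv_mul_cancel_left]
  · intro x
    have a1 : star (S * f x * ↑U⁻¹) * (S * f x * ↑U⁻¹) = 1 := by
      simp only [star_mul, hUs, hSsa]
      calc ↑U⁻¹ * (star (f x) * S) * (S * f x * ↑U⁻¹) = ↑U⁻¹ * (star (f x) * (S * S) * f x) * ↑U⁻¹ := by
            noncomm_ring
        _ = 1 := by rw [hSS, hinv, ← hSS, ← hU]; simp [mul_assoc]
    have a2 : (S * f x * ↑U⁻¹) * (S * f x⁻¹ * ↑U⁻¹) = 1 := by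
      have : f x * f x⁻¹ = 1 := by rw [← hm, mul_inv_cancel, h1]
      calc (S * f x * ↑U⁻¹) * (S * f x⁻¹ * ↑U⁻¹) = S * (f x * ((↑U⁻¹ * S) * f x⁻¹)) * ↑U⁻¹ := by noncomm_ring
        _ = 1 := by rw [← hU]; simp [this]
    rw [Unitary.mem_iff]
    refine ⟨a1, ?_⟩
    have := left_inv_eq_right_inv a1 a2
    rw [this, a2]
  · intro x
    have e : S * f x * ↑U⁻¹ - f x = ((S - 1) * f x - f x * (S - 1)) * ↑U⁻¹ := by
      have : f x = f x * S * ↑U⁻¹ := by rw [← hU]; simp [mul_assoc]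
      nth_rewrite 2 [this]
      noncomm_ring
    rw [e]
    have n1 := norm_mul_le ((S - 1) * f x - f x * (S - 1)) (↑U⁻¹ : B)
    have n2 := norm_sub_le ((S - 1) * f x) (f x * (S - 1))
    have n3 := norm_mul_le (S - 1) (f x)
    have n4 := norm_mul_le (f x) (S - 1)
    have n5 : ‖S - 1‖ * ‖f x‖ ≤ η * 2 := mul_le_mul hSn (hB x) (norm_nonneg _) hη0
    have n6 : ‖(S - 1) * f x - f x * (S - 1)‖ ≤ 4 * η := by nlinarith
    have n7 := mul_le_mul n6 hinvn (norm_nonneg _) (by linarith)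
    linarith

/-- quantitative absence of small subgroups -/
lemma us_nss {B : Type*} [NormedRing B] [NormedAlgebra ℂ B] (W : B) (J : ℕ)
    (h : ∀ j ≤ J, ‖W ^ (2 ^ j) - 1‖ ≤ 1 / 4) : (7 / 4) ^ J * ‖W - 1‖ ≤ 1 / 4 := by
  have : ∀ j ≤ J, (7 / 4) ^ j * ‖W - 1‖ ≤ ‖W ^ (2 ^ j) - 1‖ := by
    intro j
    induction j with
    | zero => simp
    | succ j ih =>
      intro hj
      have i1 := ih (by omega)
      have i2 := h j (by omega)
      set V := W ^ (2 ^ j)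
      have e : W ^ (2 ^ (j + 1)) = V * V := by rw [pow_succ, pow_mul, pow_two]
      have e2 : (2 : ℝ) * ‖V - 1‖ ≤ ‖V * V - 1‖ + ‖V - 1‖ * ‖V - 1‖ := by
        have : V - 1 + (V - 1) = (V * V - 1) - (V - 1) * (V - 1) := by noncomm_ring
        have h1 := norm_sub_le (V * V - 1) ((V - 1) * (V - 1))
        have h2 := norm_mul_le (V - 1) (V - 1)
        rw [← this] at h1
        have h3 : ‖V - 1 + (V - 1)‖ = 2 * ‖V - 1‖ := by
          rw [← two_smul ℂ, norm_smul]; simp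
        linarith
      rw [e, pow_succ]
      nlinarith [norm_nonneg (V - 1)]
  exact (this J le_rfl).trans (h J le_rfl)

/-- A group homomorphism between unitary groups which is close to being affine. -/
structure USHom {F B : Type*} [CStarAlgebra F] [CStarAlgebra B] (R : F → B) : Prop where
  map_one : R 1 = 1
  map_mul : ∀ u ∈ unitary F, ∀ v ∈ unitary F, R (u * v) = R u * R v
  mem : ∀ u ∈ unitary F, R u ∈ unitary B
  aff : ∀ p : F, IsStarProjection p → ∃ q : B, ∀ w : ℂ, ‖w‖ = 1 →
    ‖R (1 + (w - 1) • p) - (1 + (w - 1) • q)‖ ≤ 1 / 16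
  neg : ‖R (-1) + 1‖ ≤ 1 / 4
  small : ∀ u ∈ unitary F, ‖u - 1‖ ≤ 1 / 100 → ‖R u - 1‖ ≤ 1 / 4

lemma us_c_mul {F : Type*} [CStarAlgebra F] {p : F} (hp : IsStarProjection p) (w v : ℂ) :
    (1 + (w - 1) • p) * (1 + (v - 1) • p) = 1 + (w * v - 1) • p := by
  simp only [mul_add, add_mul, mul_one, one_mul, smul_mul_assoc, mul_smul_comm,
    hp.isIdempotentElem.eq]
  module

lemma us_norm_inv {w : ℂ} (hw : ‖w‖ = 1) : star w = w⁻¹ := by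
  have : w ≠ 0 := by rintro rfl; simp at hw
  rw [Complex.inv_def, Complex.normSq_eq_norm_sq, hw]; simp

lemma us_c_mem {F : Type*} [CStarAlgebra F] {p : F} (hp : IsStarProjection p) {w : ℂ}
    (hw : ‖w‖ = 1) : 1 + (w - 1) • p ∈ unitary F := by
  have h0 : w ≠ 0 := by rintro rfl; simp at hw
  have hs : star (1 + (w - 1) • p) = 1 + (w⁻¹ - 1) • p := by
    rw [← us_norm_inv hw]; simp [hp.isSelfAdjoint.star_eq]
  rw [Unitary.mem_iff, hs, us_c_mul hp, us_c_mul hp]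
  simp [h0]

/-- the projection associated to a projection -/
noncomputable def usP {F B : Type*} [CStarAlgebra F] [CStarAlgebra B] (R : F → B) (p : F) : B :=
  (1 / 2 : ℂ) • (1 - R (1 + ((-1 : ℂ) - 1) • p))

section
variable {F B : Type*} [CStarAlgebra F] [CStarAlgebra B] {R : F → B}

lemma usP_spec (R : F → B) (p : F) :
    R (1 + ((-1 : ℂ) - 1) • p) = 1 + ((-1 : ℂ) - 1) • usP R p := by
  simp only [usP]; module

lemma usP_proj (hR : USHom R) {p : F} (hp : IsStarProjection p) : IsStarProjection (usP R p) := by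
  have hm := us_c_mem hp (w := -1) (by simp)
  have h1 : R (1 + ((-1 : ℂ) - 1) • p) * R (1 + ((-1 : ℂ) - 1) • p) = 1 := by
    rw [← hR.map_mul _ hm _ hm, us_c_mul hp]; simp [hR.map_one]
  have h2 : star (R (1 + ((-1 : ℂ) - 1) • p)) = R (1 + ((-1 : ℂ) - 1) • p) :=
    left_inv_eq_right_inv (Unitary.mem_iff.mp (hR.mem _ hm)).1 h1
  constructor
  · unfold IsIdempotentElem usP
    simp only [smul_mul_assoc, mul_smul_comm, mul_sub, sub_mul, mul_one, one_mul, h1]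
    module
  · unfold IsSelfAdjoint usP
    rw [star_smul, star_sub, h2, star_one]
    simp

lemma usR_c (hR : USHom R) {p : F} (hp : IsStarProjection p) {z : ℂ} (hz : ‖z‖ = 1) :
    R (1 + (z - 1) • p) = 1 + (z - 1) • usP R p := by
  have hP := usP_proj hR hp
  set P := usP R p with hPdef
  let V : ℂ → B := fun w => R (1 + (w - 1) • p) * (1 + (w⁻¹ - 1) • P)
  have hcomm : ∀ w : ℂ, ‖w‖ = 1 → Commute (R (1 + (w - 1) • p)) P := by
    intro w hw
    have hm := us_c_mem hp (w := -1) (by simp)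
    have hmw := us_c_mem hp hw
    have : Commute (R (1 + (w - 1) • p)) (R (1 + ((-1 : ℂ) - 1) • p)) := by
      unfold Commute SemiconjBy
      rw [← hR.map_mul _ hm _ hmw, ← hR.map_mul _ hmw _ hm, us_c_mul hp, us_c_mul hp, mul_comm]
    rw [hPdef]; unfold usP
    exact ((Commute.one_right _).sub_right this).smul_right _
  have hVmul : ∀ w v : ℂ, ‖w‖ = 1 → ‖v‖ = 1 → V (w * v) = V w * V v := by
    intro w v hw hv
    have c1 : Commute (1 + (w⁻¹ - 1) • P) (R (1 + (v - 1) • p)) :=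
      ((Commute.one_right _).add_right ((hcomm v hv).smul_right _)).symm
    simp only [V]
    rw [← us_c_mul hp, hR.map_mul _ (us_c_mem hp hw) _ (us_c_mem hp hv), mul_inv, ← us_c_mul hP]
    rw [mul_assoc, mul_assoc, ← mul_assoc (R (1 + (v - 1) • p)), ← c1.eq, mul_assoc]
  have hVpow : ∀ n : ℕ, V z ^ n = V (z ^ n) := by
    intro n
    induction n with
    | zero => simp [V, hR.map_one]
    | succ n ih => rw [pow_succ, ih, pow_succ, hVmul _ _ (by simp [hz]) hz]
  obtain ⟨q, hq⟩ := hR.aff p hp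
  have hPq : ‖P - q‖ ≤ 1 / 32 := by
    have := hq (-1) (by simp)
    rw [usP_spec R p, ← hPdef] at this
    have e : (1 + ((-1 : ℂ) - 1) • P) - (1 + ((-1 : ℂ) - 1) • q) = (-2 : ℂ) • (P - q) := by module
    rw [e, norm_smul] at this
    norm_num at this
    linarith
  have hVn : ∀ w : ℂ, ‖w‖ = 1 → ‖V w - 1‖ ≤ 1 / 8 := by
    intro w hw
    have h0 : w ≠ 0 := by rintro rfl; simp at hw
    have e : V w - 1 = (R (1 + (w - 1) • p) - (1 + (w - 1) • P)) * (1 + (w⁻¹ - 1) • P) := by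
      rw [sub_mul, us_c_mul hP]; simp [V, h0]
    have e2 : R (1 + (w - 1) • p) - (1 + (w - 1) • P) =
      (R (1 + (w - 1) • p) - (1 + (w - 1) • q)) - (w - 1) • (P - q) := by module
    have n1 : ‖(w - 1) • (P - q)‖ ≤ 2 * (1 / 32) := by
      rw [norm_smul]
      refine mul_le_mul ?_ hPq (norm_nonneg _) (by norm_num)
      have := norm_sub_le w 1
      simp [hw] at this; linarith
    have n2 := hq w hw
    have n3 := norm_sub_le (R (1 + (w - 1) • p) - (1 + (w - 1) • q)) ((w - 1) • (P - q))
    have n4 := us_norm_le_one (us_c_mem hP (w := w⁻¹) (by simp [hw]))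
    rw [e, e2]
    refine (norm_mul_le _ _).trans ?_
    have := mul_le_mul (n3.trans (add_le_add n2 n1)) n4 (norm_nonneg _) (by norm_num)
    linarith
  have hV1 : V z = 1 := by
    by_contra hne
    have hpos : 0 < ‖V z - 1‖ := norm_pos_iff.mpr (sub_ne_zero.mpr hne)
    obtain ⟨J, hJ⟩ := pow_unbounded_of_one_lt (1 / ‖V z - 1‖) (by norm_num : (1 : ℝ) < 7 / 4)
    have := us_nss (V z) J (fun j _ => by
      rw [hVpow]; exact (hVn _ (by simp [hz])).trans (by norm_num))
    rw [div_lt_iff₀ hpos] at hJ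
    linarith
  have h0 : z ≠ 0 := by rintro rfl; simp at hz
  calc R (1 + (z - 1) • p) = R (1 + (z - 1) • p) * ((1 + (z⁻¹ - 1) • P) * (1 + (z - 1) • P)) := by
        rw [us_c_mul hP]; simp [h0]
    _ = V z * (1 + (z - 1) • P) := by simp only [V, mul_assoc]
    _ = _ := by rw [hV1, one_mul]

lemma usP_one (hR : USHom R) : usP R 1 = 1 := by
  have hP := usP_proj hR (IsStarProjection.one F)
  have e : R (-1) = 1 + ((-1 : ℂ) - 1) • usP R 1 := by
    rw [← usP_spec R 1]; congr 1; module
  have n := hR.neg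
  have e2 : R (-1) + 1 = (2 : ℂ) • (1 - usP R 1) := by rw [e]; module
  rw [e2, norm_smul] at n
  norm_num at n
  have hid : (1 - usP R 1) * (1 - usP R 1) = 1 - usP R 1 := hP.isIdempotentElem.one_sub.eq
  have := norm_mul_le (1 - usP R 1) (1 - usP R 1)
  rw [hid] at this
  have h0 : ‖1 - usP R 1‖ = 0 := by nlinarith [norm_nonneg (1 - usP R 1)]
  exact (sub_eq_zero.mp (norm_eq_zero.mp h0)).symm

lemma usP_orth (hR : USHom R) {p q : F} (hp : IsStarProjection p) (hq : IsStarProjection q)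
    (hpq : p * q = 0) : usP R p * usP R q = 0 ∧ usP R (p + q) = usP R p + usP R q := by
  have hqp : q * p = 0 := by
    have := congrArg star hpq
    simpa [hp.isSelfAdjoint.star_eq, hq.isSelfAdjoint.star_eq] using this
  have hpq' : IsStarProjection (p + q) := hp.add hq hpq
  have key : ∀ z : ℂ, ‖z‖ = 1 → (1 + (z - 1) • usP R (p + q)) =
      (1 + (z - 1) • usP R p) * (1 + (z - 1) • usP R q) := by
    intro z hz
    rw [← usR_c hR hp hz, ← usR_c hR hq hz, ← usR_c hR hpq' hz,
      ← hR.map_mul _ (us_c_mem hp hz) _ (us_c_mem hq hz)]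
    congr 1
    simp only [mul_add, add_mul, mul_one, one_mul, smul_mul_assoc, mul_smul_comm, hpq]
    module
  have key2 : ∀ z : ℂ, ‖z‖ = 1 → z ≠ 1 → usP R (p + q) =
      usP R p + usP R q + (z - 1) • (usP R p * usP R q) := by
    intro z hz hz1
    have := key z hz
    simp only [mul_add, add_mul, mul_one, one_mul, smul_mul_assoc, mul_smul_comm] at this
    have h2 : (z - 1) • usP R (p + q) =
      (z - 1) • (usP R p + usP R q + (z - 1) • (usP R p * usP R q)) := by
      have h3 := sub_eq_zero.mpr this
      rw [← sub_eq_zero, ← h3]; module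
    exact smul_right_injective B (sub_ne_zero.mpr hz1) h2
  have a := key2 (-1) (by simp) (by norm_num)
  have b := key2 Complex.I (by simp) (by simp [Complex.ext_iff])
  have hprod : usP R p * usP R q = 0 := by
    have h2 : (Complex.I + 1) • (usP R p * usP R q) = 0 := by
      have h3 := sub_eq_zero.mpr (b.symm.trans a)
      rw [← h3]; module
    rcases smul_eq_zero.mp h2 with h | h
    · simp [Complex.ext_iff] at h
    · exact h
  exact ⟨hprod, by rw [a, hprod]; simp⟩

/-- unitaries built from orthogonal families -/
lemma usR_sum (hR : USHom R) {ι : Type*} (s : Finset ι) (p : ι → F)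
    (hp : ∀ i ∈ s, IsStarProjection (p i)) (ho : ∀ i ∈ s, ∀ j ∈ s, i ≠ j → p i * p j = 0)
    (hsum : ∑ i ∈ s, p i = 1) (z : ι → ℂ) (hz : ∀ i ∈ s, ‖z i‖ = 1) :
    (∑ i ∈ s, z i • p i ∈ unitary F) ∧ R (∑ i ∈ s, z i • p i) = ∑ i ∈ s, z i • usP R (p i) ∧
      ∑ i ∈ s, usP R (p i) = 1 := by
  classical
  have main : ∀ t ⊆ s, (1 + ∑ i ∈ t, (z i - 1) • p i ∈ unitary F) ∧
      R (1 + ∑ i ∈ t, (z i - 1) • p i) = 1 + ∑ i ∈ t, (z i - 1) • usP R (p i) ∧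
      IsStarProjection (∑ i ∈ t, p i) ∧ usP R (∑ i ∈ t, p i) = ∑ i ∈ t, usP R (p i) := by
    intro t
    induction t using Finset.induction_on with
    | empty =>
      intro _
      refine ⟨by simp, by simp [hR.map_one], by simp, by simp [usP, hR.map_one]⟩
    | insert a t ha ih =>
      intro hsub
      have has : a ∈ s := hsub (Finset.mem_insert_self a t)
      have hts : t ⊆ s := fun i hi => hsub (Finset.mem_insert_of_mem hi)
      obtain ⟨i1, i2, i3, i4⟩ := ih hts
      have hne : ∀ i ∈ t, a ≠ i := fun i hi h => ha (h ▸ hi)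
      have o1 : p a * ∑ i ∈ t, (z i - 1) • p i = 0 := by
        rw [Finset.mul_sum]
        exact Finset.sum_eq_zero fun i hi => by
          rw [mul_smul_comm, ho a has i (hts hi) (hne i hi), smul_zero]
      have o2 : usP R (p a) * ∑ i ∈ t, (z i - 1) • usP R (p i) = 0 := by
        rw [Finset.mul_sum]
        exact Finset.sum_eq_zero fun i hi => by
          rw [mul_smul_comm, (usP_orth hR (hp a has) (hp i (hts hi))
            (ho a has i (hts hi) (hne i hi))).1, smul_zero]
      have o3 : p a * ∑ i ∈ t, p i = 0 := by
        rw [Finset.mul_sum]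
        exact Finset.sum_eq_zero fun i hi => ho a has i (hts hi) (hne i hi)
      have e : 1 + ∑ i ∈ insert a t, (z i - 1) • p i =
          (1 + (z a - 1) • p a) * (1 + ∑ i ∈ t, (z i - 1) • p i) := by
        rw [Finset.sum_insert ha]
        simp [add_mul, mul_add, o1, add_assoc]
      refine ⟨?_, ?_, ?_, ?_⟩
      · rw [e]; exact mul_mem (us_c_mem (hp a has) (hz a has)) i1
      · rw [e, hR.map_mul _ (us_c_mem (hp a has) (hz a has)) _ i1, i2, usR_c hR (hp a has) (hz a has),
          Finset.sum_insert ha]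
        simp [add_mul, mul_add, o2, add_assoc]
      · rw [Finset.sum_insert ha]; exact (hp a has).add i3 o3
      · rw [Finset.sum_insert ha, Finset.sum_insert ha, (usP_orth hR (hp a has) i3 o3).2, i4]
  obtain ⟨m1, m2, m3, m4⟩ := main s subset_rfl
  have hP1 : ∑ i ∈ s, usP R (p i) = 1 := by rw [← m4, hsum, usP_one hR]
  have e1 : 1 + ∑ i ∈ s, (z i - 1) • p i = ∑ i ∈ s, z i • p i := by
    simp only [sub_smul, one_smul, Finset.sum_sub_distrib, hsum]; abel
  have e2 : 1 + ∑ i ∈ s, (z i - 1) • usP R (p i) = ∑ i ∈ s, z i • usP R (p i) := by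
    simp only [sub_smul, one_smul, Finset.sum_sub_distrib, hP1]; abel
  rw [e1] at m1 m2
  exact ⟨m1, by rw [m2, e2], hP1⟩
end

lemma us_finite_spectrum {F : Type*} [CStarAlgebra F] [FiniteDimensional ℂ F] (x : F) :
    (spectrum ℂ x).Finite := by
  cases subsingleton_or_nontrivial F
  · simp [spectrum.of_subsingleton]
  have hi : IsIntegral ℂ x := Algebra.IsIntegral.isIntegral x
  refine ((minpoly ℂ x).rootSet_finite ℂ).subset fun z hz => ?_
  have h := spectrum.subset_polynomial_aeval x (minpoly ℂ x) ⟨z, hz, rfl⟩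
  rw [minpoly.aeval, spectrum.zero_eq, Set.mem_singleton_iff] at h
  rw [Polynomial.mem_rootSet]
  exact ⟨minpoly.ne_zero hi, by simpa using h⟩

lemma us_spectral {F : Type*} [CStarAlgebra F] [FiniteDimensional ℂ F] (x : F)
    (hx : IsStarNormal x) : ∃ (s : Finset ℂ) (p : ℂ → F), (↑s = spectrum ℂ x) ∧
      (∀ z ∈ s, IsStarProjection (p z)) ∧ (∀ z ∈ s, ∀ w ∈ s, z ≠ w → p z * p w = 0) ∧
      (∑ z ∈ s, p z = 1) ∧ x = ∑ z ∈ s, z • p z := by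
  classical
  have hfin := us_finite_spectrum x
  have hc : ∀ f : ℂ → ℂ, ContinuousOn f (spectrum ℂ x) := fun f => hfin.continuousOn f
  let d : ℂ → ℂ → ℂ := fun z w => if w = z then 1 else 0
  refine ⟨hfin.toFinset, fun z => cfc (d z) x, by simp, ?_, ?_, ?_, ?_⟩
  · intro z _
    constructor
    · unfold IsIdempotentElem
      rw [← cfc_mul _ _ x (hc _) (hc _)]
      congr 1; ext w; simp [d]
    · unfold IsSelfAdjoint
      rw [← cfc_star]
      congr 1; ext w; simp only [d]; split_ifs <;> simp
  · intro z _ w _ hzw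
    rw [← cfc_mul _ _ x (hc _) (hc _), ← cfc_zero ℂ x]
    congr 1; ext v; simp only [d, Pi.zero_apply]
    split_ifs with h1 h2 <;> simp_all
  · rw [← cfc_sum _ _ _ (fun i _ => hc _), ← cfc_one ℂ x]
    refine cfc_congr fun w hw => ?_
    simp [d, Finset.sum_ite_eq, hw]
  · have : ∀ z : ℂ, z • cfc (d z) x = cfc (fun w => z • d z w) x := fun z =>
      (cfc_smul z (d z) x (hc _)).symm
    simp only [this]
    rw [← cfc_sum (fun z w => z • d z w) _ _ (fun i _ => hc _)]
    conv_lhs => rw [← cfc_id ℂ x]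
    refine cfc_congr fun w hw => ?_
    simp [d, hw]

section
open Asymptotics Filter Topology
variable {F B : Type*} [CStarAlgebra F] [CStarAlgebra B] {R : F → B}

/-- `a` is the generator of a curve through `R` tangent to `h` -/
def usGen (R : F → B) (h : F) (a : B) : Prop :=
  ∃ u : ℝ → F, (∀ t, u t ∈ unitary F) ∧
    ((fun t : ℝ => u t - (1 + ((t : ℂ) * Complex.I) • h)) =O[𝓝 0] fun t : ℝ => t ^ 2) ∧
    ((fun t : ℝ => R (u t) - (1 + ((t : ℂ) * Complex.I) • a)) =O[𝓝 0] fun t : ℝ => t ^ 2)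

lemma us_bigO_mul {B : Type*} [CStarAlgebra B] {f g : ℝ → B} {a b : B}
    (hf : (fun t : ℝ => f t - (1 + ((t : ℂ) * Complex.I) • a)) =O[𝓝 0] fun t : ℝ => t ^ 2)
    (hg : (fun t : ℝ => g t - (1 + ((t : ℂ) * Complex.I) • b)) =O[𝓝 0] fun t : ℝ => t ^ 2) :
    (fun t : ℝ => f t * g t - (1 + ((t : ℂ) * Complex.I) • (a + b))) =O[𝓝 0]
      fun t : ℝ => t ^ 2 := by
  have hb : ∀ a : B, (fun t : ℝ => (1 + ((t : ℂ) * Complex.I) • a)) =O[𝓝 0] fun _ : ℝ => (1 : ℝ) := by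
    intro a
    have : Continuous fun t : ℝ => (1 + ((t : ℂ) * Complex.I) • a) := by fun_prop
    exact this.continuousAt.isBigO_one ℝ
  have ht : (fun t : ℝ => (t ^ 2 : ℝ)) =O[𝓝 0] fun _ : ℝ => (1 : ℝ) := by
    have : Continuous fun t : ℝ => (t ^ 2 : ℝ) := by fun_prop
    exact this.continuousAt.isBigO_one ℝ
  have hg1 : g =O[𝓝 0] fun _ : ℝ => (1 : ℝ) := by
    have := (hg.trans ht).add (hb b)
    simpa using this
  have e1 := hf.mul hg1
  have e2 := (hb a).mul hg
  have e3 : (fun t : ℝ => ((t : ℂ) * Complex.I * (t * Complex.I)) • (a * b)) =O[𝓝 0]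
      fun t : ℝ => t ^ 2 := by
    refine IsBigO.of_bound ‖a * b‖ (Eventually.of_forall fun t => ?_)
    rw [norm_smul]
    simp [mul_comm, pow_two]
  simp only [mul_one, one_mul] at e1 e2
  refine ((e1.add e2).add e3).congr_left fun t => ?_
  simp only [sub_mul, mul_sub, add_mul, mul_add, mul_one, one_mul, smul_mul_assoc, mul_smul_comm,
    smul_smul, smul_add]
  abel

lemma usGen.add (hR : USHom R) {h k : F} {a b : B} (h1 : usGen R h a) (h2 : usGen R k b) :
    usGen R (h + k) (a + b) := by
  obtain ⟨u, u1, u2, u3⟩ := h1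
  obtain ⟨v, v1, v2, v3⟩ := h2
  refine ⟨fun t => u t * v t, fun t => mul_mem (u1 t) (v1 t), us_bigO_mul u2 v2, ?_⟩
  refine (us_bigO_mul u3 v3).congr_left fun t => ?_
  rw [hR.map_mul _ (u1 t) _ (v1 t)]

lemma usGen.smul {h : F} {a : B} (h1 : usGen R h a) (r : ℝ) :
    usGen R ((r : ℂ) • h) ((r : ℂ) • a) := by
  obtain ⟨u, u1, u2, u3⟩ := h1
  have ht : Tendsto (fun t : ℝ => t * r) (𝓝 0) (𝓝 0) := by
    have : Continuous fun t : ℝ => t * r := by fun_prop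
    simpa using this.tendsto 0
  have hO : (fun t : ℝ => (t * r) ^ 2) =O[𝓝 0] fun t : ℝ => t ^ 2 := by
    refine IsBigO.of_bound (r ^ 2) (Eventually.of_forall fun t => ?_)
    simp [mul_pow, mul_comm]
  refine ⟨fun t => u (t * r), fun t => u1 _, ?_, ?_⟩
  · refine ((u2.comp_tendsto ht).trans hO).congr_left fun t => ?_
    simp only [Function.comp, smul_smul, Complex.ofReal_mul]
    ring_nf
  · refine ((u3.comp_tendsto ht).trans hO).congr_left fun t => ?_
    simp only [Function.comp, smul_smul, Complex.ofReal_mul]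
    ring_nf

lemma us_pow_sub_one {u : F} (hu : u ∈ unitary F) (n : ℕ) : ‖u ^ n - 1‖ ≤ n * ‖u - 1‖ := by
  induction n with
  | zero => simp
  | succ n ih =>
    have e : u ^ (n + 1) - 1 = u ^ n * (u - 1) + (u ^ n - 1) := by rw [pow_succ]; noncomm_ring
    rw [e]
    have := norm_add_le (u ^ n * (u - 1)) (u ^ n - 1)
    rw [CStarRing.norm_mem_unitary_mul _ (pow_mem hu n)] at this
    push_cast; linarith

lemma us_R_pow (hR : USHom R) {u : F} (hu : u ∈ unitary F) (n : ℕ) : R (u ^ n) = R u ^ n := by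
  induction n with
  | zero => simp [hR.map_one]
  | succ n ih => rw [pow_succ, pow_succ, hR.map_mul _ (pow_mem hu n) _ hu, ih]

lemma us_holder (hR : USHom R) {u : F} (hu : u ∈ unitary F) (J : ℕ)
    (h : 2 ^ J * ‖u - 1‖ ≤ 1 / 100) : (7 / 4) ^ J * ‖R u - 1‖ ≤ 1 / 4 := by
  refine us_nss (R u) J fun j hj => ?_
  rw [← us_R_pow hR hu]
  refine hR.small _ (pow_mem hu _) ((us_pow_sub_one hu _).trans (le_trans ?_ h))
  push_cast
  gcongr
  norm_num

lemma usGen.zero (hR : USHom R) {a : B} (h : usGen R 0 a) : a = 0 := by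
  obtain ⟨u, u1, u2, u3⟩ := h
  simp only [smul_zero, add_zero] at u2
  obtain ⟨C, hC0, hC⟩ := u2.exists_pos
  rw [isBigOWith_iff] at hC
  obtain ⟨j₀, hj₀⟩ := pow_unbounded_of_one_lt (100 * C) (by norm_num : (1 : ℝ) < 2)
  let t : ℕ → ℝ := fun m => (1 / 2) ^ m
  have htpos : ∀ m, 0 < t m := fun m => by positivity
  have ht : Tendsto t atTop (𝓝 0) :=
    tendsto_pow_atTop_nhds_zero_of_lt_one (by norm_num) (by norm_num)
  -- the o(t) bound
  have hsmall : Tendsto (fun m => (t m)⁻¹ * ‖R (u (t m)) - 1‖) atTop (𝓝 0) := by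
    have hgeo : Tendsto (fun m : ℕ => (7 / 4 : ℝ) ^ j₀ * (32 / 49) ^ m) atTop (𝓝 0) := by
      simpa using (tendsto_pow_atTop_nhds_zero_of_lt_one (r := (32 : ℝ) / 49) (by norm_num)
        (by norm_num)).const_mul ((7 / 4 : ℝ) ^ j₀)
    refine squeeze_zero' (Eventually.of_forall fun m => by have := htpos m; positivity) ?_ hgeo
    filter_upwards [ht.eventually hC, eventually_ge_atTop j₀] with m hm hmj
    have e1 : ‖t m ^ 2‖ = (1 / 4) ^ m := by
      rw [Real.norm_of_nonneg (by positivity)]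
      simp only [t]; rw [← pow_mul, mul_comm, pow_mul]; norm_num
    rw [e1] at hm
    have hJ : 2 * m - j₀ + j₀ = 2 * m := by omega
    have hb : (2 : ℝ) ^ (2 * m - j₀) * ‖u (t m) - 1‖ ≤ 1 / 100 := by
      have e2 : (2 : ℝ) ^ (2 * m - j₀) * 2 ^ j₀ = 4 ^ m := by
        rw [← pow_add, hJ, pow_mul]; norm_num
      have e3 : (4 : ℝ) ^ m * (1 / 4) ^ m = 1 := by rw [← mul_pow]; norm_num
      have p1 : (0 : ℝ) < 2 ^ (2 * m - j₀) := by positivity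
      have p2 : (0 : ℝ) < (1 / 4) ^ m := by positivity
      calc (2 : ℝ) ^ (2 * m - j₀) * ‖u (t m) - 1‖ ≤ 2 ^ (2 * m - j₀) * (C * (1 / 4) ^ m) := by gcongr
        _ = (1 / 100) * (2 ^ (2 * m - j₀) * (100 * C) * (1 / 4) ^ m) := by ring
        _ ≤ (1 / 100) * (2 ^ (2 * m - j₀) * 2 ^ j₀ * (1 / 4) ^ m) := by gcongr
        _ = 1 / 100 := by rw [e2, e3]; ring
    have hh := us_holder hR (u1 (t m)) _ hb
    have e4 : (7 / 4 : ℝ) ^ (2 * m - j₀) * (7 / 4) ^ j₀ = (49 / 16) ^ m := by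
      rw [← pow_add, hJ, pow_mul]; norm_num
    have e5 : (t m)⁻¹ = 2 ^ m := by simp [t]
    have e6 : (2 : ℝ) ^ m = (49 / 16) ^ m * (32 / 49) ^ m := by rw [← mul_pow]; norm_num
    rw [e5, e6, ← e4]
    have p3 : (0 : ℝ) < (7 / 4) ^ j₀ := by positivity
    have p4 : (0 : ℝ) < (32 / 49) ^ m := by positivity
    calc (7 / 4 : ℝ) ^ (2 * m - j₀) * (7 / 4) ^ j₀ * (32 / 49) ^ m * ‖R (u (t m)) - 1‖
        = ((7 / 4) ^ (2 * m - j₀) * ‖R (u (t m)) - 1‖) * ((7 / 4) ^ j₀ * (32 / 49) ^ m) := by ring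
      _ ≤ 1 * ((7 / 4) ^ j₀ * (32 / 49) ^ m) := by gcongr; linarith
      _ = _ := one_mul _
  obtain ⟨D, hD0, hD⟩ := u3.exists_pos
  rw [isBigOWith_iff] at hD
  have hlim : Tendsto (fun m => (t m)⁻¹ * ‖R (u (t m)) - 1‖ + D * t m) atTop (𝓝 0) := by
    simpa using hsmall.add (ht.const_mul D)
  have hle : ‖a‖ ≤ 0 := by
    refine ge_of_tendsto hlim ?_
    filter_upwards [ht.eventually hD] with m hm
    have hp := htpos m
    have e : ((t m : ℂ) * Complex.I) • a = (R (u (t m)) - 1) -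
      (R (u (t m)) - (1 + ((t m : ℂ) * Complex.I) • a)) := by abel
    have n1 : ‖((t m : ℂ) * Complex.I) • a‖ = t m * ‖a‖ := by
      rw [norm_smul]; simp [abs_of_pos hp]
    have n2 := norm_sub_le (R (u (t m)) - 1) (R (u (t m)) - (1 + ((t m : ℂ) * Complex.I) • a))
    rw [← e, n1] at n2
    have n3 : ‖t m ^ 2‖ = t m ^ 2 := Real.norm_of_nonneg (by positivity)
    rw [n3] at hm
    have : ‖a‖ = (t m)⁻¹ * (t m * ‖a‖) := by field_simp
    rw [this]
    calc (t m)⁻¹ * (t m * ‖a‖) ≤ (t m)⁻¹ * (‖R (u (t m)) - 1‖ + D * t m ^ 2) := by gcongr; linarith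
      _ = _ := by field_simp
  exact norm_le_zero_iff.mp hle

lemma usGen.unique (hR : USHom R) {h : F} {a b : B} (h1 : usGen R h a) (h2 : usGen R h b) :
    a = b := by
  have h3 := h2.smul (-1)
  have h4 := h1.add hR h3
  have : usGen R 0 (a - b) := by
    convert h4 using 1
    · simp
    · simp [sub_eq_add_neg]
  exact sub_eq_zero.mp (this.zero hR)

lemma us_exp_bigO (l : ℝ) : (fun t : ℝ => Complex.exp (((t * l : ℝ) : ℂ) * Complex.I) - 1 -
    ((t : ℂ) * Complex.I) * l) =O[𝓝 0] fun t : ℝ => t ^ 2 := by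
  have ht : Tendsto (fun t : ℝ => ((t * l : ℝ) : ℂ) * Complex.I) (𝓝 0) (𝓝 0) := by
    have : Continuous fun t : ℝ => ((t * l : ℝ) : ℂ) * Complex.I := by fun_prop
    simpa using this.tendsto 0
  refine IsBigO.of_bound (l ^ 2) ?_
  filter_upwards [ht.eventually (Metric.closedBall_mem_nhds 0 one_pos)] with t h
  have := Complex.norm_exp_sub_one_sub_id_le (x := ((t * l : ℝ) : ℂ) * Complex.I) (by simpa using h)
  have e : ((t * l : ℝ) : ℂ) * Complex.I = ((t : ℂ) * Complex.I) * l := by push_cast; ring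
  have e2 : ‖((t * l : ℝ) : ℂ) * Complex.I‖ ^ 2 = l ^ 2 * ‖t ^ 2‖ := by
    simp [mul_pow, mul_comm]
  rw [e2] at this
  rwa [← e]

lemma us_sum_bigO {B : Type*} [CStarAlgebra B] {ι : Type*} (s : Finset ι) (p : ι → B)
    (hsum : ∑ i ∈ s, p i = 1) (l : ι → ℝ) :
    (fun t : ℝ => (∑ i ∈ s, Complex.exp (((t * l i : ℝ) : ℂ) * Complex.I) • p i) -
      (1 + ((t : ℂ) * Complex.I) • ∑ i ∈ s, (l i : ℂ) • p i)) =O[𝓝 0] fun t : ℝ => t ^ 2 := by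
  have : (fun t : ℝ => ∑ i ∈ s, (Complex.exp (((t * l i : ℝ) : ℂ) * Complex.I) - 1 -
    ((t : ℂ) * Complex.I) * l i) • p i) =O[𝓝 0] fun t : ℝ => t ^ 2 := by
    refine IsBigO.fun_sum fun i _ => ?_
    have hc : (fun _ : ℝ => p i) =O[𝓝 0] fun _ : ℝ => (1 : ℝ) :=
      isBigO_const_const (p i) one_ne_zero _
    have h := (us_exp_bigO (l i)).smul hc
    simpa using h
  refine this.congr_left fun t => ?_
  rw [← hsum]
  simp only [sub_smul, one_smul, Finset.sum_sub_distrib, Finset.smul_sum, smul_smul]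
  abel

lemma usGen_sum (hR : USHom R) {ι : Type*} (s : Finset ι) (p : ι → F)
    (hp : ∀ i ∈ s, IsStarProjection (p i)) (ho : ∀ i ∈ s, ∀ j ∈ s, i ≠ j → p i * p j = 0)
    (hsum : ∑ i ∈ s, p i = 1) (l : ι → ℝ) :
    usGen R (∑ i ∈ s, (l i : ℂ) • p i) (∑ i ∈ s, (l i : ℂ) • usP R (p i)) := by
  have key := fun t : ℝ => usR_sum hR s p hp ho hsum
    (fun i => Complex.exp (((t * l i : ℝ) : ℂ) * Complex.I))
    (fun i _ => Complex.norm_exp_ofReal_mul_I _)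
  refine ⟨_, fun t => (key t).1, us_sum_bigO s p hsum l, ?_⟩
  refine (us_sum_bigO s (fun i => usP R (p i)) (key 0).2.2 l).congr_left fun t => ?_
  rw [(key t).2.1]
end

lemma us_linear {F B : Type*} [CStarAlgebra F] [CStarAlgebra B] [FiniteDimensional ℂ F]
    {R : F → B} (hR : USHom R) : ∃ ψ : F →⋆ₐ[ℂ] B, ∀ u ∈ unitary F, ψ u = R u := by
  have hex : ∀ h : selfAdjoint F, ∃ a : B, IsSelfAdjoint a ∧ usGen R (h : F) a := by
    intro h
    obtain ⟨s, p, hs, hp, ho, h1, hx⟩ := us_spectral (h : F) h.2.isStarNormal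
    refine ⟨∑ z ∈ s, ((z.re : ℝ) : ℂ) • usP R (p z), ?_, ?_⟩
    · unfold IsSelfAdjoint
      rw [star_sum]
      refine Finset.sum_congr rfl fun z hz => ?_
      rw [star_smul, (usP_proj hR (hp z hz)).isSelfAdjoint.star_eq]
      simp
    · have := usGen_sum hR s p hp ho h1 (fun z => z.re)
      convert this using 1
      rw [hx]
      refine Finset.sum_congr rfl fun z hz => ?_
      have hz' : z ∈ spectrum ℂ (h : F) := by rw [← hs]; exact_mod_cast hz
      congr 1
      exact IsSelfAdjoint.mem_spectrum_eq_re h.2 hz'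
  choose D hDsa hD using hex
  have hadd : ∀ h k, D (h + k) = D h + D k := fun h k =>
    (hD (h + k)).unique hR ((hD h).add hR (hD k))
  have hsmul : ∀ (r : ℝ) h, D (r • h) = r • D h := by
    intro r h
    have h1 := (hD h).smul r
    have h2 := hD (r • h)
    rw [selfAdjoint.val_smul, ← Complex.coe_smul] at h2
    rw [h2.unique hR h1, Complex.coe_smul]
  have hneg : ∀ h, D (-h) = - D h := fun h => by simpa using hsmul (-1) h
  open ComplexStarModule in
  let ψ : F →ₗ[ℂ] B :=
    { toFun := fun x => D (ℜ x) + Complex.I • D (ℑ x)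
      map_add' := fun x y => by
        simp only [map_add, hadd, smul_add]; abel
      map_smul' := fun z x => by
        simp only [realPart_smul, imaginaryPart_smul, sub_eq_add_neg, hadd, hneg, hsmul,
          RingHom.id_apply]
        simp only [← Complex.coe_smul, smul_add, smul_neg, smul_smul]
        conv_rhs => rw [← Complex.re_add_im z]
        simp only [add_smul, add_mul, mul_comm _ Complex.I, ← mul_assoc, mul_add, Complex.I_mul_I,
          neg_mul, one_mul, neg_smul]
        abel }
  have hstar : ∀ x, ψ (star x) = star (ψ x) := by
    intro x
    have e1 : realPart (star x) = realPart x := by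
      ext; simp only [realPart_apply_coe, star_star, add_comm]
    have e2 : imaginaryPart (star x) = - imaginaryPart x := by
      ext
      simp only [imaginaryPart_apply_coe, star_star, NegMemClass.coe_neg]
      rw [← smul_neg, ← smul_neg, neg_sub]
    simp only [ψ, LinearMap.coe_mk, AddHom.coe_mk, e1, e2, hneg]
    rw [star_add, star_smul, (hDsa _).star_eq, (hDsa _).star_eq]
    simp
  have hu : ∀ u ∈ unitary F, ψ u = R u := by
    intro u hu
    have hun : IsStarNormal u := ⟨by
      unfold Commute SemiconjBy; rw [(Unitary.mem_iff.mp hu).1, (Unitary.mem_iff.mp hu).2]⟩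
    obtain ⟨s, p, hs, hp, ho, h1, hx⟩ := us_spectral u hun
    have hz1 : ∀ z ∈ s, ‖z‖ = 1 := by
      intro z hz
      have hz' : z ∈ spectrum ℂ u := by rw [← hs]; exact_mod_cast hz
      have := spectrum.subset_circle_of_unitary hu hz'
      simpa using this
    have hsu : star u = ∑ z ∈ s, (starRingEnd ℂ z) • p z := by
      conv_lhs => rw [hx]
      rw [star_sum]
      refine Finset.sum_congr rfl fun z hz => ?_
      rw [star_smul, (hp z hz).isSelfAdjoint.star_eq]; rfl
    have hre : ((realPart u : selfAdjoint F) : F) = ∑ z ∈ s, ((z.re : ℝ) : ℂ) • p z := by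
      rw [realPart_apply_coe, hsu]
      conv_lhs => enter [2, 1]; rw [hx]
      rw [← Finset.sum_add_distrib, ← Complex.coe_smul, Finset.smul_sum]
      refine Finset.sum_congr rfl fun z hz => ?_
      rw [← add_smul, smul_smul, Complex.add_conj]
      congr 1; push_cast; ring
    have him : ((imaginaryPart u : selfAdjoint F) : F) = ∑ z ∈ s, ((z.im : ℝ) : ℂ) • p z := by
      rw [imaginaryPart_apply_coe, hsu]
      conv_lhs => enter [2, 2, 1]; rw [hx]
      rw [← Finset.sum_sub_distrib, ← Complex.coe_smul, smul_smul, Finset.smul_sum]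
      refine Finset.sum_congr rfl fun z hz => ?_
      rw [← sub_smul, smul_smul, Complex.sub_conj]
      congr 1; push_cast
      linear_combination (-(z.im : ℂ)) * Complex.I_mul_I
    have g1 := usGen_sum hR s p hp ho h1 (fun z => z.re)
    have g2 := usGen_sum hR s p hp ho h1 (fun z => z.im)
    rw [← hre] at g1
    rw [← him] at g2
    have d1 := (hD _).unique hR g1
    have d2 := (hD _).unique hR g2
    have key := (usR_sum hR s p hp ho h1 (fun z => z) hz1).2.1
    rw [← hx] at key
    simp only [ψ, LinearMap.coe_mk, AddHom.coe_mk]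
    rw [key, d1, d2, Finset.smul_sum, ← Finset.sum_add_distrib]
    refine Finset.sum_congr rfl fun z hz => ?_
    conv_rhs => arg 1; rw [← Complex.re_add_im z]
    rw [add_smul, smul_smul, mul_comm Complex.I]
  have hone : ψ 1 = 1 := by rw [hu 1 (one_mem _), hR.map_one]
  have hmul1 : ∀ u ∈ unitary F, ∀ y, ψ (u * y) = ψ u * ψ y := by
    intro u huu y
    have hy : y ∈ Submodule.span ℂ (unitary F : Set F) := by
      rw [CStarAlgebra.span_unitary F]; trivial
    induction hy using Submodule.span_induction with
    | mem v hv => rw [hu _ (mul_mem huu hv), hu u huu, hu v hv, hR.map_mul u huu v hv]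
    | zero => simp
    | add a b _ _ ha hb => rw [mul_add, map_add, map_add, ha, hb, mul_add]
    | smul c a _ ha => rw [mul_smul_comm, map_smul, map_smul, ha, mul_smul_comm]
  have hmul : ∀ x y, ψ (x * y) = ψ x * ψ y := by
    intro x y
    have hx : x ∈ Submodule.span ℂ (unitary F : Set F) := by
      rw [CStarAlgebra.span_unitary F]; trivial
    induction hx using Submodule.span_induction with
    | mem v hv => exact hmul1 v hv y
    | zero => simp
    | add a b _ _ ha hb => rw [add_mul, map_add, map_add, ha, hb, add_mul]
    | smul c a _ ha => rw [smul_mul_assoc, map_smul, map_smul, ha, smul_mul_assoc]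
  exact ⟨{ AlgHom.ofLinearMap ψ hone hmul with map_star' := hstar }, hu⟩

/-- approximate unital star homomorphisms between unital C*-algebras -/
structure USApprox {F B : Type*} [CStarAlgebra F] [CStarAlgebra B] (δ : ℝ) (φ : F → B) : Prop where
  add : ∀ x y : F, ‖x‖ ≤ 1 → ‖y‖ ≤ 1 → ‖φ (x + y) - φ x - φ y‖ ≤ δ
  smul : ∀ (x : F) (l : ℂ), ‖x‖ ≤ 1 → ‖l‖ ≤ 1 → ‖φ (l • x) - l • φ x‖ ≤ δ
  mul : ∀ x y : F, ‖x‖ ≤ 1 → ‖y‖ ≤ 1 → ‖φ (x * y) - φ x * φ y‖ ≤ δ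
  st : ∀ x : F, ‖x‖ ≤ 1 → ‖φ (star x) - star (φ x)‖ ≤ δ
  bdd : ∀ x : F, ‖x‖ ≤ 1 → ‖φ x‖ ≤ 10
  one : ‖φ 1 - 1‖ ≤ δ

section
variable {F B : Type*} [CStarAlgebra F] [CStarAlgebra B] {φ : F → B} {δ : ℝ}

lemma us_norm_one_le (B : Type*) [CStarAlgebra B] : ‖(1 : B)‖ ≤ 1 := us_norm_le_one (one_mem _)

lemma USApprox.st_mul (h : USApprox δ φ) {u : F} (hu : u ∈ unitary F) :
    ‖star (φ u) * φ u - 1‖ ≤ 12 * δ := by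
  have hun := us_norm_le_one hu
  have hsn : ‖star u‖ ≤ 1 := by rwa [norm_star]
  have h1 := h.mul (star u) u hsn hun
  rw [(Unitary.mem_iff.mp hu).1] at h1
  have h2 := h.one
  have h3 := h.st u hun
  have h4 : ‖(φ (star u) - star (φ u)) * φ u‖ ≤ δ * 10 :=
    (norm_mul_le _ _).trans (mul_le_mul h3 (h.bdd u hun) (norm_nonneg _) ((norm_nonneg _).trans h3))
  have e : star (φ u) * φ u - 1 = (φ 1 - 1) - (φ 1 - φ (star u) * φ u) -
    (φ (star u) - star (φ u)) * φ u := by rw [sub_mul]; abel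
  rw [e]
  have n1 := norm_sub_le ((φ 1 - 1) - (φ 1 - φ (star u) * φ u))
    ((φ (star u) - star (φ u)) * φ u)
  have n2 := norm_sub_le (φ 1 - 1) (φ 1 - φ (star u) * φ u)
  linarith

lemma USApprox.norm_unitary (h : USApprox δ φ) (hδ1 : δ ≤ 1 / 1000000) {u : F}
    (hu : u ∈ unitary F) : ‖φ u‖ ≤ 101 / 100 := by
  have h1 := h.st_mul hu
  have h2 := norm_add_le (star (φ u) * φ u - 1) 1
  rw [sub_add_cancel, CStarRing.norm_star_mul_self] at h2
  have h3 := us_norm_one_le B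
  by_contra hlt
  push Not at hlt
  nlinarith

lemma USApprox.small (h : USApprox δ φ) {x : F} {r : ℝ} (hr : 0 < r) (hr1 : r ≤ 1) (hx : ‖x‖ ≤ r) :
    ‖φ x‖ ≤ δ + 10 * r := by
  have hy : ‖((r⁻¹ : ℝ) : ℂ) • x‖ ≤ 1 := by
    rw [norm_smul, Complex.norm_real, Real.norm_of_nonneg (by positivity)]
    rw [inv_mul_le_iff₀ hr]; linarith
  have hl : ‖(r : ℂ)‖ = r := by rw [Complex.norm_real, Real.norm_of_nonneg hr.le]
  have h1 := h.smul (((r⁻¹ : ℝ) : ℂ) • x) (r : ℂ) hy (by rw [hl]; exact hr1)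
  have hrc : (r : ℂ) ≠ 0 := by exact_mod_cast hr.ne'
  have e : (r : ℂ) • (((r⁻¹ : ℝ) : ℂ) • x) = x := by
    rw [smul_smul]; push_cast; rw [mul_inv_cancel₀ hrc, one_smul]
  rw [e] at h1
  have h2 := h.bdd _ hy
  have h3 : ‖(r : ℂ) • φ (((r⁻¹ : ℝ) : ℂ) • x)‖ ≤ r * 10 := by
    rw [norm_smul, hl]; gcongr
  have h4 := norm_add_le (φ x - (r : ℂ) • φ (((r⁻¹ : ℝ) : ℂ) • x)) ((r : ℂ) • φ (((r⁻¹ : ℝ) : ℂ) • x))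
  rw [sub_add_cancel] at h4
  linarith

lemma USApprox.near (h : USApprox δ φ) {u v : F} {r : ℝ} (hr : 0 < r) (hr1 : r ≤ 1)
    (hv : ‖v‖ ≤ 1) (huv : ‖u - v‖ ≤ r) : ‖φ u - φ v‖ ≤ 2 * δ + 10 * r := by
  have h1 := h.small hr hr1 huv
  have h2 := h.add v (u - v) hv (huv.trans hr1)
  rw [add_sub_cancel] at h2
  have h3 := norm_add_le (φ u - φ v - φ (u - v)) (φ (u - v))
  rw [sub_add_cancel] at h3
  linarith

open MeasureTheory in
lemma USApprox.exists_hom [FiniteDimensional ℂ F] (h : USApprox δ φ) (hδ0 : 0 < δ)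
    (hδ1 : δ ≤ 1 / 1000000) :
    ∃ R : F → B, R 1 = 1 ∧ (∀ u ∈ unitary F, ∀ v ∈ unitary F, R (u * v) = R u * R v) ∧
      (∀ u ∈ unitary F, R u ∈ unitary B) ∧ ∀ u ∈ unitary F, ‖R u - φ u‖ ≤ 11700 * δ := by
  classical
  have : ProperSpace F := FiniteDimensional.proper ℂ F
  have hclosed : IsClosed (unitary F : Set F) := isClosed_unitary
  have : CompactSpace (unitary F) := by
    refine isCompact_iff_compactSpace.mp (Metric.isCompact_of_isClosed_isBounded hclosed ?_)
    refine (Metric.isBounded_closedBall (x := (0 : F)) (r := 1)).subset fun u hu => ?_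
    simpa using us_norm_le_one hu
  have : SecondCountableTopology (unitary F) := inferInstance
  let : MeasurableSpace (unitary F) := borel _
  have : BorelSpace (unitary F) := ⟨rfl⟩
  let μ : Measure (unitary F) := Measure.haarMeasure ⊤
  have : IsProbabilityMeasure μ := ⟨by
    have := Measure.haarMeasure_self (K₀ := (⊤ : TopologicalSpace.PositiveCompacts (unitary F)))
    simpa using this⟩
  obtain ⟨g, hg⟩ := exists_continuous_forall_mem_convex_of_local_const
    (t := fun u : unitary F => Metric.closedBall (φ u) (12 * δ))
    (fun u => convex_closedBall _ _) (fun u => ⟨φ u, by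
      filter_upwards [Metric.closedBall_mem_nhds u hδ0] with v hv
      rw [Metric.mem_closedBall, dist_eq_norm]
      have hv' : ‖(u : F) - v‖ ≤ δ := by
        rw [← dist_eq_norm, dist_comm]; exact hv
      have := h.near hδ0 (by linarith) (us_norm_le_one v.2) hv'
      linarith⟩)
  simp only [Metric.mem_closedBall, dist_eq_norm] at hg
  have hφ1 := h.one
  let f : C(unitary F, B) := g + ContinuousMap.const _ (1 - g 1)
  have hf1 : f 1 = 1 := by simp [f]
  have hfφ : ∀ u : unitary F, ‖f u - φ u‖ ≤ 25 * δ := by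
    intro u
    have e : f u - φ u = (g u - φ u) - ((g 1 - φ 1) + (φ 1 - 1)) := by simp [f]; abel
    have n1 := norm_sub_le (g u - φ u) ((g 1 - φ 1) + (φ 1 - 1))
    have n2 := norm_add_le (g 1 - φ 1) (φ 1 - 1)
    have n3 := hg u
    have n4 := hg 1
    simp only [OneMemClass.coe_one] at n4
    rw [e]; linarith
  have hφu : ∀ u : unitary F, ‖φ u‖ ≤ 101 / 100 := fun u => h.norm_unitary hδ1 u.2
  have hfb : ∀ u, ‖f u‖ ≤ 3 / 2 := by
    intro u
    have := norm_add_le (f u - φ u) (φ u)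
    rw [sub_add_cancel] at this
    have := hfφ u; have := hφu u
    linarith
  have hdef : ∀ x y, ‖f (x * y) - f x * f y‖ ≤ 101 * δ := by
    intro x y
    have e : f (x * y) - f x * f y = (f (x * y) - φ (x * y : unitary F)) +
      (φ ((x : F) * y) - φ x * φ y) - (f x - φ x) * φ y - f x * (f y - φ y) := by
      rw [sub_mul, mul_sub]; simp only [Submonoid.coe_mul]; abel
    have n1 := hfφ (x * y)
    have n2 := h.mul x y (us_norm_le_one x.2) (us_norm_le_one y.2)
    have n3 : ‖(f x - φ x) * φ y‖ ≤ (25 * δ) * (101 / 100) :=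
      (norm_mul_le _ _).trans (mul_le_mul (hfφ x) (hφu y) (norm_nonneg _) (by positivity))
    have n4 : ‖f x * (f y - φ y)‖ ≤ (3 / 2) * (25 * δ) :=
      (norm_mul_le _ _).trans (mul_le_mul (hfb x) (hfφ y) (norm_nonneg _) (by positivity))
    rw [e]
    refine (norm_sub_le _ _).trans ?_
    have m1 := norm_sub_le ((f (x * y) - φ (x * y : unitary F)) +
      (φ ((x : F) * y) - φ x * φ y)) ((f x - φ x) * φ y)
    have m2 := norm_add_le (f (x * y) - φ (x * y : unitary F)) (φ ((x : F) * y) - φ x * φ y)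
    linarith
  obtain ⟨ρ, ρ1, ρ2, ρ3⟩ := us_newton μ f (101 * δ) (by linarith) hf1 hfb hdef
  have hρφ : ∀ u : unitary F, ‖ρ u - φ u‖ ≤ 429 * δ := by
    intro u
    have e : ρ u - φ u = (ρ u - f u) + (f u - φ u) := by abel
    have := norm_add_le (ρ u - f u) (f u - φ u)
    have := ρ2 u; have := hfφ u
    rw [e]; linarith
  have hρb : ∀ u, ‖ρ u‖ ≤ 2 := by
    intro u
    have := norm_add_le (ρ u - φ u) (φ u)
    rw [sub_add_cancel] at this
    have := hρφ u; have := hφu u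
    linarith
  have hρs : ∀ u, ‖star (ρ u) * ρ u - 1‖ ≤ 1400 * δ := by
    intro u
    have e : star (ρ u) * ρ u - 1 = star (ρ u) * (ρ u - φ u) + star (ρ u - φ u) * φ u +
      (star (φ u) * φ u - 1) := by
      rw [star_sub, mul_sub, sub_mul]; abel
    have n1 : ‖star (ρ u) * (ρ u - φ u)‖ ≤ 2 * (429 * δ) :=
      (norm_mul_le _ _).trans (mul_le_mul (by rw [norm_star]; exact hρb u) (hρφ u)
        (norm_nonneg _) (by positivity))
    have n2 : ‖star (ρ u - φ u) * φ u‖ ≤ (429 * δ) * (101 / 100) :=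
      (norm_mul_le _ _).trans (mul_le_mul (by rw [norm_star]; exact hρφ u) (hφu u)
        (norm_nonneg _) (by positivity))
    have n3 := h.st_mul u.2
    have m1 := norm_add_le (star (ρ u) * (ρ u - φ u) + star (ρ u - φ u) * φ u)
      (star (φ u) * φ u - 1)
    have m2 := norm_add_le (star (ρ u) * (ρ u - φ u)) (star (ρ u - φ u) * φ u)
    rw [e]; linarith
  obtain ⟨r, r1, r2, r3, r4⟩ := us_unitarize μ ρ (1400 * δ) (by linarith) ρ1 ρ3 hρb hρs
  have hR : ∀ u (hu : u ∈ unitary F), (fun x => if hx : x ∈ unitary F then r ⟨x, hx⟩ else 0) u =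
      r ⟨u, hu⟩ := fun u hu => by simp [hu]
  refine ⟨fun x => if hx : x ∈ unitary F then r ⟨x, hx⟩ else 0, ?_, ?_, ?_, ?_⟩
  · rw [hR 1 (one_mem _)]; exact r1
  · intro u hu v hv
    rw [hR _ hu, hR _ hv, hR _ (mul_mem hu hv)]; exact r2 ⟨u, hu⟩ ⟨v, hv⟩
  · intro u hu; rw [hR _ hu]; exact r3 _
  · intro u hu
    rw [hR _ hu]
    have e : r ⟨u, hu⟩ - φ u = (r ⟨u, hu⟩ - ρ ⟨u, hu⟩) + (ρ ⟨u, hu⟩ - φ u) := by abel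
    have n1 := norm_add_le (r ⟨u, hu⟩ - ρ ⟨u, hu⟩) (ρ ⟨u, hu⟩ - φ u)
    have n2 := r4 ⟨u, hu⟩
    have n3 := hρφ ⟨u, hu⟩
    rw [e]; linarith

lemma USApprox.exists_starAlgHom [FiniteDimensional ℂ F] (h : USApprox δ φ) (hδ0 : 0 < δ)
    (hδ1 : δ ≤ 1 / 1000000) :
    ∃ ψ : F →⋆ₐ[ℂ] B, (∀ u ∈ unitary F, ‖ψ u - φ u‖ ≤ 11700 * δ) ∧
      ∀ x : F, ‖x‖ ≤ 1 → ‖ψ x - φ x‖ ≤ 23500 * δ := by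
  obtain ⟨R, R1, R2, R3, R4⟩ := h.exists_hom hδ0 hδ1
  have h1F := us_norm_one_le F
  have hφ1 := h.one
  have hR : USHom R := by
    refine ⟨R1, R2, R3, ?_, ?_, ?_⟩
    · intro p hp
      refine ⟨φ p, fun w hw => ?_⟩
      have hpn := us_proj_norm hp
      have hqn := us_proj_norm hp.one_sub
      have hwn : ‖w • p‖ ≤ 1 := by rw [norm_smul, hw, one_mul]; exact hpn
      have n1 := R4 _ (us_c_mem hp hw)
      have n2 := h.add (1 - p) (w • p) hqn hwn
      have e2 : 1 - p + w • p = 1 + (w - 1) • p := by module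
      rw [e2] at n2
      have n3 := h.smul p w hpn hw.le
      have n4 := h.add (1 - p) p hqn hpn
      rw [sub_add_cancel] at n4
      have e : R (1 + (w - 1) • p) - (1 + (w - 1) • φ p) =
        (R (1 + (w - 1) • p) - φ (1 + (w - 1) • p)) +
        (φ (1 + (w - 1) • p) - φ (1 - p) - φ (w • p)) + (φ (w • p) - w • φ p) -
        (φ 1 - φ (1 - p) - φ p) + (φ 1 - 1) := by module
      rw [e]
      refine (norm_add_le _ _).trans ?_
      refine (add_le_add_left (norm_sub_le _ _) _).trans ?_
      refine (add_le_add_left (add_le_add_left (norm_add_le _ _) _) _).trans ?_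
      refine (add_le_add_left (add_le_add_left (add_le_add_left (norm_add_le _ _) _) _) _).trans ?_
      linarith
    · have hm : (-1 : F) ∈ unitary F := by simp [Unitary.mem_iff]
      have n1 := R4 _ hm
      have n2 := h.smul 1 (-1) h1F (by simp)
      rw [neg_one_smul, neg_one_smul] at n2
      have e : R (-1) + 1 = (R (-1) - φ (-1)) + (φ (-1) - -φ 1) - (φ 1 - 1) := by abel
      rw [e]
      refine (norm_sub_le _ _).trans ?_
      refine (add_le_add_left (norm_add_le _ _) _).trans ?_
      linarith
    · intro u hu hu1
      have n1 := R4 u hu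
      have n2 := h.near (by norm_num) (by norm_num) h1F hu1
      have e : R u - 1 = (R u - φ u) + (φ u - φ 1) + (φ 1 - 1) := by abel
      rw [e]
      refine (norm_add_le _ _).trans ?_
      refine (add_le_add_left (norm_add_le _ _) _).trans ?_
      linarith
  obtain ⟨ψ, hψ⟩ := us_linear hR
  have hu : ∀ u ∈ unitary F, ‖ψ u - φ u‖ ≤ 11700 * δ := fun u hu => by
    rw [hψ u hu]; exact R4 u hu
  refine ⟨ψ, hu, ?_⟩
  have hsa : ∀ k : selfAdjoint F, ‖(k : F)‖ ≤ 1 → ‖ψ k - φ k‖ ≤ 11703 * δ := by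
    intro k hk
    obtain ⟨u, huu, hku⟩ : ∃ u ∈ unitary F, (k : F) = (1 / 2 : ℂ) • u + (1 / 2 : ℂ) • star u := by
      let : PartialOrder F := CStarAlgebra.spectralOrder F
      have : StarOrderedRing F := CStarAlgebra.spectralOrderedRing F
      refine ⟨_, (selfAdjoint.unitarySelfAddISMul k hk).2, ?_⟩
      have := selfAdjoint.realPart_unitarySelfAddISMul k hk
      conv_lhs => rw [← this]
      rw [realPart_apply_coe, ← Complex.coe_smul, smul_add]
      norm_num
    have hun := us_norm_le_one huu
    have hsn : ‖star u‖ ≤ 1 := by rwa [norm_star]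
    have hsu : star u ∈ unitary F := Unitary.star_mem huu
    have hb : ∀ v : F, ‖v‖ ≤ 1 → ‖(1 / 2 : ℂ) • v‖ ≤ 1 := by
      intro v hv; rw [norm_smul]; norm_num; linarith
    have n1 := h.add _ _ (hb u hun) (hb _ hsn)
    have n2 := h.smul u (1 / 2) hun (by norm_num)
    have n3 := h.smul (star u) (1 / 2) hsn (by norm_num)
    have n4 := hu u huu
    have n5 := hu _ hsu
    rw [← hku] at n1
    have e : ψ k - φ k = (1 / 2 : ℂ) • (ψ u - φ u) + (1 / 2 : ℂ) • (ψ (star u) - φ (star u)) -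
      (φ k - φ ((1 / 2 : ℂ) • u) - φ ((1 / 2 : ℂ) • star u)) -
      (φ ((1 / 2 : ℂ) • u) - (1 / 2 : ℂ) • φ u) -
      (φ ((1 / 2 : ℂ) • star u) - (1 / 2 : ℂ) • φ (star u)) := by
      have : ψ k = (1 / 2 : ℂ) • ψ u + (1 / 2 : ℂ) • ψ (star u) := by
        conv_lhs => rw [hku]
        rw [map_add, map_smul, map_smul]
      rw [this]; module
    have m : ∀ b : B, ‖(1 / 2 : ℂ) • b‖ = 1 / 2 * ‖b‖ := by intro b; rw [norm_smul]; norm_num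
    rw [e]
    refine (norm_sub_le _ _).trans ?_
    refine (add_le_add_left (norm_sub_le _ _) _).trans ?_
    refine (add_le_add_left (add_le_add_left (norm_sub_le _ _) _) _).trans ?_
    refine (add_le_add_left (add_le_add_left (add_le_add_left (norm_add_le _ _) _) _) _).trans ?_
    rw [m, m]
    linarith
  intro x hx
  have b1 : ‖((realPart x : selfAdjoint F) : F)‖ ≤ 1 := (realPart.norm_le x).trans hx
  have b2 : ‖((imaginaryPart x : selfAdjoint F) : F)‖ ≤ 1 := (imaginaryPart.norm_le x).trans hx
  have n1 := hsa _ b1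
  have n2 := hsa _ b2
  have b3 : ‖Complex.I • ((imaginaryPart x : selfAdjoint F) : F)‖ ≤ 1 := by
    rw [norm_smul]; simpa using b2
  have n3 := h.add _ _ b1 b3
  have n4 := h.smul _ Complex.I b2 (by simp)
  have hx2 := realPart_add_I_smul_imaginaryPart x
  rw [hx2] at n3
  generalize ((realPart x : selfAdjoint F) : F) = a at *
  generalize ((imaginaryPart x : selfAdjoint F) : F) = b at *
  have e : ψ x - φ x = (ψ a - φ a) + Complex.I • (ψ b - φ b) - (φ x - φ a - φ (Complex.I • b)) -
      (φ (Complex.I • b) - Complex.I • φ b) := by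
    have : ψ x = ψ a + Complex.I • ψ b := by rw [← hx2, map_add, map_smul]
    rw [this]; module
  have m : ‖Complex.I • (ψ b - φ b)‖ = ‖ψ b - φ b‖ := by rw [norm_smul]; simp
  rw [e]
  refine (norm_sub_le _ _).trans ?_
  refine (add_le_add_left (norm_sub_le _ _) _).trans ?_
  refine (add_le_add_left (add_le_add_left (norm_add_le _ _) _) _).trans ?_
  rw [m]
  linarith
end

lemma us_norm_add7 {A : Type*} [SeminormedAddCommGroup A] (a b c d e f g : A) :
    ‖a + b + c + d + e + f + g‖ ≤ ‖a‖ + ‖b‖ + ‖c‖ + ‖d‖ + ‖e‖ + ‖f‖ + ‖g‖ := by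
  have h1 := norm_add_le (a + b + c + d + e + f) g
  have h2 := norm_add_le (a + b + c + d + e) f
  have h3 := norm_add_le (a + b + c + d) e
  have h4 := norm_add_le (a + b + c) d
  have h5 := norm_add_le (a + b) c
  have h6 := norm_add_le a b
  linarith

lemma us_unitization_findim (F : Type*) [NonUnitalCStarAlgebra F] [FiniteDimensional ℂ F] :
    FiniteDimensional ℂ (Unitization ℂ F) := by
  let f : (ℂ × F) →ₗ[ℂ] Unitization ℂ F :=
    { toFun := fun p => Unitization.inl p.1 + Unitization.inr p.2
      map_add' := fun p q => by ext <;> simp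
      map_smul' := fun c p => by ext <;> simp }
  refine Module.Finite.of_surjective f fun y => ⟨(y.fst, y.snd), ?_⟩
  ext <;> simp [f]

lemma us_norm_fst {F : Type*} [NonUnitalCStarAlgebra F] (y : Unitization ℂ F) :
    ‖y.fst‖ ≤ ‖y‖ := by
  rw [Unitization.norm_def, Unitization.splitMul_apply]
  exact le_max_left _ _

lemma us_norm_inl_le {F : Type*} [NonUnitalCStarAlgebra F] (z : ℂ) :
    ‖(Unitization.inl z : Unitization ℂ F)‖ ≤ ‖z‖ := by
  have h : (Unitization.inl z : Unitization ℂ F) = z • 1 := by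
    ext <;> simp
  rw [h, norm_smul]
  have := us_norm_one_le (Unitization ℂ F)
  nlinarith [norm_nonneg z]

lemma us_norm_snd {F : Type*} [NonUnitalCStarAlgebra F] (y : Unitization ℂ F) :
    ‖y.snd‖ ≤ 2 * ‖y‖ := by
  have h : (Unitization.inr y.snd : Unitization ℂ F) = y - Unitization.inl y.fst := by
    rw [eq_sub_iff_add_eq]; ext <;> simp
  rw [← Unitization.norm_inr (𝕜 := ℂ), h]
  have n1 := norm_sub_le y (Unitization.inl y.fst)
  have n2 := us_norm_inl_le (F := F) y.fst
  have n3 := us_norm_fst y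
  linarith

/-- rescaled version of an approximate homomorphism -/
noncomputable def usE {F A : Type*} [NonUnitalCStarAlgebra F] [NonUnitalCStarAlgebra A] (φ : F → A)
    (x : F) : A := (8 : ℂ) • φ ((1 / 8 : ℂ) • x)

/-- the unitization of an approximate homomorphism -/
noncomputable def usT {F A : Type*} [NonUnitalCStarAlgebra F] [NonUnitalCStarAlgebra A] (φ : F → A)
    (x : Unitization ℂ F) : Unitization ℂ A := Unitization.inl x.fst + Unitization.inr (usE φ x.snd)

section
variable {F A : Type*} [NonUnitalCStarAlgebra F] [NonUnitalCStarAlgebra A] {φ : F → A} {δ : ℝ}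

lemma us_norm_eight (a : A) : ‖(8 : ℂ) • a‖ = 8 * ‖a‖ := by
  rw [norm_smul]; norm_num

lemma us_norm_eighth (a : A) : ‖(1 / 8 : ℂ) • a‖ = 1 / 8 * ‖a‖ := by
  rw [norm_smul]; norm_num

lemma usE_add (h : IsApproxStarHom δ φ) {x y : F} (hx : ‖x‖ ≤ 2) (hy : ‖y‖ ≤ 2) :
    ‖usE φ (x + y) - usE φ x - usE φ y‖ ≤ 8 * δ := by
  have := h.1 ((1 / 8 : ℂ) • x) ((1 / 8 : ℂ) • y) (by rw [us_norm_eighth]; linarith)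
    (by rw [us_norm_eighth]; linarith)
  unfold usE
  rw [smul_add, ← smul_sub, ← smul_sub, us_norm_eight]
  linarith

lemma usE_smul (h : IsApproxStarHom δ φ) {x : F} {l : ℂ} (hx : ‖x‖ ≤ 2) (hl : ‖l‖ ≤ 1) :
    ‖usE φ (l • x) - l • usE φ x‖ ≤ 8 * δ := by
  have := h.2.1 ((1 / 8 : ℂ) • x) l (by rw [us_norm_eighth]; linarith) hl
  unfold usE
  rw [smul_comm l (8 : ℂ), smul_comm _ l x, ← smul_sub, us_norm_eight]
  linarith

lemma usE_star (h : IsApproxStarHom δ φ) {x : F} (hx : ‖x‖ ≤ 2) :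
    ‖usE φ (star x) - star (usE φ x)‖ ≤ 8 * δ := by
  have := h.2.2.2.1 ((1 / 8 : ℂ) • x) (by rw [us_norm_eighth]; linarith)
  unfold usE
  have e1 : star ((8 : ℂ) • φ ((1 / 8 : ℂ) • x)) = (8 : ℂ) • star (φ ((1 / 8 : ℂ) • x)) := by
    rw [star_smul]; simp
  have e2 : star ((1 / 8 : ℂ) • x) = (1 / 8 : ℂ) • star x := by
    rw [star_smul]; simp
  rw [e2] at this
  rw [e1, ← smul_sub, us_norm_eight]
  linarith

lemma usE_mul (h : IsApproxStarHom δ φ) (hδ1 : δ ≤ 1) {x y : F} {l m : ℂ}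
    (hx : ‖x‖ ≤ 2) (hy : ‖y‖ ≤ 2) (hl : ‖l‖ ≤ 1) (hm : ‖m‖ ≤ 1) :
    ‖usE φ (l • y + m • x + x * y) - (l • usE φ y + m • usE φ x + usE φ x * usE φ y)‖ ≤
      240 * δ := by
  obtain ⟨h1, h2, h3, h4, h5⟩ := h
  set a : F := (1 / 8 : ℂ) • x with ha
  set b : F := (1 / 8 : ℂ) • y with hb
  have na : ‖a‖ ≤ 1 / 4 := by rw [ha, us_norm_eighth]; linarith
  have nb : ‖b‖ ≤ 1 / 4 := by rw [hb, us_norm_eighth]; linarith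
  have n4a : ‖(4 : ℂ) • a‖ ≤ 1 := by rw [norm_smul]; norm_num; linarith
  have n2b : ‖(2 : ℂ) • b‖ ≤ 1 / 2 := by rw [norm_smul]; norm_num; linarith
  have nlb : ‖l • b‖ ≤ 1 / 4 := by
    rw [norm_smul]; nlinarith [norm_nonneg l, norm_nonneg b]
  have nma : ‖m • a‖ ≤ 1 / 4 := by
    rw [norm_smul]; nlinarith [norm_nonneg m, norm_nonneg a]
  have nab : ‖((4 : ℂ) • a) * ((2 : ℂ) • b)‖ ≤ 1 := by
    refine (norm_mul_le _ _).trans ?_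
    nlinarith [norm_nonneg ((4 : ℂ) • a), norm_nonneg ((2 : ℂ) • b)]
  have hδ0 : 0 ≤ δ := (norm_nonneg _).trans (h1 0 0 (by simp) (by simp))
  have nlm : ‖l • b + m • a‖ ≤ 1 := (norm_add_le _ _).trans (by linarith)
  have e0 : (1 / 8 : ℂ) • (l • y + m • x + x * y) =
      (l • b + m • a) + ((4 : ℂ) • a) * ((2 : ℂ) • b) := by
    rw [ha, hb, smul_mul_smul_comm, smul_mul_smul_comm, smul_smul]; module
  have p1 := h1 _ _ nlm nab
  have p2 := h1 (l • b) (m • a) (by linarith) (by linarith)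
  have p3 := h2 b l (by linarith) hl
  have p4 := h2 a m (by linarith) hm
  have p5 := h3 _ _ n4a (by linarith : ‖(2 : ℂ) • b‖ ≤ 1)
  have p6 := h2 ((4 : ℂ) • a) (1 / 4) n4a (by norm_num)
  have p7 := h2 ((2 : ℂ) • b) (1 / 2) (by linarith) (by norm_num)
  rw [smul_smul, show (1 / 4 : ℂ) * 4 = 1 by norm_num, one_smul] at p6
  rw [smul_smul, show (1 / 2 : ℂ) * 2 = 1 by norm_num, one_smul] at p7
  have q6 : ‖φ ((4 : ℂ) • a) - (4 : ℂ) • φ a‖ ≤ 4 * δ := by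
    have e : φ ((4 : ℂ) • a) - (4 : ℂ) • φ a =
      (-4 : ℂ) • (φ a - (1 / 4 : ℂ) • φ ((4 : ℂ) • a)) := by module
    rw [e, norm_smul]; norm_num; simpa using p6
  have q7 : ‖φ ((2 : ℂ) • b) - (2 : ℂ) • φ b‖ ≤ 2 * δ := by
    have e : φ ((2 : ℂ) • b) - (2 : ℂ) • φ b =
      (-2 : ℂ) • (φ b - (1 / 2 : ℂ) • φ ((2 : ℂ) • b)) := by module
    rw [e, norm_smul]; norm_num; simpa using p7
  have r1 : ‖(φ ((4 : ℂ) • a) - (4 : ℂ) • φ a) * φ ((2 : ℂ) • b)‖ ≤ (4 * δ) * 2 :=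
    (norm_mul_le _ _).trans (mul_le_mul q6 ((h5 _ (by linarith)).trans (by linarith))
      (norm_nonneg _) (by positivity))
  have r2 : ‖((4 : ℂ) • φ a) * (φ ((2 : ℂ) • b) - (2 : ℂ) • φ b)‖ ≤ 8 * (2 * δ) := by
    refine (norm_mul_le _ _).trans (mul_le_mul ?_ q7 (norm_nonneg _) (by positivity))
    rw [norm_smul]
    have := h5 a (by linarith)
    norm_num; linarith
  have E : usE φ (l • y + m • x + x * y) - (l • usE φ y + m • usE φ x + usE φ x * usE φ y) =
      (8 : ℂ) • ((φ ((l • b + m • a) + ((4 : ℂ) • a) * ((2 : ℂ) • b)) - φ (l • b + m • a) -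
        φ (((4 : ℂ) • a) * ((2 : ℂ) • b))) + (φ (l • b + m • a) - φ (l • b) - φ (m • a)) +
        (φ (l • b) - l • φ b) + (φ (m • a) - m • φ a) +
        (φ (((4 : ℂ) • a) * ((2 : ℂ) • b)) - φ ((4 : ℂ) • a) * φ ((2 : ℂ) • b)) +
        (φ ((4 : ℂ) • a) - (4 : ℂ) • φ a) * φ ((2 : ℂ) • b) +
        ((4 : ℂ) • φ a) * (φ ((2 : ℂ) • b) - (2 : ℂ) • φ b)) := by
    unfold usE
    rw [e0, ← ha, ← hb, sub_mul, mul_sub]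
    simp only [smul_mul_assoc, mul_smul_comm, smul_smul]
    module
  rw [E, us_norm_eight]
  refine (mul_le_mul_of_nonneg_left (us_norm_add7 _ _ _ _ _ _ _) (by norm_num)).trans ?_
  linarith

end

section
variable {F A : Type*} [NonUnitalCStarAlgebra F] [NonUnitalCStarAlgebra A] {φ : F → A} {δ : ℝ}

lemma usT_approx (h : IsApproxStarHom δ φ) (hδ1 : δ ≤ 1 / 8) : USApprox (240 * δ) (usT φ) := by
  have hδ0 : 0 ≤ δ := (norm_nonneg _).trans (h.1 0 0 (by simp) (by simp))
  have hs : ∀ x : Unitization ℂ F, ‖x‖ ≤ 1 → ‖x.snd‖ ≤ 2 := fun x hx =>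
    (us_norm_snd x).trans (by linarith)
  have hf : ∀ x : Unitization ℂ F, ‖x‖ ≤ 1 → ‖x.fst‖ ≤ 1 := fun x hx => (us_norm_fst x).trans hx
  refine ⟨?_, ?_, ?_, ?_, ?_, ?_⟩
  · intro x y hx hy
    have e : usT φ (x + y) - usT φ x - usT φ y =
        Unitization.inr (usE φ (x.snd + y.snd) - usE φ x.snd - usE φ y.snd) := by
      rw [sub_eq_iff_eq_add, sub_eq_iff_eq_add]
      unfold usT
      ext
      · simp [-Unitization.inr_sub, add_comm]
      · simp [-Unitization.inr_sub]
    rw [e, Unitization.norm_inr]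
    linarith [usE_add h (hs x hx) (hs y hy)]
  · intro x l hx hl
    have e : usT φ (l • x) - l • usT φ x =
        Unitization.inr (usE φ (l • x.snd) - l • usE φ x.snd) := by
      rw [sub_eq_iff_eq_add]
      unfold usT
      ext <;> simp
    rw [e, Unitization.norm_inr]
    linarith [usE_smul h (hs x hx) hl]
  · intro x y hx hy
    have e : usT φ (x * y) - usT φ x * usT φ y =
        Unitization.inr (usE φ (x.fst • y.snd + y.fst • x.snd + x.snd * y.snd) -
          (x.fst • usE φ y.snd + y.fst • usE φ x.snd + usE φ x.snd * usE φ y.snd)) := by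
      rw [sub_eq_iff_eq_add]
      unfold usT
      ext <;> simp [-Unitization.inr_sub]
    rw [e, Unitization.norm_inr]
    exact usE_mul h (by linarith) (hs x hx) (hs y hy) (hf x hx) (hf y hy)
  · intro x hx
    have e : usT φ (star x) - star (usT φ x) =
        Unitization.inr (usE φ (star x.snd) - star (usE φ x.snd)) := by
      rw [sub_eq_iff_eq_add]
      unfold usT
      ext <;> simp
    rw [e, Unitization.norm_inr]
    linarith [usE_star h (hs x hx)]
  · intro x hx
    have n1 : ‖usE φ x.snd‖ ≤ 8 * (1 + δ) := by
      unfold usE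
      rw [us_norm_eight]
      have := h.2.2.2.2 ((1 / 8 : ℂ) • x.snd) (by rw [us_norm_eighth]; linarith [hs x hx])
      linarith
    unfold usT
    refine (norm_add_le _ _).trans ?_
    rw [Unitization.norm_inr]
    have := us_norm_inl_le (F := A) x.fst
    have := hf x hx
    linarith
  · have e : usT φ 1 - 1 = Unitization.inr (usE φ 0) := by
      rw [sub_eq_iff_eq_add]
      unfold usT
      ext <;> simp
    rw [e, Unitization.norm_inr]
    unfold usE
    rw [us_norm_eight, smul_zero]
    have := h.2.1 0 0 (by simp) (by simp)
    simp only [smul_zero, zero_smul, sub_zero] at this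
    linarith

lemma us_main_nonunital [FiniteDimensional ℂ F] (h : IsApproxStarHom δ φ) (hδ0 : 0 < δ)
    (hδ1 : δ ≤ 1 / 240000000) :
    ∃ ψ : F →⋆ₙₐ[ℂ] A, ∀ x : F, ‖x‖ ≤ 1 → ‖ψ x - φ x‖ ≤ 5640008 * δ := by
  have := us_unitization_findim F
  obtain ⟨Ψ, hΨu, hΨ⟩ := (usT_approx h (by linarith)).exists_starAlgHom (by linarith)
    (by linarith)
  have hfu : ∀ u ∈ unitary (Unitization ℂ F), (Ψ u).fst = u.fst := by
    intro u hu
    have hu1 : star u.fst * u.fst = 1 := by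
      have := congrArg (fun y : Unitization ℂ F => y.fst) (Unitary.mem_iff.mp hu).1
      simpa using this
    let W : Unitization ℂ F → ℂ := fun v => (Ψ v).fst * star v.fst
    have hWmul : ∀ v w, W (v * w) = W v * W w := by
      intro v w
      simp only [W, map_mul, Unitization.fst_mul, star_mul']; ring
    have hWpow : ∀ n : ℕ, W u ^ n = W (u ^ n) := by
      intro n
      induction n with
      | zero => simp [W]
      | succ n ih => rw [pow_succ, ih, pow_succ, hWmul]
    have hWn : ∀ v ∈ unitary (Unitization ℂ F), ‖W v - 1‖ ≤ 1 / 4 := by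
      intro v hv
      have hv1 : star v.fst * v.fst = 1 := by
        have := congrArg (fun y : Unitization ℂ F => y.fst) (Unitary.mem_iff.mp hv).1
        simpa using this
      have e : W v - 1 = (Ψ v - usT φ v).fst * star v.fst := by
        have e1 : (Ψ v - usT φ v).fst = (Ψ v).fst - v.fst := by
          have : (usT φ v).fst = v.fst := by simp [usT]
          rw [← this]; rfl
        rw [e1, sub_mul, mul_comm v.fst, hv1]
      rw [e, norm_mul, norm_star]
      have n1 := (us_norm_fst (Ψ v - usT φ v)).trans (hΨu v hv)
      have n2 := (us_norm_fst v).trans (us_norm_le_one hv)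
      have := mul_le_mul n1 n2 (norm_nonneg _) (by positivity)
      linarith
    have hW1 : W u = 1 := by
      by_contra hne
      have hpos : 0 < ‖W u - 1‖ := norm_pos_iff.mpr (sub_ne_zero.mpr hne)
      obtain ⟨J, hJ⟩ := pow_unbounded_of_one_lt (1 / ‖W u - 1‖) (by norm_num : (1 : ℝ) < 7 / 4)
      have := us_nss (W u) J (fun j _ => by rw [hWpow]; exact hWn _ (pow_mem hu _))
      rw [div_lt_iff₀ hpos] at hJ
      linarith
    calc (Ψ u).fst = W u * u.fst := by simp only [W]; rw [mul_assoc, hu1, mul_one]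
      _ = u.fst := by rw [hW1, one_mul]
  have hfst : ∀ y : Unitization ℂ F, (Ψ y).fst = y.fst := by
    intro y
    have hy : y ∈ Submodule.span ℂ (unitary (Unitization ℂ F) : Set (Unitization ℂ F)) := by
      rw [CStarAlgebra.span_unitary]; trivial
    induction hy using Submodule.span_induction with
    | mem v hv => exact hfu v hv
    | zero => simp
    | add a b _ _ ha hb => rw [map_add, Unitization.fst_add, Unitization.fst_add, ha, hb]
    | smul c a _ ha => rw [map_smul, Unitization.fst_smul, Unitization.fst_smul, ha]
  have hinr : ∀ x : F, Ψ (Unitization.inr x) = Unitization.inr (Ψ (Unitization.inr x)).snd := by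
    intro x
    ext
    · rw [hfst]; simp
    · simp
  let ψ : F →⋆ₙₐ[ℂ] A :=
    { toFun := fun x => (Ψ (Unitization.inr x)).snd
      map_smul' := fun c x => by simp
      map_zero' := by simp
      map_add' := fun x y => by simp
      map_mul' := fun x y => by
        rw [Unitization.inr_mul, map_mul, hinr x, hinr y, ← Unitization.inr_mul]; simp
      map_star' := fun x => by
        rw [Unitization.inr_star, map_star]; simp }
  refine ⟨ψ, fun x hx => ?_⟩
  have n1 := hΨ (Unitization.inr x) (by rwa [Unitization.norm_inr])
  have e1 : Ψ (Unitization.inr x) - usT φ (Unitization.inr x) =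
      Unitization.inr (ψ x - usE φ x) := by
    rw [sub_eq_iff_eq_add, hinr x]
    ext
    · simp [usT]
    · simp [usT, ψ]
  rw [e1, Unitization.norm_inr] at n1
  have n2 := h.2.1 x (1 / 8) hx (by norm_num)
  have e2 : usE φ x - φ x = (8 : ℂ) • (φ ((1 / 8 : ℂ) • x) - (1 / 8 : ℂ) • φ x) := by
    unfold usE; module
  have n3 : ‖usE φ x - φ x‖ ≤ 8 * δ := by
    rw [e2, us_norm_eight]; linarith
  have n4 := norm_add_le (ψ x - usE φ x) (usE φ x - φ x)
  rw [sub_add_sub_cancel] at n4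
  linarith
end

/-- Ulam stability of the pair (finite-dimensional C*-algebras, all C*-algebras):
for every `ε > 0` there is `δ > 0` such that any `δ`-*-homomorphism from a
finite-dimensional C*-algebra `F` into a C*-algebra `A` is within `ε` (on the closed
unit ball) of an actual *-homomorphism. -/
theorem ulam_stability_fin_dim :
    ∀ ε : ℝ, 0 < ε → ∃ δ : ℝ, 0 < δ ∧
      ∀ (F : Type u) (A : Type v)
        [NonUnitalNormedRing F] [StarRing F] [CStarRing F] [NormedSpace ℂ F]
        [IsScalarTower ℂ F F] [SMulCommClass ℂ F F] [StarModule ℂ F] [CompleteSpace F]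
        [FiniteDimensional ℂ F]
        [NonUnitalNormedRing A] [StarRing A] [CStarRing A] [NormedSpace ℂ A]
        [IsScalarTower ℂ A A] [SMulCommClass ℂ A A] [StarModule ℂ A] [CompleteSpace A]
        (φ : F → A), IsApproxStarHom δ φ →
          ∃ ψ : F →⋆ₙₐ[ℂ] A, ∀ x : F, ‖x‖ ≤ 1 → ‖ψ x - φ x‖ < ε := by
  intro ε hε
  refine ⟨min (1 / 240000000) (ε / 6000000), by positivity, ?_⟩
  intro F A _ _ _ _ _ _ _ _ _ _ _ _ _ _ _ _ _ φ hφ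
  let _ : NonUnitalCStarAlgebra F := { }
  let _ : NonUnitalCStarAlgebra A := { }
  obtain ⟨ψ, hψ⟩ := us_main_nonunital (F := F) (A := A) (φ := φ) hφ (by positivity)
    (min_le_left _ _)
  refine ⟨ψ, fun x hx => (hψ x hx).trans_lt ?_⟩
  have := min_le_right (1 / 240000000) (ε / 6000000)
  linarith
end

section
/- There exist constants K > 0 and δ > 0 such that for every ε with 0 < ε < δ, every finite-dimensional C*-algebra F, every C*-algebra A, and every ε-*-homomorphism φ : F → A, there exists a *-homomorphism ψ : F → A with ‖ψ(x) − φ(x)‖ < K·ε^{1/2} for every x in the closed unit ball of F. -/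
set_option linter.unusedSectionVars false

namespace UlamStab

open MeasureTheory Filter Topology

lemma idem_eq_zero {B : Type*} [NormedRing B] {e : B} (he : e * e = e) (h : ‖e‖ < 1) : e = 0 := by
  by_contra h0
  have hp : 0 < ‖e‖ := norm_pos_iff.mpr h0
  have h1 : ‖e‖ ≤ ‖e‖ * ‖e‖ := by
    conv_lhs => rw [← he]
    exact norm_mul_le _ _
  nlinarith

lemma eq_one_of_pow_near {B : Type*} [NormedRing B] [NormedAlgebra ℝ B] {w : B}
    (h : ∀ n : ℕ, ‖w ^ n - 1‖ ≤ 1 / 2) : w = 1 := by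
  have key : ∀ k : ℕ, ∀ n : ℕ, ‖w ^ n - 1‖ ≤ (1 / 2) * (2 / 3 : ℝ) ^ k := by
    intro k
    induction k with
    | zero => intro n; simpa using h n
    | succ k ih =>
      intro n
      have e : (2 : ℝ) • (w ^ n - 1) = (w ^ (n * 2) - 1) - (w ^ n - 1) * (w ^ n - 1) := by
        rw [pow_mul, two_smul]; noncomm_ring
      have e2 : 2 * ‖w ^ n - 1‖ ≤ ‖w ^ (n * 2) - 1‖ + ‖w ^ n - 1‖ * ‖w ^ n - 1‖ := by
        have := congrArg norm e
        rw [norm_smul] at this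
        norm_num at this
        rw [this]
        exact (norm_sub_le _ _).trans (by gcongr; exact norm_mul_le _ _)
      have h1 := ih (n * 2)
      have h2 := h n
      have h3 := norm_nonneg (w ^ n - 1)
      rw [pow_succ]
      nlinarith
  have h1 : ‖w - 1‖ ≤ 0 := by
    have ht : Tendsto (fun k : ℕ => (1 / 2) * (2 / 3 : ℝ) ^ k) atTop (𝓝 ((1 / 2) * 0)) :=
      (tendsto_pow_atTop_nhds_zero_of_lt_one (by norm_num) (by norm_num)).const_mul _
    rw [mul_zero] at ht
    exact ge_of_tendsto' ht (fun k => by simpa using key k 1)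
  exact sub_eq_zero.mp (norm_le_zero_iff.mp h1)

section Newton
variable {G B : Type*} [Group G] [TopologicalSpace G] [IsTopologicalGroup G] [CompactSpace G]
  [SecondCountableTopology G] [MeasurableSpace G] [BorelSpace G]
  [NormedRing B] [NormedAlgebra ℝ B] [CompleteSpace B]
  (μ : Measure G) [IsProbabilityMeasure μ] [μ.IsMulLeftInvariant]

lemma cont_int {f : G → B} (hf : Continuous f) : Integrable f μ :=
  hf.integrable_of_hasCompactSupport (HasCompactSupport.of_compactSpace f)

lemma norm_int_le {f : G → B} {C : ℝ} (h : ∀ g, ‖f g‖ ≤ C) : ‖∫ g, f g ∂μ‖ ≤ C := by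
  have := norm_integral_le_of_norm_le_const (μ := μ) (Eventually.of_forall h)
  simpa using this

lemma norm_int_sub_le {f : G → B} (hf : Continuous f) {C : ℝ} {b : B}
    (h : ∀ g, ‖f g - b‖ ≤ C) : ‖∫ g, f g ∂μ - b‖ ≤ C := by
  have h1 := norm_int_le μ h
  rwa [integral_sub (cont_int μ hf) (integrable_const _), integral_const, probReal_univ,
    one_smul] at h1

/-- one averaging step -/
noncomputable def step (ρ : G → B) (x : G) : B := ∫ g, ρ (x * g) * Ring.inverse (ρ g) ∂μ

lemma cont_inv {ρ : G → B} (hρ : Continuous ρ) (hu : ∀ g, IsUnit (ρ g)) :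
    Continuous fun g => Ring.inverse (ρ g) := by
  rw [continuous_iff_continuousAt]
  intro g
  obtain ⟨u, hu⟩ := hu g
  have := NormedRing.inverse_continuousAt u
  rw [hu] at this
  exact this.comp hρ.continuousAt

lemma step_cont {ρ : G → B} (hρ : Continuous ρ) (hu : ∀ g, IsUnit (ρ g)) :
    Continuous (step μ ρ) := by
  have hi := cont_inv hρ hu
  have := continuous_parametric_integral_of_continuous (μ := μ)
    (f := fun x g => ρ (x * g) * Ring.inverse (ρ g)) (s := Set.univ)
    (by
      have h1 : Continuous fun p : G × G => ρ (p.1 * p.2) := hρ.comp continuous_mul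
      have h2 : Continuous fun p : G × G => Ring.inverse (ρ p.2) := hi.comp continuous_snd
      exact h1.mul h2) isCompact_univ
  simp only [Measure.restrict_univ] at this
  exact this

lemma step_near {ρ : G → B} (hu : ∀ g, IsUnit (ρ g)) {M d : ℝ}
    (hM : ∀ g, ‖Ring.inverse (ρ g)‖ ≤ M) (hd : ∀ x y, ‖ρ (x * y) - ρ x * ρ y‖ ≤ d) (x g : G) :
    ‖ρ (x * g) * Ring.inverse (ρ g) - ρ x‖ ≤ d * M := by
  have h1 : ρ (x * g) * Ring.inverse (ρ g) - ρ x
      = (ρ (x * g) - ρ x * ρ g) * Ring.inverse (ρ g) := by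
    rw [sub_mul, mul_assoc, Ring.mul_inverse_cancel _ (hu g), mul_one]
  rw [h1]
  refine (norm_mul_le _ _).trans ?_
  have := (norm_nonneg _).trans (hd 1 1)
  gcongr
  · exact hd _ _
  · exact hM _

lemma step_sub {ρ : G → B} (hρ : Continuous ρ) (hu : ∀ g, IsUnit (ρ g)) {M d : ℝ}
    (hM : ∀ g, ‖Ring.inverse (ρ g)‖ ≤ M) (hd : ∀ x y, ‖ρ (x * y) - ρ x * ρ y‖ ≤ d) (x : G) :
    ‖step μ ρ x - ρ x‖ ≤ d * M := by
  have hi := cont_inv hρ hu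
  exact norm_int_sub_le μ (by fun_prop) (step_near hu hM hd x)

lemma step_defect {ρ : G → B} (hρ : Continuous ρ) (hu : ∀ g, IsUnit (ρ g)) {M d : ℝ}
    (hM : ∀ g, ‖Ring.inverse (ρ g)‖ ≤ M) (hd : ∀ x y, ‖ρ (x * y) - ρ x * ρ y‖ ≤ d) (x y : G) :
    ‖step μ ρ (x * y) - step μ ρ x * step μ ρ y‖ ≤ (2 * (d * M)) * (2 * (d * M)) := by
  have hi := cont_inv hρ hu
  set c : G → G → B := fun x g => ρ (x * g) * Ring.inverse (ρ g) with hc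
  have hcc : ∀ x, Continuous (c x) := fun x => by simp only [hc]; fun_prop
  have hcc' : Continuous fun g => c x (y * g) := (hcc x).comp (continuous_const.mul continuous_id)
  set a := step μ ρ x with ha
  set b := step μ ρ y with hb
  have ha' : ∫ g, c x (y * g) ∂μ = a := integral_mul_left_eq_self (μ := μ) (c x) y
  have hb' : ∫ g, c y g ∂μ = b := rfl
  have hxy : step μ ρ (x * y) = ∫ g, c x (y * g) * c y g ∂μ := by
    refine integral_congr_ae (Eventually.of_forall fun g => ?_)
    simp only [hc]
    rw [mul_assoc x y g, mul_assoc (ρ (x * (y * g))) (Ring.inverse (ρ (y * g))),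
      ← mul_assoc (Ring.inverse (ρ (y * g))) (ρ (y * g)), Ring.inverse_mul_cancel _ (hu _),
      one_mul]
  have key : step μ ρ (x * y) - a * b = ∫ g, (c x (y * g) - a) * (c y g - b) ∂μ := by
    have e : ∀ g, (c x (y * g) - a) * (c y g - b) =
        c x (y * g) * c y g - c x (y * g) * b - a * c y g + a * b := fun g => by noncomm_ring
    simp_rw [e]
    rw [integral_add, integral_sub, integral_sub, integral_const, probReal_univ, one_smul,
      integral_mul_const_of_integrable, integral_const_mul_of_integrable, ha', hb', ← hxy]
    · abel
    all_goals first
      | exact cont_int μ (by fun_prop)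
      | exact integrable_const _
  rw [key]
  have hnear : ∀ x g, ‖c x g - step μ ρ x‖ ≤ 2 * (d * M) := fun x g => by
    have h1 := step_near hu hM hd x g
    have h2 := step_sub μ hρ hu hM hd x
    calc ‖c x g - step μ ρ x‖ = ‖(c x g - ρ x) - (step μ ρ x - ρ x)‖ := by congr 1; abel
      _ ≤ ‖c x g - ρ x‖ + ‖step μ ρ x - ρ x‖ := norm_sub_le _ _
      _ ≤ _ := by linarith
  refine norm_int_le μ fun g => (norm_mul_le _ _).trans ?_
  have h0 := (norm_nonneg _).trans (hnear x x)
  exact mul_le_mul (hnear _ _) (hnear _ _) (norm_nonneg _) h0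

lemma unit_of_near {ρ : G → B} (h9 : ∀ g, ‖ρ g‖ ≤ 10) (h1 : ‖ρ 1 - 1‖ ≤ 1 / 4)
    (hd : ∀ x y, ‖ρ (x * y) - ρ x * ρ y‖ ≤ 1 / 4) (g : G) :
    IsUnit (ρ g) ∧ ‖Ring.inverse (ρ g)‖ ≤ 20 := by
  have near : ∀ g, ‖1 - ρ g * ρ g⁻¹‖ ≤ 1 / 2 := fun g => by
    have h2 := hd g g⁻¹
    rw [mul_inv_cancel] at h2
    calc ‖1 - ρ g * ρ g⁻¹‖ = ‖(ρ 1 - ρ g * ρ g⁻¹) - (ρ 1 - 1)‖ := by congr 1; abel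
      _ ≤ _ := norm_sub_le _ _
      _ ≤ _ := by linarith
  have un : ∀ g, IsUnit (ρ g * ρ g⁻¹) := fun g => by
    have : ‖1 - ρ g * ρ g⁻¹‖ < 1 := (near g).trans_lt (by norm_num)
    have h := (Units.oneSub _ this).isUnit
    simpa using h
  have hu : IsUnit (ρ g) := by
    obtain ⟨a, ha⟩ := (un g).exists_right_inv
    obtain ⟨b, hb⟩ := (un g⁻¹).exists_left_inv
    rw [inv_inv] at hb
    rw [isUnit_iff_exists_and_exists]
    exact ⟨⟨ρ g⁻¹ * a, by rw [← mul_assoc, ha]⟩, ⟨b * ρ g⁻¹, by rw [mul_assoc, hb]⟩⟩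
  refine ⟨hu, ?_⟩
  set s := Ring.inverse (ρ g)
  have e : s = ρ g⁻¹ + s * (1 - ρ g * ρ g⁻¹) := by
    rw [mul_sub, mul_one, ← mul_assoc, Ring.inverse_mul_cancel _ hu, one_mul]; abel
  have h2 : ‖s‖ ≤ ‖ρ g⁻¹‖ + ‖s‖ * ‖1 - ρ g * ρ g⁻¹‖ := by
    conv_lhs => rw [e]
    exact (norm_add_le _ _).trans (by gcongr; exact norm_mul_le _ _)
  have := near g
  have := h9 g⁻¹
  have := norm_nonneg s
  nlinarith

theorem newton (μ : Measure G) [IsProbabilityMeasure μ] [μ.IsMulLeftInvariant] {ρ : G → B} (hρ : Continuous ρ) (h9 : ∀ g, ‖ρ g‖ ≤ 9) (h1 : ‖ρ 1 - 1‖ ≤ 1 / 8)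
    {d : ℝ} (hd : ∀ x y, ‖ρ (x * y) - ρ x * ρ y‖ ≤ d) (hd0 : d ≤ 1 / 3200) :
    ∃ π : G →* B, Continuous π ∧ ∀ g, ‖π g - ρ g‖ ≤ 40 * d := by
  have hd00 : 0 ≤ d := (norm_nonneg _).trans (hd 1 1)
  set R : ℕ → G → B := fun n => (step μ)^[n] ρ with hR
  have hRs : ∀ n, R (n + 1) = step μ (R n) := fun n => Function.iterate_succ_apply' _ _ _
  have inv : ∀ n, Continuous (R n) ∧ (∀ g, ‖R n g - ρ g‖ ≤ 40 * d * (1 - (1 / 2) ^ n)) ∧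
      (∀ x y, ‖R n (x * y) - R n x * R n y‖ ≤ d * (1 / 2) ^ n) ∧
      ∀ g, ‖R (n + 1) g - R n g‖ ≤ 20 * d * (1 / 2) ^ n := by
    intro n
    have good : ∀ n, Continuous (R n) → (∀ g, ‖R n g - ρ g‖ ≤ 40 * d * (1 - (1 / 2) ^ n)) →
      (∀ x y, ‖R n (x * y) - R n x * R n y‖ ≤ d * (1 / 2) ^ n) →
      ∀ g, IsUnit (R n g) ∧ ‖Ring.inverse (R n g)‖ ≤ 20 := by
      intro n _ hb hc
      have hp : (0 : ℝ) ≤ (1 / 2) ^ n := by positivity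
      have hp1 : ((1 : ℝ) / 2) ^ n ≤ 1 := pow_le_one₀ (by norm_num) (by norm_num)
      have hb' : ∀ g, ‖R n g - ρ g‖ ≤ 1 / 8 := fun g => (hb g).trans (by nlinarith)
      refine unit_of_near (fun g => ?_) ?_ (fun x y => (hc x y).trans (by nlinarith))
      · have := norm_add_le (R n g - ρ g) (ρ g)
        rw [sub_add_cancel] at this
        linarith [hb' g, h9 g]
      · have := norm_add_le (R n 1 - ρ 1) (ρ 1 - 1)
        rw [sub_add_sub_cancel] at this
        linarith [hb' 1]
    have mv : ∀ n, Continuous (R n) → (∀ g, ‖R n g - ρ g‖ ≤ 40 * d * (1 - (1 / 2) ^ n)) →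
      (∀ x y, ‖R n (x * y) - R n x * R n y‖ ≤ d * (1 / 2) ^ n) →
      ∀ g, ‖R (n + 1) g - R n g‖ ≤ 20 * d * (1 / 2) ^ n := by
      intro n ha hb hc g
      have hg := good n ha hb hc
      rw [hRs]
      refine (step_sub μ ha (fun g => (hg g).1) (fun g => (hg g).2) hc g).trans (le_of_eq ?_)
      ring
    induction n with
    | zero =>
      have a1 : Continuous (R 0) := hρ
      have a2 : ∀ g, ‖R 0 g - ρ g‖ ≤ 40 * d * (1 - (1 / 2) ^ 0) := fun g => by simp [hR]
      have a3 : ∀ x y, ‖R 0 (x * y) - R 0 x * R 0 y‖ ≤ d * (1 / 2) ^ 0 := fun x y => by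
        simpa [hR] using hd x y
      exact ⟨a1, a2, a3, mv 0 a1 a2 a3⟩
    | succ n ih =>
      obtain ⟨b1, b2, b3, b4⟩ := ih
      have hg := good n b1 b2 b3
      have hp : (0 : ℝ) ≤ (1 / 2) ^ n := by positivity
      have hp1 : ((1 : ℝ) / 2) ^ n ≤ 1 := pow_le_one₀ (by norm_num) (by norm_num)
      have a1 : Continuous (R (n + 1)) := by
        rw [hRs]; exact step_cont μ b1 (fun g => (hg g).1)
      have a2 : ∀ g, ‖R (n + 1) g - ρ g‖ ≤ 40 * d * (1 - (1 / 2) ^ (n + 1)) := fun g => by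
        have := norm_add_le (R (n + 1) g - R n g) (R n g - ρ g)
        rw [sub_add_sub_cancel] at this
        refine (this.trans (add_le_add (b4 g) (b2 g))).trans (le_of_eq ?_)
        rw [pow_succ]; ring
      have a3 : ∀ x y, ‖R (n + 1) (x * y) - R (n + 1) x * R (n + 1) y‖ ≤ d * (1 / 2) ^ (n + 1) := by
        intro x y
        rw [hRs]
        refine (step_defect μ b1 (fun g => (hg g).1) (fun g => (hg g).2) b3 x y).trans ?_
        rw [pow_succ]
        have : 0 ≤ d * (1 / 2) ^ n := by positivity
        have : d * (1 / 2) ^ n ≤ 1 / 3200 := by nlinarith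
        nlinarith
      exact ⟨a1, a2, a3, mv _ a1 a2 a3⟩
  have hstep : ∀ g n, dist (R n g) (R (n + 1) g) ≤ 20 * d * (1 / 2) ^ n := fun g n => by
    rw [dist_comm, dist_eq_norm]; exact (inv n).2.2.2 g
  choose L hL using fun g => cauchySeq_tendsto_of_complete
    (cauchySeq_of_le_geometric (1 / 2) (20 * d) (by norm_num) (hstep g))
  have hLn : ∀ n g, dist (R n g) (L g) ≤ 20 * d * (1 / 2) ^ n / (1 - 1 / 2) := fun n g =>
    dist_le_of_le_geometric_of_tendsto (1 / 2) (20 * d) (by norm_num) (hstep g) (hL g) n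
  have hnear : ∀ g, ‖L g - ρ g‖ ≤ 40 * d := fun g => by
    have := hLn 0 g
    rw [dist_comm, dist_eq_norm] at this
    refine this.trans (le_of_eq ?_)
    ring
  have hunif : TendstoUniformly R L atTop := by
    rw [Metric.tendstoUniformly_iff]
    intro e he
    have ht : Tendsto (fun n : ℕ => 20 * d * (1 / 2 : ℝ) ^ n / (1 - 1 / 2)) atTop
        (𝓝 (20 * d * 0 / (1 - 1 / 2))) :=
      ((tendsto_pow_atTop_nhds_zero_of_lt_one (by norm_num) (by norm_num)).const_mul _).div_const _
    rw [mul_zero, zero_div] at ht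
    filter_upwards [ht.eventually (gt_mem_nhds he)] with n hn g
    rw [dist_comm]
    exact (hLn n g).trans_lt hn
  have hmul : ∀ x y, L (x * y) = L x * L y := fun x y => by
    have t1 : Tendsto (fun n => ‖R n (x * y) - R n x * R n y‖) atTop
        (𝓝 ‖L (x * y) - L x * L y‖) := ((hL _).sub ((hL _).mul (hL _))).norm
    have t2 : Tendsto (fun n : ℕ => d * (1 / 2 : ℝ) ^ n) atTop (𝓝 (d * 0)) :=
      (tendsto_pow_atTop_nhds_zero_of_lt_one (by norm_num) (by norm_num)).const_mul _
    have := le_of_tendsto_of_tendsto' t1 t2 (fun n => (inv n).2.2.1 x y)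
    rw [mul_zero] at this
    exact sub_eq_zero.mp (norm_le_zero_iff.mp this)
  have hone : L 1 = 1 := by
    have e1 : L 1 * L 1 = L 1 := by rw [← hmul, mul_one]
    have e2 : (1 - L 1) * (1 - L 1) = 1 - L 1 := by
      have : (1 - L 1) * (1 - L 1) = 1 - L 1 - L 1 + L 1 * L 1 := by noncomm_ring
      rw [this, e1]; abel
    have e3 : ‖1 - L 1‖ < 1 := by
      have := norm_add_le (L 1 - ρ 1) (ρ 1 - 1)
      rw [sub_add_sub_cancel] at this
      rw [norm_sub_rev]
      linarith [hnear 1]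
    exact (sub_eq_zero.mp (idem_eq_zero e2 e3)).symm
  exact ⟨{ toFun := L, map_one' := hone, map_mul' := hmul },
    hunif.continuous (Frequently.of_forall fun n => (inv n).1), hnear⟩

end Newton

section Unitarize
variable {G B : Type*} [Group G] [TopologicalSpace G] [IsTopologicalGroup G] [CompactSpace G]
  [SecondCountableTopology G] [MeasurableSpace G] [BorelSpace G] [CStarAlgebra B]

lemma norm_inv_le_two {B : Type*} [NormedRing B] [NormOneClass B] (s t : B) (hst : s * t = 1)
    (hs : ‖s - 1‖ ≤ 1 / 2) : ‖t‖ ≤ 2 := by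
  have e : t = 1 - (s - 1) * t := by rw [sub_mul, hst, one_mul]; abel
  have h : ‖t‖ ≤ 1 + ‖s - 1‖ * ‖t‖ := by
    conv_lhs => rw [e]
    refine (norm_sub_le _ _).trans ?_
    rw [norm_one]
    gcongr
    exact norm_mul_le _ _
  nlinarith [norm_nonneg t]

lemma exists_sqrt [Nontrivial B] {c : B} (hc : IsSelfAdjoint c) {η : ℝ} (h : ‖c - 1‖ ≤ η)
    (hη : η ≤ 1 / 2) : ∃ s : B, IsSelfAdjoint s ∧ s * s = c ∧ ‖s - 1‖ ≤ η := by
  have h0 : 0 ≤ η := (norm_nonneg _).trans h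
  have hsp : ∀ x ∈ spectrum ℝ c, |x - 1| ≤ η := by
    intro x hx
    have h1 : x - 1 ∈ spectrum ℝ (c - 1) := by
      have := spectrum.sub_singleton_eq c (1 : ℝ)
      rw [map_one] at this
      rw [← this]
      exact Set.sub_mem_sub hx rfl
    exact (spectrum.norm_le_norm_of_mem h1).trans h
  refine ⟨cfc Real.sqrt c, IsSelfAdjoint.cfc, ?_, ?_⟩
  · rw [← cfc_mul Real.sqrt Real.sqrt c]
    conv_rhs => rw [← cfc_id ℝ c]
    refine cfc_congr fun x hx => ?_
    have := abs_le.mp (hsp x hx)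
    exact Real.mul_self_sqrt (by linarith)
  · have e : cfc Real.sqrt c - 1 = cfc (fun x => Real.sqrt x - 1) c := by
      rw [cfc_sub .., cfc_const_one ..]
    rw [e]
    refine norm_cfc_le h0 fun x hx => ?_
    have hx' := hsp x hx
    have := abs_le.mp hx'
    have h2 : 0 ≤ x := by linarith
    have h3 := Real.sqrt_nonneg x
    have h4 := Real.mul_self_sqrt h2
    refine le_trans ?_ hx'
    rw [Real.norm_eq_abs]
    have : x - 1 = (Real.sqrt x - 1) * (Real.sqrt x + 1) := by nlinarith
    rw [this, abs_mul]
    refine le_mul_of_one_le_right (abs_nonneg _) ?_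
    rw [abs_of_nonneg] <;> linarith

theorem unitarize [Nontrivial B] (μ : Measure G) [IsProbabilityMeasure μ] [μ.IsMulLeftInvariant]
    (π : G →* B) (hπ : Continuous π) {η : ℝ} (hη : η ≤ 1 / 2)
    (h : ∀ g, ‖π g * star (π g) - 1‖ ≤ η) :
    ∃ σ : G →* unitary B, ∀ g, ‖(σ g : B) - π g‖ ≤ 8 * η := by
  have h0 : 0 ≤ η := (norm_nonneg _).trans (h 1)
  have hcf : Continuous fun g => π g * star (π g) := by fun_prop
  set c : B := ∫ g, π g * star (π g) ∂μ with hc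
  have hc1 : ‖c - 1‖ ≤ η := norm_int_sub_le μ hcf h
  have hcs : IsSelfAdjoint c := by
    rw [isSelfAdjoint_iff, hc]
    have := ((starL' ℝ : B ≃L[ℝ] B) : B →L[ℝ] B).integral_comp_comm (cont_int μ hcf)
    simp only [ContinuousLinearEquiv.coe_coe, starL'_apply, star_mul, star_star] at this
    exact this.symm
  have hinv : ∀ x, π x * c * star (π x) = c := by
    intro x
    rw [hc, ← integral_const_mul_of_integrable (cont_int μ hcf),
      ← integral_mul_const_of_integrable (cont_int μ (by fun_prop)),
      ← integral_mul_left_eq_self (μ := μ) (fun g => π g * star (π g)) x]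
    congr 1
    ext g
    simp [mul_assoc]
  obtain ⟨s, hss, hsc, hs1⟩ := exists_sqrt hcs hc1 hη
  have hus : IsUnit s := by
    have : ‖1 - s‖ < 1 := by rw [norm_sub_rev]; linarith
    simpa using (Units.oneSub _ this).isUnit
  obtain ⟨u, rfl⟩ := hus
  set t : B := ((u⁻¹ : Bˣ) : B) with ht
  have hst : (u : B) * t = 1 := u.mul_inv
  have hts : t * (u : B) = 1 := u.inv_mul
  have htsa : star t = t := by
    have h1 := congrArg star hst
    rw [star_mul, star_one, hss.star_eq] at h1
    calc star t = star t * (u * t) := by rw [hst, mul_one]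
      _ = t := by rw [← mul_assoc, h1, one_mul]
  have htn : ‖t‖ ≤ 2 := norm_inv_le_two _ _ hst (hs1.trans hη)
  have hn : ∀ g, ‖π g‖ ≤ 2 := fun g => by
    have h1 := h g
    have h2 : ‖π g‖ * ‖π g‖ = ‖π g * star (π g)‖ := (CStarRing.norm_self_mul_star).symm
    have h3 := norm_add_le (π g * star (π g) - 1) 1
    rw [sub_add_cancel, norm_one, ← h2] at h3
    nlinarith [norm_nonneg (π g)]
  let τ : G →* B :=
    { toFun := fun g => t * π g * u
      map_one' := by simp [hts]
      map_mul' := fun x y => by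
        rw [map_mul]
        calc t * (π x * π y) * u = t * π x * 1 * π y * u := by noncomm_ring
          _ = _ := by rw [← hst]; noncomm_ring }
  have hτ : ∀ g, τ g = t * π g * u := fun g => rfl
  have h1 : ∀ g, τ g * star (τ g) = 1 := fun g => by
    simp only [hτ, star_mul, htsa, hss.star_eq]
    calc t * π g * u * (u * (star (π g) * t)) = t * (π g * (u * u) * star (π g)) * t := by
          noncomm_ring
      _ = 1 := by rw [hsc, hinv, ← hsc, ← mul_assoc, hts, one_mul, hst]
  have h2 : ∀ g, star (τ g) * τ g = 1 := fun g => by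
    have e1 : τ g⁻¹ * τ g = 1 := by rw [← map_mul, inv_mul_cancel, map_one]
    have e2 : τ g⁻¹ = star (τ g) := by
      calc τ g⁻¹ = τ g⁻¹ * (τ g * star (τ g)) := by rw [h1, mul_one]
        _ = _ := by rw [← mul_assoc, e1, one_mul]
    rw [← e2, e1]
  refine ⟨τ.codRestrict (unitary B) fun g => ?_, fun g => ?_⟩
  · rw [Unitary.mem_iff]; exact ⟨h2 g, h1 g⟩
  · change ‖τ g - π g‖ ≤ _
    have e : τ g - π g = t * (π g * (u - 1) - (u - 1) * π g) := by
      have : t * (π g * (u - 1) - (u - 1) * π g) = t * π g * u - (t * u) * π g := by noncomm_ring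
      rw [this, hts, one_mul, hτ]
    rw [e]
    have a1 : ‖π g * ((u : B) - 1)‖ ≤ 2 * η :=
      (norm_mul_le _ _).trans (mul_le_mul (hn g) hs1 (norm_nonneg _) (by norm_num))
    have a2 : ‖((u : B) - 1) * π g‖ ≤ η * 2 :=
      (norm_mul_le _ _).trans (mul_le_mul hs1 (hn g) (norm_nonneg _) h0)
    have a3 : ‖π g * ((u : B) - 1) - (u - 1) * π g‖ ≤ 4 * η := (norm_sub_le _ _).trans (by linarith)
    refine (norm_mul_le _ _).trans ?_
    calc ‖t‖ * ‖π g * ((u : B) - 1) - (u - 1) * π g‖ ≤ 2 * (4 * η) := by gcongr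
      _ = _ := by ring
end Unitarize

/-- approximate unital star homomorphism on the unit ball, with crude bound. -/
structure Approx {F B : Type*} [CStarAlgebra F] [CStarAlgebra B] (ε : ℝ) (φ : F → B) : Prop where
  add : ∀ x y : F, ‖x‖ ≤ 1 → ‖y‖ ≤ 1 → ‖φ (x + y) - φ x - φ y‖ ≤ ε
  smul : ∀ (x : F) (l : ℂ), ‖x‖ ≤ 1 → ‖l‖ ≤ 1 → ‖φ (l • x) - l • φ x‖ ≤ ε
  mul : ∀ x y : F, ‖x‖ ≤ 1 → ‖y‖ ≤ 1 → ‖φ (x * y) - φ x * φ y‖ ≤ ε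
  star : ∀ x : F, ‖x‖ ≤ 1 → ‖φ (star x) - star (φ x)‖ ≤ ε
  bound : ∀ x : F, ‖x‖ ≤ 1 → ‖φ x‖ ≤ 8
  one : ‖φ 1 - 1‖ ≤ ε

lemma norm_mul_sub_mul_le {B : Type*} [NormedRing B] {a b a' b' : B} {e M M' : ℝ}
    (ha : ‖a - a'‖ ≤ e) (hb : ‖b - b'‖ ≤ e) (hM : ‖b‖ ≤ M) (hM' : ‖a'‖ ≤ M') :
    ‖a * b - a' * b'‖ ≤ e * M + M' * e := by
  have e1 : a * b - a' * b' = (a - a') * b + a' * (b - b') := by noncomm_ring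
  have h0 : 0 ≤ e := (norm_nonneg _).trans ha
  have h1 : 0 ≤ M' := (norm_nonneg _).trans hM'
  rw [e1]
  refine (norm_add_le _ _).trans (add_le_add ?_ ?_)
  · exact (norm_mul_le _ _).trans (mul_le_mul ha hM (norm_nonneg _) h0)
  · exact (norm_mul_le _ _).trans (mul_le_mul hM' hb (norm_nonneg _) h1)

lemma tri {B : Type*} [NormedAddCommGroup B] {a b c : B} {r s : ℝ} (h1 : ‖a - b‖ ≤ r)
    (h2 : ‖b - c‖ ≤ s) : ‖a - c‖ ≤ r + s :=
  (norm_sub_le_norm_sub_add_norm_sub a b c).trans (add_le_add h1 h2)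

theorem exists_rep {F B : Type*} [CStarAlgebra F] [CStarAlgebra B] [FiniteDimensional ℂ F]
    [Nontrivial F] [Nontrivial B] {ε : ℝ} (hε : 0 < ε) (hε1 : ε ≤ 1 / 200000) {φ : F → B}
    (h : Approx ε φ) :
    ∃ σ : unitary F →* unitary B, ∀ u, ‖(σ u : B) - φ u‖ ≤ 400000 * ε := by
  have hprop : ProperSpace F := FiniteDimensional.proper ℂ F
  have hcomp : IsCompact (unitary F : Set F) := by
    refine Metric.isCompact_of_isClosed_isBounded isClosed_unitary ?_
    refine (Metric.isBounded_closedBall (x := (0 : F)) (r := 1)).subset fun u hu => ?_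
    rw [mem_closedBall_zero_iff]
    exact (CStarRing.norm_of_mem_unitary hu).le
  have : CompactSpace (unitary F) := isCompact_iff_compactSpace.mp hcomp
  let _ : MeasurableSpace (unitary F) := borel _
  have : BorelSpace (unitary F) := ⟨rfl⟩
  have hn : ∀ u : unitary F, ‖(u : F)‖ ≤ 1 := fun u => (CStarRing.norm_of_mem_unitary u.2).le
  -- continuous approximation
  obtain ⟨ρ, hρ⟩ : ∃ ρ : C(unitary F, B), ∀ u : unitary F,
      ρ u ∈ Metric.closedBall (φ u) (3 * ε) := by
    refine exists_continuous_forall_mem_convex_of_local_const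
      (fun u => convex_closedBall _ _) fun u => ⟨φ u, ?_⟩
    have : Metric.ball u (ε / 8) ∈ 𝓝 u := Metric.ball_mem_nhds _ (by positivity)
    filter_upwards [this] with v hv
    rw [Metric.mem_ball, Subtype.dist_eq, dist_eq_norm] at hv
    rw [mem_closedBall_iff_norm]
    set s : ℝ := ε / 8
    have hs : 0 < s := by positivity
    set w : F := v - u
    set y : F := ((s⁻¹ : ℝ) : ℂ) • w
    have hy : ‖y‖ ≤ 1 := by
      simp only [y, norm_smul, Complex.norm_real, norm_inv, Real.norm_eq_abs, abs_of_pos hs]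
      rw [inv_mul_le_one₀ hs]; exact hv.le
    have hwy : w = (s : ℂ) • y := by
      simp only [y, smul_smul]
      rw [← Complex.ofReal_mul, mul_inv_cancel₀ hs.ne', Complex.ofReal_one, one_smul]
    have hs1 : ‖(s : ℂ)‖ ≤ 1 := by
      rw [Complex.norm_real, Real.norm_eq_abs, abs_of_pos hs]; simp only [s]; linarith
    have hw : ‖w‖ ≤ 1 := hv.le.trans (by simp only [s]; linarith)
    have h1 := h.add u w (hn u) hw
    have h2 := h.smul y s hy hs1
    rw [← hwy] at h2
    have h3 : ‖(s : ℂ) • φ y‖ ≤ ε := by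
      rw [norm_smul, Complex.norm_real, Real.norm_eq_abs, abs_of_pos hs]
      have := h.bound y hy
      simp only [s]; nlinarith
    have h4 : (u : F) + w = v := by simp [w]
    rw [h4] at h1
    have e : φ u - φ v = -(φ v - φ u - φ w) - (φ w - (s : ℂ) • φ y) - (s : ℂ) • φ y := by abel
    rw [e]
    refine (norm_sub_le _ _).trans ?_
    have := norm_sub_le (-(φ v - φ u - φ w)) (φ w - (s : ℂ) • φ y)
    rw [norm_neg] at this
    linarith
  have hρ' : ∀ u, ‖ρ u - φ u‖ ≤ 3 * ε := fun u => by
    have := hρ u; rwa [mem_closedBall_iff_norm] at this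
  have hφ8 : ∀ u : unitary F, ‖φ u‖ ≤ 8 := fun u => h.bound _ (hn u)
  have hρ9 : ∀ u, ‖ρ u‖ ≤ 9 := fun u => by
    have := norm_add_le (ρ u - φ u) (φ u)
    rw [sub_add_cancel] at this
    linarith [hρ' u, hφ8 u]
  have hd : ∀ u v, ‖ρ (u * v) - ρ u * ρ v‖ ≤ 55 * ε := fun u v => by
    have a1 := hρ' (u * v)
    have a2 := h.mul u v (hn u) (hn v)
    have a3 := norm_mul_sub_mul_le (hρ' u) (hρ' v) (hρ9 v) (hφ8 u)
    rw [norm_sub_rev] at a3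
    have := tri (tri a1 a2) a3
    linarith
  have h1 : ‖ρ 1 - 1‖ ≤ 1 / 8 := by
    have a1 := hρ' 1
    have := tri a1 h.one
    linarith
  let K : TopologicalSpace.PositiveCompacts (unitary F) :=
    ⟨⟨Set.univ, isCompact_univ⟩, by simp⟩
  let μ : Measure (unitary F) := Measure.haarMeasure K
  have hμ : IsProbabilityMeasure μ := ⟨Measure.haarMeasure_self (K₀ := K)⟩
  obtain ⟨π, hπc, hπ⟩ := newton μ ρ.continuous hρ9 h1 hd (by linarith)
  have hπφ : ∀ u, ‖π u - φ u‖ ≤ 2203 * ε := fun u => (tri (hπ u) (hρ' u)).trans (by linarith)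
  have hπ9 : ∀ u, ‖π u‖ ≤ 9 := fun u => by
    have := norm_add_le (π u - φ u) (φ u)
    rw [sub_add_cancel] at this
    linarith [hπφ u, hφ8 u]
  have hu : ∀ u, ‖π u * star (π u) - 1‖ ≤ 40000 * ε := fun u => by
    have a1 := norm_mul_sub_mul_le (a := π u) (a' := φ u) (b := star (π u)) (b' := star (φ u)) (M := 9)
      (hπφ u) (by rw [← star_sub, norm_star]; exact hπφ u) (by rw [norm_star]; exact hπ9 u) (hφ8 u)
    have a2 : ‖φ u * star (φ u) - φ u * φ (star (u : F))‖ ≤ 8 * ε := by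
      rw [← mul_sub]
      refine (norm_mul_le _ _).trans (mul_le_mul (hφ8 u) ?_ (norm_nonneg _) (by norm_num))
      rw [norm_sub_rev]
      exact h.star _ (hn u)
    have a3 := h.mul u (star (u : F)) (hn u) (by rw [norm_star]; exact hn u)
    rw [Unitary.mul_star_self_of_mem u.2, norm_sub_rev] at a3
    have := tri (tri (tri a1 a2) a3) h.one
    linarith
  obtain ⟨σ, hσ⟩ := unitarize μ π hπc (by linarith) hu
  exact ⟨σ, fun u => (tri (hσ u) (hπφ u)).trans (by linarith)⟩

/-- data: exact unitary representation `s` close to the approximate map `φ`. -/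
structure Core {F B : Type*} [CStarAlgebra F] [CStarAlgebra B] (κ : ℝ) (s φ : F → B) : Prop where
  small : κ ≤ 1 / 100
  one : s 1 = 1
  mul : ∀ u v : F, u ∈ unitary F → v ∈ unitary F → s (u * v) = s u * s v
  str : ∀ u : F, u ∈ unitary F → s (star u) = star (s u)
  near : ∀ u : F, u ∈ unitary F → ‖s u - φ u‖ ≤ κ
  approx : Approx κ φ

/-- the partial rotation `1 + (z-1) p`. -/
noncomputable def rot {F : Type*} [CStarAlgebra F] (z : ℂ) (p : F) : F := 1 + (z - 1) • p

section rot
variable {F : Type*} [CStarAlgebra F]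

lemma rot_mul (z w : ℂ) {p : F} (hp : p * p = p) : rot z p * rot w p = rot (z * w) p := by
  simp only [rot, mul_add, add_mul, mul_one, one_mul, smul_mul_smul_comm, hp]
  module

lemma rot_one (p : F) : rot 1 p = 1 := by simp [rot]

lemma rot_star (z : ℂ) {p : F} (hp : star p = p) : star (rot z p) = rot (star z) p := by
  simp [rot, hp]

lemma rot_pow (z : ℂ) {p : F} (hp : p * p = p) (n : ℕ) : rot z p ^ n = rot (z ^ n) p := by
  induction n with
  | zero => simp [rot_one]
  | succ n ih => rw [pow_succ, ih, rot_mul _ _ hp, pow_succ]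

lemma star_mul_self_of_norm {z : ℂ} (hz : ‖z‖ = 1) : star z * z = 1 := by
  have := Complex.conj_mul' z
  rw [hz] at this
  simpa using this

lemma rot_mem {z : ℂ} (hz : ‖z‖ = 1) {p : F} (hp : p * p = p) (hs : star p = p) :
    rot z p ∈ unitary F := by
  rw [Unitary.mem_iff, rot_star _ hs, rot_mul _ _ hp, rot_mul _ _ hp, mul_comm z,
    star_mul_self_of_norm hz, rot_one]
  simp

lemma norm_le_one_of_proj {p : F} (hp : p * p = p) (hs : star p = p) : ‖p‖ ≤ 1 := by
  have h := CStarRing.norm_star_mul_self (x := p)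
  rw [hs, hp] at h
  by_contra hc
  push Not at hc
  nlinarith

lemma norm_unitary_le {u : F} (hu : u ∈ unitary F) : ‖u‖ ≤ 1 := by
  nontriviality F
  exact (CStarRing.norm_of_mem_unitary hu).le

end rot

section core
variable {F B : Type*} [CStarAlgebra F] [CStarAlgebra B] {κ : ℝ} {s φ : F → B}

/-- image projection. -/
noncomputable def PP (s : F → B) (p : F) : B := (1 / 2 : ℂ) • (1 - s (rot (-1) p))

lemma Core.mem (h : Core κ s φ) {u : F} (hu : u ∈ unitary F) : s u ∈ unitary B := by
  rw [Unitary.mem_iff, ← h.str u hu, ← h.mul _ _ (Unitary.star_mem hu) hu, ← h.mul _ _ hu (Unitary.star_mem hu),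
    Unitary.star_mul_self_of_mem hu, Unitary.mul_star_self_of_mem hu, h.one]
  simp

lemma Core.pow (h : Core κ s φ) {u : F} (hu : u ∈ unitary F) (n : ℕ) : s (u ^ n) = s u ^ n := by
  induction n with
  | zero => simp [h.one]
  | succ n ih => rw [pow_succ, h.mul _ _ (pow_mem hu n) hu, ih, pow_succ]

lemma Core.nonneg (h : Core κ s φ) : 0 ≤ κ := (norm_nonneg _).trans h.approx.one

lemma Core.est (h : Core κ s φ) {z : ℂ} (hz : ‖z‖ = 1) {p : F} (hp : p * p = p)
    (hs : star p = p) : ‖s (rot z p) - rot z (φ p)‖ ≤ 5 * κ := by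
  have n1 : ‖p‖ ≤ 1 := norm_le_one_of_proj hp hs
  have n2 : ‖1 - p‖ ≤ 1 := norm_le_one_of_proj (by simp [mul_sub, sub_mul, hp]) (by simp [hs])
  have n3 : ‖z • p‖ ≤ 1 := by rw [norm_smul, hz, one_mul]; exact n1
  have a1 := h.near _ (rot_mem hz hp hs)
  have a2 := h.approx.add (1 - p) (z • p) n2 n3
  have a3 := h.approx.smul p z n1 hz.le
  have a4 := h.approx.add (1 - p) p n2 n1
  have a5 := h.approx.one
  rw [sub_add_cancel] at a4
  have e1 : (1 - p) + z • p = rot z p := by simp only [rot]; module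
  rw [e1] at a2
  have e : s (rot z p) - rot z (φ p) = (s (rot z p) - φ (rot z p))
    + (φ (rot z p) - φ (1 - p) - φ (z • p)) + (φ (z • p) - z • φ p)
    - (φ 1 - φ (1 - p) - φ p) + (φ 1 - 1) := by
    simp only [rot]; module
  rw [e]
  refine (norm_add_le _ _).trans ?_
  refine (add_le_add ((norm_sub_le _ _).trans (add_le_add ((norm_add_le _ _).trans
    (add_le_add ((norm_add_le _ _).trans (add_le_add a1 a2)) a3)) a4)) a5).trans ?_
  linarith

lemma Core.PP_near (h : Core κ s φ) {p : F} (hp : p * p = p)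
    (hs : star p = p) : ‖PP s p - φ p‖ ≤ 5 / 2 * κ := by
  have a := h.est (z := -1) (by simp) hp hs
  have e : PP s p - φ p = (-(1 / 2 : ℂ)) • (s (rot (-1) p) - rot (-1) (φ p)) := by
    simp only [PP, rot]; module
  rw [e, norm_smul]
  norm_num
  linarith

lemma Core.PP_eq (s : F → B) (p : F) : s (rot (-1) p) = rot (-1) (PP s p) := by
  simp only [PP, rot]; module

lemma Core.PP_idem (h : Core κ s φ) {p : F} (hp : p * p = p) (hs : star p = p) :
    PP s p * PP s p = PP s p := by
  have a : s (rot (-1) p) * s (rot (-1) p) = 1 := by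
    have hm : rot (-1) p ∈ unitary F := rot_mem (by simp) hp hs
    rw [← h.mul _ _ hm hm, rot_mul _ _ hp]
    norm_num [rot_one, h.one]
  simp only [PP, smul_mul_smul_comm, mul_sub, sub_mul, a, mul_one, one_mul]
  module

lemma Core.PP_star (h : Core κ s φ) {p : F} (hp : p * p = p) (hs : star p = p) :
    star (PP s p) = PP s p := by
  have hm : rot (-1) p ∈ unitary F := rot_mem (by simp) hp hs
  simp only [PP, star_smul, star_sub, ← h.str _ hm, rot_star _ hs]
  simp

lemma Core.comm (h : Core κ s φ) {u v : F} (hu : u ∈ unitary F) (hv : v ∈ unitary F)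
    (huv : u * v = v * u) : s u * s v = s v * s u := by
  rw [← h.mul _ _ hu hv, huv, h.mul _ _ hv hu]

lemma Core.rot_eq (h : Core κ s φ) {z : ℂ} (hz : ‖z‖ = 1) {p : F} (hp : p * p = p)
    (hs : star p = p) : s (rot z p) = rot z (PP s p) := by
  set P := PP s p with hP
  have hPi : P * P = P := h.PP_idem hp hs
  have hPs : star P = P := h.PP_star hp hs
  have hk := h.nonneg
  have hsm := h.small
  have bd : ∀ w : ℂ, ‖w‖ = 1 → ‖s (rot w p) * rot (star w) P - 1‖ ≤ 1 / 2 := by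
    intro w hw
    have e : s (rot w p) * rot (star w) P - 1 =
        (s (rot w p) - rot w P) * rot (star w) P := by
      rw [sub_mul, rot_mul _ _ hPi, mul_comm w, star_mul_self_of_norm hw, rot_one]
    have hw' : ‖star w‖ = 1 := by simpa using hw
    have m1 : ‖rot (star w) P‖ ≤ 1 := norm_unitary_le (rot_mem hw' hPi hPs)
    have m2 : ‖s (rot w p) - rot w P‖ ≤ 10 * κ := by
      have b1 := h.est hw hp hs
      have b2 := h.PP_near hp hs
      have e2 : s (rot w p) - rot w P = (s (rot w p) - rot w (φ p)) - (w - 1) • (P - φ p) := by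
        simp only [rot]; module
      rw [e2]
      refine (norm_sub_le _ _).trans ?_
      rw [norm_smul]
      have b3 : ‖w - 1‖ ≤ 2 := (norm_sub_le _ _).trans (by rw [hw]; norm_num)
      have := mul_le_mul b3 b2 (norm_nonneg _) (by norm_num)
      linarith
    rw [e]
    refine (norm_mul_le _ _).trans ?_
    have := mul_le_mul m2 m1 (norm_nonneg _) (by linarith)
    linarith
  have hcomm : Commute (s (rot z p)) (rot (star z) P) := by
    have c1 : s (rot z p) * s (rot (-1) p) = s (rot (-1) p) * s (rot z p) :=
      h.comm (rot_mem hz hp hs) (rot_mem (by simp) hp hs) (by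
        rw [rot_mul _ _ hp, rot_mul _ _ hp, mul_comm])
    have c2 : Commute (s (rot z p)) P := by
      rw [hP, PP]
      exact ((Commute.one_right _).sub_right c1).smul_right _
    rw [rot]
    exact (Commute.one_right _).add_right (c2.smul_right _)
  have key : s (rot z p) * rot (star z) P = 1 := by
    refine eq_one_of_pow_near fun n => ?_
    rw [hcomm.mul_pow, ← h.pow (rot_mem hz hp hs), rot_pow _ hp, rot_pow _ hPi, ← star_pow]
    exact bd _ (by rw [norm_pow, hz, one_pow])
  have : s (rot z p) * (rot (star z) P * rot z P) = rot z P := by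
    rw [← mul_assoc, key, one_mul]
  rwa [rot_mul _ _ hPi, star_mul_self_of_norm hz, rot_one, mul_one] at this

lemma Core.phi_zero (h : Core κ s φ) : ‖φ 0‖ ≤ κ := by
  have := h.approx.smul 0 0 (by simp) (by simp)
  simpa using this

lemma Core.PP_orth (h : Core κ s φ) {p q : F} (hp : p * p = p) (hs : star p = p)
    (hq : q * q = q) (hqs : star q = q) (hpq : p * q = 0) (hqp : q * p = 0) :
    PP s p * PP s q = 0 := by
  have hk := h.nonneg
  have hsm := h.small
  have mp : rot (-1) p ∈ unitary F := rot_mem (by simp) hp hs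
  have mq : rot (-1) q ∈ unitary F := rot_mem (by simp) hq hqs
  have c : s (rot (-1) p) * s (rot (-1) q) = s (rot (-1) q) * s (rot (-1) p) :=
    h.comm mp mq (by
      simp only [rot, mul_add, add_mul, mul_one, one_mul, smul_mul_smul_comm, hpq, hqp]
      module)
  have c2 : PP s p * PP s q = PP s q * PP s p := by
    simp only [PP, smul_mul_smul_comm, mul_sub, sub_mul, mul_one, one_mul, c]
    module
  refine idem_eq_zero ?_ ?_
  · rw [mul_assoc, ← mul_assoc (PP s q), ← c2, mul_assoc, h.PP_idem hq hqs, ← mul_assoc,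
      h.PP_idem hp hs]
  · have a1 := norm_mul_sub_mul_le (M := 1) (M' := 8) (h.PP_near hp hs) (h.PP_near hq hqs)
      (norm_le_one_of_proj (h.PP_idem hq hqs) (h.PP_star hq hqs))
      (h.approx.bound p (norm_le_one_of_proj hp hs))
    have a2 := h.approx.mul p q (norm_le_one_of_proj hp hs) (norm_le_one_of_proj hq hqs)
    rw [hpq, norm_sub_rev] at a2
    have a3 := tri a1 a2
    have a4 := norm_add_le (PP s p * PP s q - φ 0) (φ 0)
    rw [sub_add_cancel] at a4
    have := h.phi_zero
    linarith

lemma Core.PP_one (h : Core κ s φ) : PP s (1 : F) = 1 := by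
  have hk := h.nonneg
  have hsm := h.small
  have a := h.PP_near (p := 1) (by simp) (by simp)
  have b := tri a h.approx.one
  have i := h.PP_idem (p := 1) (by simp) (by simp)
  have : 1 - PP s (1 : F) = 0 := by
    refine idem_eq_zero ?_ ?_
    · simp [mul_sub, sub_mul, i]
    · rw [norm_sub_rev]; linarith
  exact (sub_eq_zero.mp this).symm

/-- star homomorphism from an orthogonal partition of unity. -/
noncomputable def ofFamily {X : Type*} [Fintype X] (P : X → B) (hi : ∀ j, P j * P j = P j)
    (hs : ∀ j, star (P j) = P j) (ho : ∀ i j, i ≠ j → P i * P j = 0) (h1 : ∑ j, P j = 1) :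
    (X → ℂ) →⋆ₐ[ℂ] B where
  toFun c := ∑ j, c j • P j
  map_one' := by simpa using h1
  map_zero' := by simp
  map_mul' c d := by
    rw [Finset.sum_mul_sum]
    refine Finset.sum_congr rfl fun i _ => ?_
    rw [Finset.sum_eq_single i]
    · rw [smul_mul_smul_comm, hi]; rfl
    · intro j _ hj
      rw [smul_mul_smul_comm, ho i j hj.symm, smul_zero]
    · simp
  map_add' c d := by simp [add_smul, Finset.sum_add_distrib]
  commutes' r := by simp [← Finset.smul_sum, h1, Algebra.algebraMap_eq_smul_one]
  map_star' c := by simp [hs]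

lemma Core.comm_case (h : Core κ s φ) {X : Type*} [Fintype X] (θ : (X → ℂ) →⋆ₐ[ℂ] F) :
    ∃ θ' : (X → ℂ) →⋆ₐ[ℂ] B, ∀ c : X → ℂ, (∀ j, ‖c j‖ = 1) → s (θ c) = θ' c := by
  classical
  let e : X → F := fun j => θ (Pi.single j 1)
  have ei : ∀ j, e j * e j = e j := fun j => by
    simp only [e, ← map_mul]
    rw [← Pi.single_mul, one_mul]
  have es : ∀ j, star (e j) = e j := fun j => by
    simp only [e, ← map_star]
    congr 1
    rw [← Pi.single_star, star_one]
  have eo : ∀ i j, i ≠ j → e i * e j = 0 := fun i j hij => by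
    simp only [e, ← map_mul]
    have : (Pi.single i 1 * Pi.single j 1 : X → ℂ) = 0 := by
      ext k
      by_cases hk : k = i
      · subst hk; simp [hij]
      · simp [hk]
    rw [this, map_zero]
  have eθ : ∀ c, θ c = ∑ j, c j • e j := fun c => by
    simp only [e, ← map_smul, ← map_sum]
    congr 1
    ext k
    simp [Finset.sum_apply, Pi.single_apply]
  have e1 : ∑ j, e j = 1 := by
    have := eθ 1
    simpa using this.symm
  have key : ∀ c : X → ℂ, (∀ j, ‖c j‖ = 1) → ∀ S : Finset X,
      (1 + ∑ j ∈ S, (c j - 1) • e j) ∈ unitary F ∧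
      s (1 + ∑ j ∈ S, (c j - 1) • e j) = 1 + ∑ j ∈ S, (c j - 1) • PP s (e j) := by
    intro c hc S
    induction S using Finset.induction_on with
    | empty => simp [h.one]
    | insert a S ha ih =>
      have f1 : 1 + ∑ j ∈ insert a S, (c j - 1) • e j =
          rot (c a) (e a) * (1 + ∑ j ∈ S, (c j - 1) • e j) := by
        have : e a * ∑ j ∈ S, (c j - 1) • e j = 0 := by
          rw [Finset.mul_sum]
          refine Finset.sum_eq_zero fun j hj => ?_
          rw [mul_smul_comm, eo a j (by rintro rfl; exact ha hj), smul_zero]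
        rw [Finset.sum_insert ha, rot, add_mul, one_mul, smul_mul_assoc, mul_add, this]
        simp only [mul_one, add_zero]; abel
      have f2 : 1 + ∑ j ∈ insert a S, (c j - 1) • PP s (e j) =
          rot (c a) (PP s (e a)) * (1 + ∑ j ∈ S, (c j - 1) • PP s (e j)) := by
        have : PP s (e a) * ∑ j ∈ S, (c j - 1) • PP s (e j) = 0 := by
          rw [Finset.mul_sum]
          refine Finset.sum_eq_zero fun j hj => ?_
          have hne : a ≠ j := by rintro rfl; exact ha hj
          rw [mul_smul_comm, h.PP_orth (ei a) (es a) (ei j) (es j) (eo a j hne)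
            (eo j a hne.symm), smul_zero]
        rw [Finset.sum_insert ha, rot, add_mul, one_mul, smul_mul_assoc, mul_add, this]
        simp only [mul_one, add_zero]; abel
      have m := rot_mem (hc a) (ei a) (es a)
      rw [f1, f2]
      exact ⟨mul_mem m ih.1, by rw [h.mul _ _ m ih.1, ih.2, h.rot_eq (hc a) (ei a) (es a)]⟩
  have sumF : ∀ c : X → ℂ, 1 + ∑ j, (c j - 1) • e j = ∑ j, c j • e j := fun c => by
    simp only [sub_smul, one_smul, Finset.sum_sub_distrib, e1]; abel
  have P1 : ∑ j, PP s (e j) = 1 := by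
    have k := (key (fun _ => -1) (by simp) Finset.univ).2
    simp only [← Finset.smul_sum, e1] at k
    change s (rot (-1) 1) = _ at k
    rw [Core.PP_eq s, h.PP_one, rot] at k
    have k2 := add_left_cancel k
    exact (smul_right_injective B (by norm_num : ((-1 : ℂ) - 1) ≠ 0) k2).symm
  refine ⟨ofFamily (fun j => PP s (e j)) (fun j => h.PP_idem (ei j) (es j))
    (fun j => h.PP_star (ei j) (es j))
    (fun i j hij => h.PP_orth (ei i) (es i) (ei j) (es j) (eo i j hij) (eo j i hij.symm)) P1,
    fun c hc => ?_⟩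
  change s (θ c) = ∑ j, c j • PP s (e j)
  rw [eθ, ← sumF, (key c hc Finset.univ).2]
  simp only [sub_smul, one_smul, Finset.sum_sub_distrib, P1]; abel

end core

lemma norm_le_hom {X B : Type*} [Fintype X] [CStarAlgebra B] (θ : (X → ℂ) →⋆ₐ[ℂ] B) (c : X → ℂ) :
    ‖θ c‖ ≤ ‖c‖ := NonUnitalStarAlgHom.norm_apply_le θ c

lemma spectral {F : Type*} [CStarAlgebra F] [FiniteDimensional ℂ F] [Nontrivial F]
    {a : F} (ha : IsStarNormal a) :
    ∃ (X : Type) (_ : Fintype X) (θ : (X → ℂ) →⋆ₐ[ℂ] F) (c : X → ℂ),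
      θ c = a ∧ ∀ f, ‖f‖ ≤ ‖θ f‖ := by
  have hfin : (spectrum ℂ a).Finite := by
    have hint : IsIntegral ℂ a := Algebra.IsIntegral.isIntegral a
    refine ((minpoly ℂ a).roots.toFinset.finite_toSet).subset fun z hz => ?_
    have h1 := spectrum.subset_polynomial_aeval a (minpoly ℂ a) ⟨z, hz, rfl⟩
    rw [minpoly.aeval] at h1
    simp only [spectrum.zero_eq, Set.mem_singleton_iff] at h1
    simpa [minpoly.ne_zero hint] using h1
  have : Fintype (spectrum ℂ a) := hfin.fintype
  have : DiscreteTopology (spectrum ℂ a) := inferInstance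
  let e : (spectrum ℂ a → ℂ) →⋆ₐ[ℂ] C(spectrum ℂ a, ℂ) :=
    { toFun := fun f => ⟨f, continuous_of_discreteTopology⟩
      map_one' := rfl
      map_zero' := rfl
      map_mul' := fun _ _ => rfl
      map_add' := fun _ _ => rfl
      commutes' := fun _ => rfl
      map_star' := fun _ => rfl }
  refine ⟨spectrum ℂ a, inferInstance, (cfcHom ha).comp e, fun z => z, ?_, fun f => ?_⟩
  · exact cfcHom_id ha
  · rw [StarAlgHom.comp_apply, norm_cfcHom a (e f) ha]
    rw [pi_norm_le_iff_of_nonneg (norm_nonneg _)]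
    exact fun i => (e f).norm_coe_le_norm i

lemma inj_of_norm {X F : Type*} [Fintype X] [CStarAlgebra F] {θ : (X → ℂ) →⋆ₐ[ℂ] F}
    (hθ : ∀ f, ‖f‖ ≤ ‖θ f‖) {f g : X → ℂ} (h : θ f = θ g) : f = g := by
  have := hθ (f - g)
  rw [map_sub, h, sub_self, norm_zero] at this
  exact sub_eq_zero.mp (norm_le_zero_iff.mp this)

section core2
variable {F B : Type*} [CStarAlgebra F] [CStarAlgebra B] [FiniteDimensional ℂ F] [Nontrivial F]
  {κ : ℝ} {s φ : F → B}

lemma Core.unit_case (h : Core κ s φ) {u : F} (hu : u ∈ unitary F) :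
    ∃ (X : Type) (_ : Fintype X) (θ : (X → ℂ) →⋆ₐ[ℂ] F) (θ' : (X → ℂ) →⋆ₐ[ℂ] B) (c : X → ℂ),
      θ c = u ∧ (∀ f, ‖f‖ ≤ ‖θ f‖) ∧ (∀ j, ‖c j‖ = 1) ∧
      ∀ c : X → ℂ, (∀ j, ‖c j‖ = 1) → s (θ c) = θ' c := by
  have hn : IsStarNormal u := ⟨by
    rw [Commute, SemiconjBy, Unitary.star_mul_self_of_mem hu, Unitary.mul_star_self_of_mem hu]⟩
  obtain ⟨X, hX, θ, c, hc, hθ⟩ := spectral hn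
  obtain ⟨θ', h'⟩ := h.comm_case θ
  refine ⟨X, hX, θ, θ', c, hc, hθ, fun j => ?_, h'⟩
  have e : star c * c = 1 := inj_of_norm hθ (by
    rw [map_mul, map_star, hc, map_one, Unitary.star_mul_self_of_mem hu])
  have e2 := congrFun e j
  simp only [Pi.mul_apply, Pi.star_apply, Pi.one_apply] at e2
  have e3 := congrArg norm e2
  rw [norm_mul, norm_star, norm_one] at e3
  nlinarith [norm_nonneg (c j)]

lemma Core.sa_case (h : Core κ s φ) {a : F} (ha : IsSelfAdjoint a) :
    ∃ (X : Type) (_ : Fintype X) (θ : (X → ℂ) →⋆ₐ[ℂ] F) (θ' : (X → ℂ) →⋆ₐ[ℂ] B) (l : X → ℝ),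
      θ (fun j => (l j : ℂ)) = a ∧
      ∀ c : X → ℂ, (∀ j, ‖c j‖ = 1) → s (θ c) = θ' c := by
  obtain ⟨X, hX, θ, c, hc, hθ⟩ := spectral ha.isStarNormal
  obtain ⟨θ', h'⟩ := h.comm_case θ
  refine ⟨X, hX, θ, θ', fun j => (c j).re, ?_, h'⟩
  rw [← hc]
  congr 1
  have e : star c = c := inj_of_norm hθ (by rw [map_star, hc, ha.star_eq])
  ext j
  exact Complex.conj_eq_iff_re.mp (congrFun e j)

lemma Core.lip1 (h : Core κ s φ) {u : F} (hu : u ∈ unitary F) : ‖s u - 1‖ ≤ ‖u - 1‖ := by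
  obtain ⟨X, hX, θ, θ', c, hc, hθ, hc1, h'⟩ := h.unit_case hu
  have e1 : s u - 1 = θ' (c - 1) := by rw [← hc, h' c hc1, map_sub, map_one]
  have e2 : u - 1 = θ (c - 1) := by rw [← hc, map_sub, map_one]
  rw [e1, e2]
  exact (norm_le_hom _ _).trans (hθ _)

lemma Core.lip (h : Core κ s φ) {u v : F} (hu : u ∈ unitary F) (hv : v ∈ unitary F) :
    ‖s u - s v‖ ≤ ‖u - v‖ := by
  have hv' := Unitary.star_mem hv
  have a := h.lip1 (mul_mem hu hv')
  have e1 : s u - s v = (s (u * star v) - 1) * s v := by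
    rw [sub_mul, one_mul, ← h.mul _ _ (mul_mem hu hv') hv, mul_assoc,
      Unitary.star_mul_self_of_mem hv, mul_one]
  have e2 : u * star v - 1 = (u - v) * star v := by
    rw [sub_mul, Unitary.mul_star_self_of_mem hv]
  rw [e1]
  rw [e2] at a
  have n1 := norm_unitary_le (h.mem hv)
  have n2 := norm_unitary_le hv'
  calc _ ≤ ‖s (u * star v) - 1‖ * ‖s v‖ := norm_mul_le _ _
    _ ≤ ‖s (u * star v) - 1‖ * 1 := by gcongr
    _ ≤ ‖(u - v) * star v‖ := by rw [mul_one]; exact a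
    _ ≤ ‖u - v‖ * ‖star v‖ := norm_mul_le _ _
    _ ≤ ‖u - v‖ * 1 := by gcongr
    _ = _ := mul_one _

/-- `q` is the image tangent vector of `x`. -/
def DD (s : F → B) (x : F) (q : B) : Prop :=
  ∃ γ : ℝ → F, (∀ t, γ t ∈ unitary F) ∧ γ 0 = 1 ∧ HasDerivAt γ x 0 ∧
    HasDerivAt (fun t => s (γ t)) q 0

lemma DD.uniq (h : Core κ s φ) {x : F} {q q' : B} (h1 : DD s x q) (h2 : DD s x q') : q = q' := by
  obtain ⟨γ, a1, a2, a3, a4⟩ := h1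
  obtain ⟨δ, b1, b2, b3, b4⟩ := h2
  have c1 := a3.sub b3
  have c2 := a4.sub b4
  have c3 : HasDerivAt ((fun t => s (γ t)) - fun t => s (δ t)) 0 0 := by
    rw [hasDerivAt_iff_isLittleO] at c1 ⊢
    refine Asymptotics.IsBigO.trans_isLittleO (Asymptotics.IsBigO.of_bound 1 ?_) c1
    refine Eventually.of_forall fun t => ?_
    simp only [Pi.sub_apply, a2, b2, sub_self, smul_zero, sub_zero, one_mul]
    exact h.lip (a1 t) (b1 t)
  exact sub_eq_zero.mp (c2.unique c3)

lemma DD.add (h : Core κ s φ) {x y : F} {q r : B} (h1 : DD s x q) (h2 : DD s y r) :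
    DD s (x + y) (q + r) := by
  obtain ⟨γ, a1, a2, a3, a4⟩ := h1
  obtain ⟨δ, b1, b2, b3, b4⟩ := h2
  refine ⟨fun t => γ t * δ t, fun t => mul_mem (a1 t) (b1 t), by simp [a2, b2], ?_, ?_⟩
  · have := a3.mul b3
    rw [a2, b2, mul_one, one_mul] at this
    exact this
  · have := a4.mul b4
    rw [a2, b2, h.one, mul_one, one_mul] at this
    refine this.congr_of_eventuallyEq (Eventually.of_forall fun t => ?_)
    exact h.mul _ _ (a1 t) (b1 t)

lemma DD.smul {x : F} {q : B} (r : ℝ) (h1 : DD s x q) : DD s (r • x) (r • q) := by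
  obtain ⟨γ, a1, a2, a3, a4⟩ := h1
  have hr : HasDerivAt (fun t : ℝ => r * t) r 0 := by
    simpa using (hasDerivAt_id (0 : ℝ)).const_mul r
  refine ⟨fun t => γ (r * t), fun t => a1 _, by simp [a2], ?_, ?_⟩
  · exact HasDerivAt.scomp (g₁ := γ) (h := fun t : ℝ => r * t) 0 (by simpa using a3) hr
  · exact HasDerivAt.scomp (g₁ := fun t => s (γ t)) (h := fun t : ℝ => r * t) 0
      (by simpa using a4) hr

lemma hom_deriv {X C : Type*} [Fintype X] [CStarAlgebra C] (θ : (X → ℂ) →⋆ₐ[ℂ] C) (l : X → ℝ) :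
    HasDerivAt (fun t : ℝ => θ (fun j => Complex.exp (t * (l j * Complex.I))))
      (Complex.I • θ (fun j => (l j : ℂ))) 0 := by
  let L : (X → ℂ) →L[ℂ] C := LinearMap.toContinuousLinearMap θ.toAlgHom.toLinearMap
  have h1 : HasDerivAt (fun t : ℝ => fun j => Complex.exp (t * (l j * Complex.I)))
      (Complex.I • fun j => (l j : ℂ)) 0 := by
    rw [hasDerivAt_pi]
    intro j
    have a : HasDerivAt (fun t : ℝ => (t : ℂ) * (l j * Complex.I)) (1 * (l j * Complex.I)) 0 :=
      (HasDerivAt.ofReal_comp (hasDerivAt_id (0 : ℝ))).mul_const _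
    have := a.cexp
    simp only [Complex.ofReal_zero, zero_mul, Complex.exp_zero, one_mul] at this
    simpa [mul_comm] using this
  have h2 := (L.restrictScalars ℝ).hasFDerivAt.comp_hasDerivAt (0 : ℝ) h1
  rw [← map_smul]
  exact h2

lemma norm_exp_aux (t l : ℝ) : ‖Complex.exp (t * (l * Complex.I))‖ = 1 := by
  rw [← mul_assoc, ← Complex.ofReal_mul, Complex.norm_exp_ofReal_mul_I]

lemma DD.hom {X : Type*} [Fintype X] {θ : (X → ℂ) →⋆ₐ[ℂ] F} {θ' : (X → ℂ) →⋆ₐ[ℂ] B}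
    (h' : ∀ c : X → ℂ, (∀ j, ‖c j‖ = 1) → s (θ c) = θ' c) (l : X → ℝ) :
    DD s (Complex.I • θ (fun j => (l j : ℂ))) (Complex.I • θ' (fun j => (l j : ℂ))) := by
  refine ⟨_, fun t => ?_, ?_, hom_deriv θ l, ?_⟩
  · have e : star (fun j => Complex.exp (t * (l j * Complex.I))) *
        (fun j => Complex.exp (t * (l j * Complex.I))) = 1 := by
      ext j
      exact star_mul_self_of_norm (norm_exp_aux t (l j))
    rw [Unitary.mem_iff, ← map_star, ← map_mul, ← map_mul, mul_comm _ (star _), e, map_one]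
    simp
  · simp only [Complex.ofReal_zero, zero_mul, Complex.exp_zero]
    exact map_one θ
  · refine (hom_deriv θ' l).congr_of_eventuallyEq (Eventually.of_forall fun t => ?_)
    exact h' _ fun j => norm_exp_aux t (l j)

theorem Core.exists_hom (h : Core κ s φ) :
    ∃ ψ : F →⋆ₐ[ℂ] B, ∀ u ∈ unitary F, ψ u = s u := by
  have hex : ∀ a : F, ∃ q : B, IsSelfAdjoint a → DD s (Complex.I • a) (Complex.I • q) := by
    intro a
    by_cases ha : IsSelfAdjoint a
    · obtain ⟨X, hX, θ, θ', l, hl, h'⟩ := h.sa_case ha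
      exact ⟨θ' (fun j => (l j : ℂ)), fun _ => hl ▸ DD.hom h' l⟩
    · exact ⟨0, fun h => absurd h ha⟩
  choose Q hQ using hex
  have uniq : ∀ {a : F} {q : B}, IsSelfAdjoint a → DD s (Complex.I • a) (Complex.I • q) →
      Q a = q := fun {a q} ha hq =>
    smul_right_injective B Complex.I_ne_zero (DD.uniq h (hQ a ha) hq)
  have Qadd : ∀ {a b : F}, IsSelfAdjoint a → IsSelfAdjoint b → Q (a + b) = Q a + Q b :=
    fun {a b} ha hb => uniq (ha.add hb) (by
      rw [smul_add, smul_add]; exact (hQ a ha).add h (hQ b hb))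
  have Qsmul : ∀ (r : ℝ) {a : F}, IsSelfAdjoint a → Q (r • a) = r • Q a :=
    fun r {a} ha => uniq (IsSelfAdjoint.smul (IsSelfAdjoint.all r) ha) (by
      rw [smul_comm _ r, smul_comm _ r]; exact (hQ a ha).smul r)
  have Q0 : Q 0 = 0 := by simpa using Qsmul 0 (IsSelfAdjoint.zero F)
  have Qsub : ∀ {a b : F}, IsSelfAdjoint a → IsSelfAdjoint b → Q (a - b) = Q a - Q b :=
    fun {a b} ha hb => by
      have := Qadd (ha.sub hb) hb
      rw [sub_add_cancel] at this
      rw [this, add_sub_cancel_right]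
  let L : F →ₗ[ℂ] B :=
    { toFun := fun a => Q (realPart a : F) + Complex.I • Q (imaginaryPart a : F)
      map_add' := fun a b => by
        simp only [map_add, AddSubgroup.coe_add]
        rw [Qadd (realPart a).2 (realPart b).2, Qadd (imaginaryPart a).2 (imaginaryPart b).2,
          smul_add]
        abel
      map_smul' := fun z a => by
        have hr := (realPart a).2
        have hi := (imaginaryPart a).2
        simp only [realPart_smul, imaginaryPart_smul, AddSubgroup.coe_add, AddSubgroup.coe_sub,
          selfAdjoint.val_smul, RingHom.id_apply]
        rw [Qsub (IsSelfAdjoint.smul (IsSelfAdjoint.all _) hr)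
          (IsSelfAdjoint.smul (IsSelfAdjoint.all _) hi),
          Qadd (IsSelfAdjoint.smul (IsSelfAdjoint.all _) hi)
          (IsSelfAdjoint.smul (IsSelfAdjoint.all _) hr), Qsmul _ hr, Qsmul _ hr, Qsmul _ hi,
          Qsmul _ hi]
        conv_rhs => rw [← Complex.re_add_im z]
        simp only [← Complex.coe_smul, smul_add, add_smul, smul_smul]
        have : (z.im : ℂ) * Complex.I * Complex.I = -z.im := by
          rw [mul_assoc, Complex.I_mul_I, mul_neg_one]
        rw [add_mul, this, mul_comm Complex.I, mul_comm Complex.I]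
        module }
  have Lsa : ∀ a : F, IsSelfAdjoint a → L a = Q a := fun a ha => by
    change Q (realPart a : F) + Complex.I • Q (imaginaryPart a : F) = Q a
    rw [ha.coe_realPart, ha.imaginaryPart]
    simp [Q0]
  have Lu : ∀ u ∈ unitary F, L u = s u := fun u hu => by
    obtain ⟨X, hX, θ, θ', c, hc, hθ, hc1, h'⟩ := h.unit_case hu
    have sa : ∀ l : X → ℝ, IsSelfAdjoint (θ (fun j => (l j : ℂ))) := fun l => by
      rw [IsSelfAdjoint, ← map_star]
      congr 1
      ext j
      exact Complex.conj_ofReal _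
    have e : c = (fun j => ((c j).re : ℂ)) + Complex.I • (fun j => ((c j).im : ℂ)) := by
      ext j
      simp only [Pi.add_apply, Pi.smul_apply, smul_eq_mul, mul_comm Complex.I]
      exact (Complex.re_add_im _).symm
    have k : ∀ l : X → ℝ, L (θ (fun j => (l j : ℂ))) = θ' (fun j => (l j : ℂ)) := fun l => by
      rw [Lsa _ (sa l)]
      exact uniq (sa l) (DD.hom h' l)
    rw [← hc, h' c hc1, e, map_add, map_add, map_add, map_smul, map_smul, map_smul, k, k]
  have span : ∀ x : F, x ∈ Submodule.span ℂ (unitary F : Set F) := fun x => by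
    rw [CStarAlgebra.span_unitary]; trivial
  have Lmul : ∀ x y, L (x * y) = L x * L y := fun x y => by
    induction span x using Submodule.span_induction with
    | mem u hu =>
      induction span y using Submodule.span_induction with
      | mem v hv => rw [Lu _ (mul_mem hu hv), Lu u hu, Lu v hv, h.mul u v hu hv]
      | zero => simp
      | add y z _ _ hy hz => rw [mul_add, map_add, map_add, mul_add, hy, hz]
      | smul r y _ hy => rw [mul_smul_comm, map_smul, map_smul, mul_smul_comm, hy]
    | zero => simp
    | add x z _ _ hx hz => rw [add_mul, map_add, map_add, add_mul, hx, hz]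
    | smul r x _ hx => rw [smul_mul_assoc, map_smul, map_smul, smul_mul_assoc, hx]
  have Lstar : ∀ x, L (star x) = star (L x) := fun x => by
    induction span x using Submodule.span_induction with
    | mem u hu => rw [Lu _ (Unitary.star_mem hu), Lu u hu, h.str u hu]
    | zero => simp
    | add x z _ _ hx hz => rw [star_add, map_add, map_add, star_add, hx, hz]
    | smul r x _ hx => rw [star_smul, map_smul, map_smul, star_smul, hx]
  have L1 : L 1 = 1 := by rw [Lu 1 (one_mem _), h.one]
  exact ⟨{ AlgHom.ofLinearMap L L1 Lmul with map_star' := Lstar }, Lu⟩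

end core2

lemma Approx.mono {F B : Type*} [CStarAlgebra F] [CStarAlgebra B] {ε ε' : ℝ} {φ : F → B}
    (h : Approx ε φ) (he : ε ≤ ε') : Approx ε' φ where
  add x y hx hy := (h.add x y hx hy).trans he
  smul x l hx hl := (h.smul x l hx hl).trans he
  mul x y hx hy := (h.mul x y hx hy).trans he
  star x hx := (h.star x hx).trans he
  bound := h.bound
  one := h.one.trans he

lemma close_sa {F B : Type*} [CStarAlgebra F] [CStarAlgebra B] {κ : ℝ} {φ : F → B}
    (h : Approx κ φ) (ψ : F →⋆ₐ[ℂ] B) (hψ : ∀ u ∈ unitary F, ‖ψ u - φ u‖ ≤ κ)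
    (a : selfAdjoint F) (ha : ‖(a : F)‖ ≤ 1) : ‖ψ a - φ a‖ ≤ 4 * κ := by
  let _ := CStarAlgebra.spectralOrder F
  let _ := CStarAlgebra.spectralOrderedRing F
  let u : unitary F := selfAdjoint.unitarySelfAddISMul a ha
  have hu : (realPart (u : F)) = a := selfAdjoint.realPart_unitarySelfAddISMul a ha
  have hu2 : (a : F) = (1 / 2 : ℂ) • (u : F) + (1 / 2 : ℂ) • star (u : F) := by
    rw [← hu, realPart_apply_coe, ← Complex.coe_smul]
    push_cast
    rw [smul_add]; norm_num
  have n1 : ‖(u : F)‖ ≤ 1 := norm_unitary_le u.2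
  have n2 : ‖star (u : F)‖ ≤ 1 := by rw [norm_star]; exact n1
  have nh : ‖(1 / 2 : ℂ)‖ = 1 / 2 := by norm_num
  have m1 : ‖(1 / 2 : ℂ) • (u : F)‖ ≤ 1 := by rw [norm_smul, nh]; linarith
  have m2 : ‖(1 / 2 : ℂ) • star (u : F)‖ ≤ 1 := by rw [norm_smul, nh]; linarith
  have a1 := h.add _ _ m1 m2
  have a2 := h.smul u (1 / 2) n1 (by norm_num)
  have a3 := h.smul (star (u : F)) (1 / 2) n2 (by norm_num)
  have a4 := hψ u u.2
  have a5 := hψ (star (u : F)) (Unitary.star_mem u.2)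
  rw [← hu2] at a1
  have e : ψ a - φ a = (1 / 2 : ℂ) • (ψ u - φ u) + (1 / 2 : ℂ) • (ψ (star (u : F)) - φ (star (u : F)))
      - (φ ((1 / 2 : ℂ) • (u : F)) - (1 / 2 : ℂ) • φ u)
      - (φ ((1 / 2 : ℂ) • star (u : F)) - (1 / 2 : ℂ) • φ (star (u : F)))
      - (φ a - φ ((1 / 2 : ℂ) • (u : F)) - φ ((1 / 2 : ℂ) • star (u : F))) := by
    have : ψ a = (1 / 2 : ℂ) • ψ u + (1 / 2 : ℂ) • ψ (star (u : F)) := by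
      conv_lhs => rw [hu2]
      rw [map_add, map_smul, map_smul]
    rw [this]
    module
  have b4 : ‖(1 / 2 : ℂ) • (ψ u - φ u)‖ ≤ 1 / 2 * κ := by rw [norm_smul, nh]; gcongr
  have b5 : ‖(1 / 2 : ℂ) • (ψ (star (u : F)) - φ (star (u : F)))‖ ≤ 1 / 2 * κ := by
    rw [norm_smul, nh]; gcongr
  rw [e]
  refine (norm_sub_le _ _).trans ?_
  refine (add_le_add ((norm_sub_le _ _).trans (add_le_add ((norm_sub_le _ _).trans
    (add_le_add ((norm_add_le _ _).trans (add_le_add b4 b5)) a2)) a3)) a1).trans ?_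
  linarith

lemma close_ball {F B : Type*} [CStarAlgebra F] [CStarAlgebra B] {κ : ℝ} {φ : F → B}
    (h : Approx κ φ) (ψ : F →⋆ₐ[ℂ] B) (hψ : ∀ u ∈ unitary F, ‖ψ u - φ u‖ ≤ κ)
    (x : F) (hx : ‖x‖ ≤ 1) : ‖ψ x - φ x‖ ≤ 10 * κ := by
  have nr : ‖(realPart x : F)‖ ≤ 1 := (realPart.norm_le x).trans hx
  have ni : ‖(imaginaryPart x : F)‖ ≤ 1 := (imaginaryPart.norm_le x).trans hx
  have c1 := close_sa h ψ hψ (realPart x) nr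
  have c2 := close_sa h ψ hψ (imaginaryPart x) ni
  have ex := realPart_add_I_smul_imaginaryPart x
  have ni' : ‖Complex.I • (imaginaryPart x : F)‖ ≤ 1 := by
    rw [norm_smul, Complex.norm_I, one_mul]; exact ni
  have a1 := h.add _ _ nr ni'
  have a2 := h.smul (imaginaryPart x : F) Complex.I ni (by simp)
  rw [ex] at a1
  have c2' : ‖Complex.I • (ψ (imaginaryPart x : F) - φ (imaginaryPart x : F))‖ ≤ 4 * κ := by
    rw [norm_smul, Complex.norm_I, one_mul]; exact c2
  have e : ψ x - φ x = (ψ (realPart x : F) - φ (realPart x : F))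
      + Complex.I • (ψ (imaginaryPart x : F) - φ (imaginaryPart x : F))
      - (φ (Complex.I • (imaginaryPart x : F)) - Complex.I • φ (imaginaryPart x : F))
      - (φ x - φ (realPart x : F) - φ (Complex.I • (imaginaryPart x : F))) := by
    have : ψ x = ψ (realPart x : F) + Complex.I • ψ (imaginaryPart x : F) := by
      conv_lhs => rw [← ex]
      rw [map_add, map_smul]
    rw [this]
    module
  rw [e]
  refine (norm_sub_le _ _).trans ?_
  refine (add_le_add ((norm_sub_le _ _).trans
    (add_le_add ((norm_add_le _ _).trans (add_le_add c1 c2')) a2)) a1).trans ?_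
  linarith

theorem core_unital {F B : Type*} [CStarAlgebra F] [CStarAlgebra B] [FiniteDimensional ℂ F]
    [Nontrivial F] [Nontrivial B] {ε : ℝ} (hε : 0 < ε) (hε1 : ε ≤ 1 / 40000000) {φ : F → B}
    (h : Approx ε φ) : ∃ ψ : F →⋆ₐ[ℂ] B, ∀ x, ‖x‖ ≤ 1 → ‖ψ x - φ x‖ ≤ 4000000 * ε := by
  classical
  obtain ⟨σ, hσ⟩ := exists_rep hε (by linarith) h
  let s : F → B := fun x => if hx : x ∈ unitary F then (σ ⟨x, hx⟩ : B) else 0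
  have hs : ∀ u : unitary F, s u = σ u := fun u => by simp [s]
  have hs' : ∀ u (hu : u ∈ unitary F), s u = σ ⟨u, hu⟩ := fun u hu => hs ⟨u, hu⟩
  have hc : Core (400000 * ε) s φ :=
    { small := by linarith
      one := by
        have := hs 1
        rwa [map_one] at this
      mul := fun u v hu hv => by
        rw [hs' u hu, hs' v hv, hs' _ (mul_mem hu hv), ← Submonoid.coe_mul, ← map_mul]
        rfl
      str := fun u hu => by
        rw [hs' u hu, hs' _ (Unitary.star_mem hu)]
        have e : (⟨star u, Unitary.star_mem hu⟩ : unitary F) = (⟨u, hu⟩ : unitary F)⁻¹ := rfl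
        rw [e, map_inv]
        rfl
      near := fun u hu => by rw [hs' u hu]; exact hσ ⟨u, hu⟩
      approx := h.mono (by linarith) }
  obtain ⟨ψ, hψ⟩ := hc.exists_hom
  refine ⟨ψ, fun x hx => ?_⟩
  have := close_ball hc.approx ψ (fun u hu => by rw [hψ u hu]; exact hc.near u hu) x hx
  linarith

section unitize
variable {F A : Type*} [NonUnitalCStarAlgebra F] [NonUnitalCStarAlgebra A] {ε : ℝ} {φ : F → A}

/-- rescaled map. -/
noncomputable def Sc (φ : F → A) (a : F) : A := (16 : ℂ) • φ ((1 / 16 : ℂ) • a)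

lemma norm_sc_le {a : F} (ha : ‖a‖ ≤ 16) : ‖(1 / 16 : ℂ) • a‖ ≤ 1 := by
  rw [norm_smul]; norm_num; linarith

lemma norm_16 (a : A) : ‖(16 : ℂ) • a‖ = 16 * ‖a‖ := by
  rw [norm_smul]; norm_num

lemma Sc_add (h : IsApproxStarHom ε φ) {a b : F} (ha : ‖a‖ ≤ 16) (hb : ‖b‖ ≤ 16) :
    ‖Sc φ (a + b) - Sc φ a - Sc φ b‖ ≤ 16 * ε := by
  have := h.1 _ _ (norm_sc_le ha) (norm_sc_le hb)
  simp only [Sc, ← smul_sub, smul_add, norm_16]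
  linarith

lemma Sc_smul (h : IsApproxStarHom ε φ) {a : F} {z : ℂ} (ha : ‖a‖ ≤ 16) (hz : ‖z‖ ≤ 1) :
    ‖Sc φ (z • a) - z • Sc φ a‖ ≤ 16 * ε := by
  have := h.2.1 _ z (norm_sc_le ha) hz
  simp only [Sc]
  rw [smul_comm _ z, smul_comm z (16 : ℂ), ← smul_sub, norm_16]
  linarith

lemma Sc_star (h : IsApproxStarHom ε φ) {a : F} (ha : ‖a‖ ≤ 16) :
    ‖Sc φ (star a) - star (Sc φ a)‖ ≤ 16 * ε := by
  have := h.2.2.2.1 _ (norm_sc_le ha)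
  have e : Sc φ (star a) - star (Sc φ a) =
      (16 : ℂ) • (φ (star ((1 / 16 : ℂ) • a)) - star (φ ((1 / 16 : ℂ) • a))) := by
    simp [Sc, star_smul, smul_sub]
  rw [e, norm_16]
  linarith

lemma Sc_near (h : IsApproxStarHom ε φ) {a : F} (ha : ‖a‖ ≤ 1) :
    ‖Sc φ a - φ a‖ ≤ 16 * ε := by
  have := h.2.1 a (1 / 16) ha (by norm_num)
  have e : Sc φ a - φ a = (16 : ℂ) • (φ ((1 / 16 : ℂ) • a) - (1 / 16 : ℂ) • φ a) := by
    simp only [Sc]; module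
  rw [e, norm_16]
  linarith

lemma Sc_mul (h : IsApproxStarHom ε φ) {a b : F} (ha : ‖a‖ ≤ 2) (hb : ‖b‖ ≤ 2) :
    ‖Sc φ (a * b) - Sc φ a * Sc φ b‖ ≤ 512 * ε := by
  have hab : ‖a * b‖ ≤ 16 := (norm_mul_le _ _).trans (by nlinarith [norm_nonneg a, norm_nonneg b])
  have h1 := h.2.2.1 _ _ (norm_sc_le (ha.trans (by norm_num))) (norm_sc_le (hb.trans (by norm_num)))
  have h2 := h.2.1 _ (1 / 16) (norm_sc_le hab) (by norm_num)
  have e0 : (1 / 16 : ℂ) • a * (1 / 16 : ℂ) • b = (1 / 16 : ℂ) • (1 / 16 : ℂ) • (a * b) := by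
    rw [smul_mul_smul_comm, smul_smul]
  rw [e0] at h1
  set c : F := (1 / 16 : ℂ) • (a * b)
  have e : Sc φ (a * b) - Sc φ a * Sc φ b =
      (16 : ℂ) • (16 : ℂ) • ((φ ((1 / 16 : ℂ) • c) - φ ((1 / 16 : ℂ) • a) * φ ((1 / 16 : ℂ) • b)) -
        (φ ((1 / 16 : ℂ) • c) - (1 / 16 : ℂ) • φ c)) := by
    simp only [Sc, smul_mul_smul_comm]
    change (16 : ℂ) • φ c - _ = _
    module
  rw [e, norm_16, norm_16]
  have := norm_sub_le (φ ((1 / 16 : ℂ) • c) - φ ((1 / 16 : ℂ) • a) * φ ((1 / 16 : ℂ) • b))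
    (φ ((1 / 16 : ℂ) • c) - (1 / 16 : ℂ) • φ c)
  linarith

lemma Sc_zero (h : IsApproxStarHom ε φ) : ‖Sc φ 0‖ ≤ 16 * ε := by
  have := h.2.1 0 0 (by simp) (by simp)
  rw [zero_smul, zero_smul, sub_zero] at this
  simp only [Sc, smul_zero, norm_16]
  linarith

lemma Sc_bound (h : IsApproxStarHom ε φ) (hε : ε ≤ 1 / 100) {a : F} (ha : ‖a‖ ≤ 2) :
    ‖Sc φ a‖ ≤ 3 := by
  set b : F := (1 / 2 : ℂ) • a
  have hb : ‖b‖ ≤ 1 := by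
    simp only [b, norm_smul]; norm_num; linarith
  have hab : a = b + b := by simp only [b]; module
  have h1 := Sc_add h (a := b) (b := b) (by linarith) (by linarith)
  rw [← hab] at h1
  have h2 := Sc_near h hb
  have h3 := h.2.2.2.2 b hb
  have e : Sc φ a = (Sc φ a - Sc φ b - Sc φ b) + ((Sc φ b - φ b) + (Sc φ b - φ b)) + (φ b + φ b) := by
    abel
  rw [e]
  refine (norm_add_le _ _).trans ?_
  refine (add_le_add ((norm_add_le _ _).trans (add_le_add h1 ((norm_add_le _ _).trans
    (add_le_add h2 h2)))) ((norm_add_le _ _).trans (add_le_add h3 h3))).trans ?_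
  linarith

/-- unitized map. -/
noncomputable def Un (φ : F → A) (x : Unitization ℂ F) : Unitization ℂ A :=
  Unitization.inl x.fst + Unitization.inr (Sc φ x.snd)

lemma Un_fst_sub (x y : Unitization ℂ F) : (x - y).fst = x.fst - y.fst :=
  eq_sub_of_add_eq (by rw [← Unitization.fst_add, sub_add_cancel])

lemma Un_snd_sub (x y : Unitization ℂ F) : (x - y).snd = x.snd - y.snd :=
  eq_sub_of_add_eq (by rw [← Unitization.snd_add, sub_add_cancel])

lemma norm_fst_le (x : Unitization ℂ F) : ‖x.fst‖ ≤ ‖x‖ := by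
  rw [Unitization.norm_eq_sup]; exact le_sup_left

lemma norm_inl_le (z : ℂ) : ‖(Unitization.inl z : Unitization ℂ F)‖ ≤ ‖z‖ := by
  have : (Unitization.inl z : Unitization ℂ F) = z • 1 := by
    ext <;> simp
  rw [this, norm_smul, CStarRing.norm_one, mul_one]

lemma norm_snd_le (x : Unitization ℂ F) : ‖x.snd‖ ≤ 2 * ‖x‖ := by
  have e : (Unitization.inr x.snd : Unitization ℂ F) = x - Unitization.inl x.fst := by
    ext <;> simp [Un_fst_sub, Un_snd_sub]
  rw [← Unitization.norm_inr (𝕜 := ℂ), e]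
  have := norm_sub_le x (Unitization.inl x.fst)
  have := norm_inl_le (F := F) x.fst
  have := norm_fst_le x
  linarith

lemma Un_approx (h : IsApproxStarHom ε φ) (h0 : 0 ≤ ε) (hε : ε ≤ 1 / 100) :
    Approx (1000 * ε) (Un φ) := by
  have s2 : ∀ x : Unitization ℂ F, ‖x‖ ≤ 1 → ‖x.snd‖ ≤ 2 := fun x hx =>
    (norm_snd_le x).trans (by linarith)
  have f1 : ∀ x : Unitization ℂ F, ‖x‖ ≤ 1 → ‖x.fst‖ ≤ 1 := fun x hx => (norm_fst_le x).trans hx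
  refine ⟨fun x y hx hy => ?_, fun x l hx hl => ?_, fun x y hx hy => ?_, fun x hx => ?_,
    fun x hx => ?_, ?_⟩
  · have e : Un φ (x + y) - Un φ x - Un φ y =
        Unitization.inr (Sc φ (x.snd + y.snd) - Sc φ x.snd - Sc φ y.snd) := by
      ext <;> simp [Un_fst_sub, Un_snd_sub, Un]
    rw [e, Unitization.norm_inr]
    have := Sc_add h ((s2 x hx).trans (by norm_num)) ((s2 y hy).trans (by norm_num))
    linarith
  · have e : Un φ (l • x) - l • Un φ x =
        Unitization.inr (Sc φ (l • x.snd) - l • Sc φ x.snd) := by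
      ext <;> simp [Un_fst_sub, Un_snd_sub, Un]
    rw [e, Unitization.norm_inr]
    have := Sc_smul h ((s2 x hx).trans (by norm_num)) hl
    linarith
  · obtain ⟨l, hl⟩ : ∃ l, l = x.fst := ⟨_, rfl⟩
    obtain ⟨m, hm⟩ : ∃ m, m = y.fst := ⟨_, rfl⟩
    obtain ⟨a, ha⟩ : ∃ a, a = x.snd := ⟨_, rfl⟩
    obtain ⟨b, hb⟩ : ∃ b, b = y.snd := ⟨_, rfl⟩
    have e : Un φ (x * y) - Un φ x * Un φ y =
        Unitization.inr (Sc φ (l • b + m • a + a * b) -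
          (l • Sc φ b + m • Sc φ a + Sc φ a * Sc φ b)) := by
      ext <;> simp [Un_fst_sub, Un_snd_sub, Un, hl, hm, ha, hb]
    have hl1 : ‖l‖ ≤ 1 := hl ▸ f1 x hx
    have hm1 : ‖m‖ ≤ 1 := hm ▸ f1 y hy
    have ha2 : ‖a‖ ≤ 2 := ha ▸ s2 x hx
    have hb2 : ‖b‖ ≤ 2 := hb ▸ s2 y hy
    have n1 : ‖l • b‖ ≤ 2 := by rw [norm_smul]; nlinarith [norm_nonneg b, norm_nonneg l]
    have n2 : ‖m • a‖ ≤ 2 := by rw [norm_smul]; nlinarith [norm_nonneg a, norm_nonneg m]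
    have n3 : ‖a * b‖ ≤ 4 := (norm_mul_le _ _).trans (by nlinarith [norm_nonneg a, norm_nonneg b])
    have n4 : ‖l • b + m • a‖ ≤ 4 := (norm_add_le _ _).trans (by linarith)
    have k1 := Sc_add h (a := l • b + m • a) (b := a * b) (by linarith) (by linarith)
    have k2 := Sc_add h (a := l • b) (b := m • a) (by linarith) (by linarith)
    have k3 := Sc_smul h (a := b) (by linarith) hl1
    have k4 := Sc_smul h (a := a) (by linarith) hm1
    have k5 := Sc_mul h ha2 hb2
    rw [e, Unitization.norm_inr]
    have e2 : Sc φ (l • b + m • a + a * b) - (l • Sc φ b + m • Sc φ a + Sc φ a * Sc φ b) =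
      (Sc φ (l • b + m • a + a * b) - Sc φ (l • b + m • a) - Sc φ (a * b)) +
      (Sc φ (l • b + m • a) - Sc φ (l • b) - Sc φ (m • a)) +
      (Sc φ (l • b) - l • Sc φ b) + (Sc φ (m • a) - m • Sc φ a) +
      (Sc φ (a * b) - Sc φ a * Sc φ b) := by abel
    rw [e2]
    refine (norm_add_le _ _).trans ?_
    refine (add_le_add ((norm_add_le _ _).trans (add_le_add ((norm_add_le _ _).trans
      (add_le_add ((norm_add_le _ _).trans (add_le_add k1 k2)) k3)) k4)) k5).trans ?_
    linarith
  · have e : Un φ (star x) - star (Un φ x) =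
        Unitization.inr (Sc φ (star x.snd) - star (Sc φ x.snd)) := by
      ext <;> simp [Un_fst_sub, Un_snd_sub, Un]
    rw [e, Unitization.norm_inr]
    have := Sc_star h ((s2 x hx).trans (by norm_num))
    linarith
  · refine (norm_add_le _ _).trans ?_
    rw [Unitization.norm_inr]
    have := Sc_bound h hε (s2 x hx)
    have := norm_inl_le (F := A) x.fst
    have := f1 x hx
    linarith
  · have e : Un φ 1 - 1 = Unitization.inr (Sc φ 0) := by
      ext <;> simp [Un_fst_sub, Un_snd_sub, Un]
    rw [e, Unitization.norm_inr]
    have := Sc_zero h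
    linarith

theorem nonunital [FiniteDimensional ℂ F] (h : IsApproxStarHom ε φ) (h0 : 0 < ε)
    (hε : ε ≤ 1 / 100000000000) :
    ∃ ψ : F →⋆ₙₐ[ℂ] A, ∀ x : F, ‖x‖ ≤ 1 → ‖ψ x - φ x‖ ≤ 5000000000 * ε := by
  have : FiniteDimensional ℂ (Unitization ℂ F) :=
    (Unitization.linearEquiv ℂ ℂ F).symm.finiteDimensional
  obtain ⟨Ψ, hΨ⟩ := core_unital (by positivity) (by linarith)
    (Un_approx h h0.le (hε.trans (by norm_num)))
  have hfst : ∀ x : Unitization ℂ F, ‖x‖ ≤ 1 → ‖(Ψ x).fst - x.fst‖ ≤ 1 / 2 := fun x hx => by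
    have e : (Ψ x).fst - x.fst = (Ψ x - Un φ x).fst := by simp [Un_fst_sub, Un_snd_sub, Un]
    rw [e]
    refine (norm_fst_le _).trans ((hΨ x hx).trans ?_)
    linarith
  have hu : ∀ u ∈ unitary (Unitization ℂ F), (Ψ u).fst = u.fst := fun u hu => by
    have hn : ∀ v ∈ unitary (Unitization ℂ F), star v.fst * v.fst = 1 := fun v hv => by
      have := congrArg (fun w => w.fst) (Unitary.star_mul_self_of_mem hv)
      simpa using this
    have key : (Ψ u).fst * star u.fst = 1 := by
      refine eq_one_of_pow_near fun n => ?_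
      have hun := pow_mem hu n
      have e : ((Ψ u).fst * star u.fst) ^ n = (Ψ (u ^ n)).fst * star (u ^ n).fst := by
        have a1 : (Ψ (u ^ n)).fst = (Ψ u).fst ^ n := by
          rw [map_pow]; exact map_pow (Unitization.fstHom ℂ A) _ n
        have a2 : (u ^ n).fst = u.fst ^ n := map_pow (Unitization.fstHom ℂ F) _ n
        rw [a1, a2, mul_pow, star_pow]
      have e2 : (Ψ (u ^ n)).fst * star (u ^ n).fst - 1 =
          ((Ψ (u ^ n)).fst - (u ^ n).fst) * star (u ^ n).fst := by
        rw [sub_mul, mul_comm (u ^ n).fst, hn _ hun]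
      rw [e, e2, norm_mul, norm_star]
      have b1 := hfst _ (norm_unitary_le hun)
      have b2 := (norm_fst_le (u ^ n)).trans (norm_unitary_le hun)
      nlinarith [norm_nonneg ((Ψ (u ^ n)).fst - (u ^ n).fst), norm_nonneg (u ^ n).fst]
    calc (Ψ u).fst = (Ψ u).fst * (star u.fst * u.fst) := by rw [hn u hu, mul_one]
      _ = u.fst := by rw [← mul_assoc, key, one_mul]
  have hall : ∀ x, (Ψ x).fst = x.fst := fun x => by
    have hx : x ∈ Submodule.span ℂ (unitary (Unitization ℂ F) : Set (Unitization ℂ F)) := by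
      rw [CStarAlgebra.span_unitary]; trivial
    induction hx using Submodule.span_induction with
    | mem u h => exact hu u h
    | zero => simp
    | add x y _ _ hx hy => simp [hx, hy]
    | smul r x _ hx => simp [hx]
  have h0' : ∀ x : F, (Ψ (Unitization.inr x)).fst = 0 := fun x => by rw [hall]; simp
  let ψ : F →⋆ₙₐ[ℂ] A :=
    { toFun := fun x => (Ψ (Unitization.inr x)).snd
      map_smul' := fun r x => by simp [Unitization.inr_smul]
      map_zero' := by simp
      map_add' := fun x y => by simp [Unitization.inr_add]
      map_mul' := fun x y => by
        rw [Unitization.inr_mul, map_mul, Unitization.snd_mul, h0', h0']; simp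
      map_star' := fun x => by rw [Unitization.inr_star, map_star]; simp }
  refine ⟨ψ, fun x hx => ?_⟩
  have e : (Unitization.inr (ψ x - Sc φ x) : Unitization ℂ A) =
      Ψ (Unitization.inr x) - Un φ (Unitization.inr x) := by
    ext
    · simp [Un_fst_sub, Un_snd_sub, Un, h0']
    · simp [Un_fst_sub, Un_snd_sub, Un, ψ]
  have a1 : ‖ψ x - Sc φ x‖ ≤ 4000000 * (1000 * ε) := by
    rw [← Unitization.norm_inr (𝕜 := ℂ), e]
    exact hΨ _ (by rw [Unitization.norm_inr]; exact hx)
  have := tri a1 (Sc_near h hx)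
  linarith

end unitize

end UlamStab

universe u v

/-- Quantitative Ulam stability: there are `K, δ > 0` such that for `0 < ε < δ`, any
`ε`-*-homomorphism from a finite-dimensional C*-algebra into any C*-algebra is within
`K √ε` of an actual *-homomorphism on the closed unit ball. -/
theorem ulam_stability_fin_dim_quantitative :
    ∃ K δ : ℝ, 0 < K ∧ 0 < δ ∧
      ∀ ε : ℝ, 0 < ε → ε < δ →
      ∀ (F : Type u) (A : Type v)
        [NonUnitalNormedRing F] [StarRing F] [CStarRing F] [NormedSpace ℂ F]
        [IsScalarTower ℂ F F] [SMulCommClass ℂ F F] [StarModule ℂ F] [CompleteSpace F]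
        [FiniteDimensional ℂ F]
        [NonUnitalNormedRing A] [StarRing A] [CStarRing A] [NormedSpace ℂ A]
        [IsScalarTower ℂ A A] [SMulCommClass ℂ A A] [StarModule ℂ A] [CompleteSpace A]
        (φ : F → A), IsApproxStarHom ε φ →
          ∃ ψ : F →⋆ₙₐ[ℂ] A, ∀ x : F, ‖x‖ ≤ 1 → ‖ψ x - φ x‖ < K * Real.sqrt ε := by
  refine ⟨10000000000, 1 / 100000000000, by norm_num, by norm_num, ?_⟩
  intro ε h0 hε F A _ _ _ _ _ _ _ _ _ _ _ _ _ _ _ _ _ φ hφ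
  let _ : NonUnitalCStarAlgebra F := {}
  let _ : NonUnitalCStarAlgebra A := {}
  obtain ⟨ψ, hψ⟩ := UlamStab.nonunital (F := F) (A := A) (φ := φ) hφ h0 hε.le
  refine ⟨ψ, fun x hx => (hψ x hx).trans_lt ?_⟩
  have hs : 0 < Real.sqrt ε := Real.sqrt_pos.mpr h0
  have hsq : Real.sqrt ε * Real.sqrt ε = ε := Real.mul_self_sqrt h0.le
  have hs1 : Real.sqrt ε ≤ 1 := by
    refine Real.sqrt_le_one.mpr ?_
    linarith
  nlinarith
end

section
/- Suppose ε < 1/100, ℓ is a positive integer, B is a C*-algebra, and φ : M_ℓ(ℂ) → B is a 2√ε-nonzero ε-*-homomorphism with ‖φ(x)‖ ≤ 1 for every x in the closed unit ball of M_ℓ(ℂ). Then φ is 2√ε-isometric, i.e. ‖φ(x)‖ ∈ [1 − 2√ε, 1 + 2√ε] for every x ∈ M_ℓ(ℂ) with ‖x‖ = 1. -/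
universe u

/-- `M_ℓ(ℂ)` with the operator norm, realized as the algebra of (automatically bounded)
operators on the `ℓ`-dimensional complex Hilbert space. -/
abbrev MatrixAlg (ℓ : ℕ) : Type :=
  EuclideanSpace ℂ (Fin ℓ) →L[ℂ] EuclideanSpace ℂ (Fin ℓ)

/-- The C*-type consequence of the approximate relations: `φ(star u * u)` is within `2ε`
of `star (φ u) * φ u`. -/
lemma approx_star_mul {A B : Type*}
    [NonUnitalNormedRing A] [StarRing A] [CStarRing A] [Module ℂ A]
    [NonUnitalNormedRing B] [StarRing B] [CStarRing B] [Module ℂ B]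
    {ε : ℝ} {φ : A → B} (hφ : IsApproxStarHom ε φ)
    (hcontr : ∀ x : A, ‖x‖ ≤ 1 → ‖φ x‖ ≤ 1) (u : A) (hu : ‖u‖ ≤ 1) :
    |‖φ (star u * u)‖ - ‖φ u‖ ^ 2| ≤ 2 * ε ∧ |‖φ (u * star u)‖ - ‖φ u‖ ^ 2| ≤ 2 * ε := by
  obtain ⟨-, -, hmul, hstar, -⟩ := hφ
  have hsu : ‖star u‖ ≤ 1 := by rwa [norm_star]
  have h3 := hstar u hu
  have hc := hcontr u hu
  have hε : 0 ≤ ε := (norm_nonneg _).trans h3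
  constructor
  · have h1 := hmul (star u) u hsu hu
    have e : φ (star u * u) - star (φ u) * φ u
        = (φ (star u * u) - φ (star u) * φ u) + (φ (star u) - star (φ u)) * φ u := by
      noncomm_ring
    have h4 : ‖(φ (star u) - star (φ u)) * φ u‖ ≤ ε :=
      (norm_mul_le _ _).trans (by nlinarith [norm_nonneg (φ u)])
    have h5 : ‖φ (star u * u) - star (φ u) * φ u‖ ≤ 2 * ε := by
      rw [e]; exact (norm_add_le _ _).trans (by linarith)
    have h6 := (abs_norm_sub_norm_le _ _).trans h5
    rwa [CStarRing.norm_star_mul_self, ← sq] at h6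
  · have h1 := hmul u (star u) hu hsu
    have e : φ (u * star u) - φ u * star (φ u)
        = (φ (u * star u) - φ u * φ (star u)) + φ u * (φ (star u) - star (φ u)) := by
      noncomm_ring
    have h4 : ‖φ u * (φ (star u) - star (φ u))‖ ≤ ε :=
      (norm_mul_le _ _).trans (by nlinarith [norm_nonneg (φ u)])
    have h5 : ‖φ (u * star u) - φ u * star (φ u)‖ ≤ 2 * ε := by
      rw [e]; exact (norm_add_le _ _).trans (by linarith)
    have h6 := (abs_norm_sub_norm_le _ _).trans h5
    rwa [CStarRing.norm_self_mul_star, ← sq] at h6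

/-- A star projection in a C*-ring has norm at most one. -/
lemma starProj_norm_le_one {A : Type*} [NonUnitalNormedRing A] [StarRing A] [CStarRing A]
    {p : A} (hp : IsStarProjection p) : ‖p‖ ≤ 1 := by
  have h := CStarRing.norm_star_mul_self (x := p)
  rw [hp.isSelfAdjoint.star_eq, hp.isIdempotentElem.eq] at h
  nlinarith [norm_nonneg p]

/-- Images of projections have norm near zero or near one. -/
lemma approx_proj_dichotomy {A B : Type*}
    [NonUnitalNormedRing A] [StarRing A] [CStarRing A] [Module ℂ A]
    [NonUnitalNormedRing B] [StarRing B] [CStarRing B] [Module ℂ B]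
    {ε : ℝ} (hε0 : 0 < ε) (hε : ε < 1 / 100) {φ : A → B} (hφ : IsApproxStarHom ε φ)
    (hcontr : ∀ x : A, ‖x‖ ≤ 1 → ‖φ x‖ ≤ 1) {p : A} (hp : IsStarProjection p) :
    ‖φ p‖ ≤ 3 * ε ∨ 1 - 3 * ε ≤ ‖φ p‖ := by
  have h := (approx_star_mul hφ hcontr p (starProj_norm_le_one hp)).1
  rw [hp.isSelfAdjoint.star_eq, hp.isIdempotentElem.eq, abs_le] at h
  by_contra! hc
  nlinarith [mul_pos (sub_pos.2 hc.1) (sub_pos.2 hc.2)]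

/-- In finite dimension the operator norm is attained. -/
lemma exists_unit_norm_eq {ℓ : ℕ} (x : MatrixAlg ℓ) (hx : ‖x‖ = 1) :
    ∃ v, ‖v‖ = 1 ∧ ‖x v‖ = 1 := by
  have hne : (Metric.sphere (0 : EuclideanSpace ℂ (Fin ℓ)) 1).Nonempty := by
    by_contra hc
    have h0 : x = 0 := by
      ext1 v
      by_contra hv
      have hv0 : v ≠ 0 := by rintro rfl; simp at hv
      refine hc ⟨((‖v‖⁻¹ : ℝ) : ℂ) • v, ?_⟩
      simp [norm_smul, hv0]
    simp [h0] at hx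
  obtain ⟨v, hv, hmax⟩ := (isCompact_sphere (0 : EuclideanSpace ℂ (Fin ℓ)) 1).exists_isMaxOn hne
    (f := fun v => ‖x v‖) (by fun_prop)
  have hv1 : ‖v‖ = 1 := by simpa using hv
  refine ⟨v, hv1, le_antisymm ?_ ?_⟩
  · simpa [hx, hv1] using x.le_opNorm v
  · rw [← hx]
    refine x.opNorm_le_bound (norm_nonneg _) fun w => ?_
    by_cases hw : w = 0
    · simp [hw]
    have h1 : ‖x (((‖w‖⁻¹ : ℝ) : ℂ) • w)‖ ≤ ‖x v‖ := hmax (by simp [norm_smul, hw])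
    rw [map_smul, norm_smul] at h1
    simp only [Complex.norm_real, norm_inv, norm_norm] at h1
    rwa [inv_mul_le_iff₀ (norm_pos_iff.2 hw), mul_comm] at h1

open InnerProductSpace in
/-- Rank one projections are star projections. -/
lemma rankOne_starProj {ℓ : ℕ} (v : EuclideanSpace ℂ (Fin ℓ)) (hv : ‖v‖ = 1) :
    IsStarProjection (rankOne ℂ v v : MatrixAlg ℓ) := by
  constructor
  · rw [IsIdempotentElem]
    ext1 w
    simp [hv]
  · rw [IsSelfAdjoint, ContinuousLinearMap.star_eq_adjoint]
    simp

/-- If `ε < 1/100` and `φ : M_ℓ(ℂ) → B` is a `2√ε`-nonzero `ε`-*-homomorphism with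
`‖φ‖ ≤ 1`, then `φ` is `2√ε`-isometric. -/
theorem approx_hom_matrix_isometric (ε : ℝ) (hε0 : 0 < ε) (hε : ε < 1 / 100)
    (ℓ : ℕ) (hℓ : 0 < ℓ) (B : Type u)
    [NonUnitalNormedRing B] [StarRing B] [CStarRing B] [NormedSpace ℂ B]
    [IsScalarTower ℂ B B] [SMulCommClass ℂ B B] [StarModule ℂ B] [CompleteSpace B]
    (φ : MatrixAlg ℓ → B) (hφ : IsApproxStarHom ε φ)
    (hcontr : ∀ x : MatrixAlg ℓ, ‖x‖ ≤ 1 → ‖φ x‖ ≤ 1)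
    (hnonzero : ∃ a : MatrixAlg ℓ, ‖a‖ = 1 ∧ 1 - 2 * Real.sqrt ε ≤ ‖φ a‖) :
    ∀ x : MatrixAlg ℓ, ‖x‖ = 1 →
      ‖φ x‖ ∈ Set.Icc (1 - 2 * Real.sqrt ε) (1 + 2 * Real.sqrt ε) := by
  obtain ⟨a, ha, hφa⟩ := hnonzero
  have hs0 : 0 < Real.sqrt ε := Real.sqrt_pos.2 hε0
  have hs2 : Real.sqrt ε ^ 2 = ε := Real.sq_sqrt hε0.le
  have hs1 : Real.sqrt ε < 1 / 10 := by
    nlinarith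
  have hadd := hφ.1
  have hmul := hφ.2.2.1
  -- if one rank one projection is small then all are
  have hswap : ∀ v w : EuclideanSpace ℂ (Fin ℓ), ‖v‖ = 1 → ‖w‖ = 1 →
      ‖φ (InnerProductSpace.rankOne ℂ v v)‖ ≤ 3 * ε →
      ‖φ (InnerProductSpace.rankOne ℂ w w)‖ ≤ 3 * ε := by
    intro v w hv hw h
    have hu : ‖(InnerProductSpace.rankOne ℂ w v : MatrixAlg ℓ)‖ ≤ 1 := by simp [hv, hw]
    obtain ⟨h1, h2⟩ := approx_star_mul hφ hcontr _ hu
    have e1 : star (InnerProductSpace.rankOne ℂ w v : MatrixAlg ℓ)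
        * InnerProductSpace.rankOne ℂ w v = InnerProductSpace.rankOne ℂ v v := by
      ext1 z
      simp [ContinuousLinearMap.star_eq_adjoint, hw]
    have e2 : (InnerProductSpace.rankOne ℂ w v : MatrixAlg ℓ)
        * star (InnerProductSpace.rankOne ℂ w v) = InnerProductSpace.rankOne ℂ w w := by
      ext1 z
      simp [ContinuousLinearMap.star_eq_adjoint, hv]
    rw [e1, abs_le] at h1
    rw [e2, abs_le] at h2
    rcases approx_proj_dichotomy hε0 hε hφ hcontr (rankOne_starProj w hw) with h3 | h3
    · exact h3
    · linarith
  -- the unit is not small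
  have hone : 3 * ε < ‖φ 1‖ := by
    by_contra! hc
    have h1 : ‖(1 : MatrixAlg ℓ)‖ ≤ 1 := ContinuousLinearMap.norm_id_le
    have h2 := hmul 1 a h1 ha.le
    rw [one_mul] at h2
    have h3 : ‖φ a‖ ≤ ‖φ a - φ 1 * φ a‖ + ‖φ 1 * φ a‖ := by
      simpa using norm_add_le (φ a - φ 1 * φ a) (φ 1 * φ a)
    have h4 := norm_mul_le (φ 1) (φ a)
    have h5 := hcontr a ha.le
    nlinarith [norm_nonneg (φ a), norm_nonneg (φ 1)]
  -- all rank one projections are large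
  have hlarge : ∀ v : EuclideanSpace ℂ (Fin ℓ), ‖v‖ = 1 →
      1 - 3 * ε ≤ ‖φ (InnerProductSpace.rankOne ℂ v v)‖ := by
    intro v hv
    rcases approx_proj_dichotomy hε0 hε hφ hcontr (rankOne_starProj v hv) with h | h
    swap
    · exact h
    exfalso
    let b := EuclideanSpace.basisFun (Fin ℓ) ℂ
    have hb : ∀ i, ‖b i‖ = 1 := fun i => b.orthonormal.1 i
    have key : ∀ S : Finset (Fin ℓ),
        IsStarProjection (∑ i ∈ S, InnerProductSpace.rankOne ℂ (b i) (b i) : MatrixAlg ℓ) ∧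
        ‖φ (∑ i ∈ S, InnerProductSpace.rankOne ℂ (b i) (b i))‖ ≤ 3 * ε := by
      intro S
      induction S using Finset.induction_on with
      | empty =>
        have h0 := hadd 0 0 (by simp) (by simp)
        simp only [add_zero, sub_self, zero_sub, norm_neg] at h0
        refine ⟨by simp, ?_⟩
        rw [Finset.sum_empty]
        linarith
      | insert i S hi ih =>
        obtain ⟨ih1, ih2⟩ := ih
        have hP := rankOne_starProj (b i) (hb i)
        have horth : (InnerProductSpace.rankOne ℂ (b i) (b i) : MatrixAlg ℓ) *
            (∑ j ∈ S, InnerProductSpace.rankOne ℂ (b j) (b j)) = 0 := by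
          rw [Finset.mul_sum]
          refine Finset.sum_eq_zero fun j hj => ?_
          have hij : i ≠ j := by rintro rfl; exact hi hj
          ext1 z
          have := b.orthonormal.2 hij
          simp [this]
        have hproj := hP.add ih1 horth
        rw [Finset.sum_insert hi]
        refine ⟨hproj, ?_⟩
        have h1 := hadd _ _ (starProj_norm_le_one hP) (starProj_norm_le_one ih1)
        have h2 := hswap v (b i) hv (hb i) h
        rcases approx_proj_dichotomy hε0 hε hφ hcontr hproj with h3 | h3
        · exact h3
        · rw [sub_sub] at h1
          have h4 := norm_sub_norm_le (φ (InnerProductSpace.rankOne ℂ (b i) (b i) +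
            ∑ j ∈ S, InnerProductSpace.rankOne ℂ (b j) (b j)))
            (φ (InnerProductSpace.rankOne ℂ (b i) (b i)) +
              φ (∑ j ∈ S, InnerProductSpace.rankOne ℂ (b j) (b j)))
          have h5 := norm_add_le (φ (InnerProductSpace.rankOne ℂ (b i) (b i)))
              (φ (∑ j ∈ S, InnerProductSpace.rankOne ℂ (b j) (b j)))
          linarith
    have hfin := (key Finset.univ).2
    rw [b.sum_rankOne_eq_id] at hfin
    exact absurd hfin (not_le.2 hone)
  intro x hx
  have hup := hcontr x hx.le
  refine ⟨?_, by linarith⟩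
  obtain ⟨v, hv, hw⟩ := exists_unit_norm_eq x hx
  have hP := rankOne_starProj v hv
  have h1 := hmul x _ hx.le (starProj_norm_le_one hP)
  have e : x * InnerProductSpace.rankOne ℂ v v = InnerProductSpace.rankOne ℂ (x v) v := by
    ext1 z
    simp
  rw [e] at h1
  have hu : ‖(InnerProductSpace.rankOne ℂ (x v) v : MatrixAlg ℓ)‖ ≤ 1 := by simp [hv, hw]
  obtain ⟨h2, -⟩ := approx_star_mul hφ hcontr _ hu
  have e1 : star (InnerProductSpace.rankOne ℂ (x v) v : MatrixAlg ℓ)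
      * InnerProductSpace.rankOne ℂ (x v) v = InnerProductSpace.rankOne ℂ v v := by
    ext1 z
    simp [ContinuousLinearMap.star_eq_adjoint, hw]
  rw [e1, abs_le] at h2
  have h3 := hlarge v hv
  have h4 := hcontr _ hu
  have h5 := norm_sub_norm_le (φ (InnerProductSpace.rankOne ℂ (x v) v))
    (φ x * φ (InnerProductSpace.rankOne ℂ v v))
  have h6 := norm_mul_le (φ x) (φ (InnerProductSpace.rankOne ℂ v v))
  have h7 := hcontr _ (starProj_norm_le_one hP)
  have h8 : ‖φ x‖ * ‖φ (InnerProductSpace.rankOne ℂ v v)‖ ≤ ‖φ x‖ :=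
    mul_le_of_le_one_right (norm_nonneg _) h7
  have h9 : ‖φ (InnerProductSpace.rankOne ℂ (x v) v)‖ ^ 2
      ≤ ‖φ (InnerProductSpace.rankOne ℂ (x v) v)‖ := by
    nlinarith [norm_nonneg (φ (InnerProductSpace.rankOne ℂ (x v) v))]
  nlinarith
end
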